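/- arXiv:2306.05054 — 4 statements merged into one kernel-verified Lean document; each statement's English description precedes it below -/
import Mathlib

section
/- For every fixed real α with 1/4 ≤ α ≤ 1 and every η > 0 there exists n₀ such that for all integers n ≥ n₀ the following two statements hold. (Upper bound) For every N ≥ ((√α + 1)² + η)·n, every simple graph R on N vertices either contains a book B_{⌈αn⌉} or its complement contains a book B_n. (Lower bound) There exists a simple graph R on ⌊((√α + 1)² − η)·n⌋ vertices such that R contains no book B_{⌈αn⌉} and the complement of R contains no book B_n. Equivalently, the Ramsey number satisfies r(B_{⌈αn⌉}, B_n) = (√α + 1)²·n + o(n). -/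
/-- A simple graph `G` contains the book `B_m`: two adjacent vertices with at
least `m` common neighbors. -/
def HasBook {V : Type*} (G : SimpleGraph V) (m : ℕ) : Prop :=
  ∃ u v : V, G.Adj u v ∧ m ≤ ({w | G.Adj u w ∧ G.Adj v w} : Set V).ncard

section RandomGraph

open MeasureTheory ProbabilityTheory

/-- Sums of indicators of monochromatic disjoint pairs of coordinates are sub-Gaussian. -/
lemma hasSubgaussianMGF_sum_pairs {E W : Type*} [Fintype E] [DecidableEq E] [DecidableEq W]
    (ν : Measure Bool) [IsProbabilityMeasure ν] (c : Bool) (a b : W → E)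
    (hab : ∀ w, a w ≠ b w)
    (hdisj : ∀ w w', w ≠ w' → Disjoint ({a w, b w} : Finset E) {a w', b w'}) (s : Finset W) :
    HasSubgaussianMGF
      (fun ω : E → Bool ↦ ∑ w ∈ s,
        ((if ω (a w) = c ∧ ω (b w) = c then (1 : ℝ) else 0) - ν.real {c} ^ 2))
      (s.card * (1 / 2) ^ 2) (Measure.pi fun _ : E ↦ ν) := by
  have hind : iIndepFun (fun (i : E) (ω : E → Bool) ↦ ω i) (Measure.pi fun _ : E ↦ ν) :=
    iIndepFun_pi (X := fun _ ↦ id) fun _ ↦ aemeasurable_id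
  have hone : ∀ w, HasSubgaussianMGF (fun ω : E → Bool ↦
      (if ω (a w) = c ∧ ω (b w) = c then (1 : ℝ) else 0) - ν.real {c} ^ 2)
      ((1 / 2) ^ 2) (Measure.pi fun _ : E ↦ ν) := by
    intro w
    have hmean : ∫ ω : E → Bool, (if ω (a w) = c ∧ ω (b w) = c then (1 : ℝ) else 0)
        ∂(Measure.pi fun _ : E ↦ ν) = ν.real {c} ^ 2 := by
      have h1 : (fun ω : E → Bool ↦ if ω (a w) = c ∧ ω (b w) = c then (1 : ℝ) else 0) =
          Set.indicator ((fun ω ↦ ω (a w)) ⁻¹' {c} ∩ (fun ω ↦ ω (b w)) ⁻¹' {c}) 1 := by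
        ext ω
        simp only [Set.indicator, Set.mem_inter_iff, Set.mem_preimage, Set.mem_singleton_iff,
          Pi.one_apply]
      have h2 := (hind.indepFun (hab w)).measure_inter_preimage_eq_mul {c} {c}
        (measurableSet_singleton c) (measurableSet_singleton c)
      have h3 : ∀ e : E, (Measure.pi fun _ : E ↦ ν) ((fun ω : E → Bool ↦ ω e) ⁻¹' {c}) = ν {c} :=
        fun e ↦ (measurePreserving_eval (fun _ : E ↦ ν) e).measure_preimage
          (measurableSet_singleton c).nullMeasurableSet
      rw [h1, integral_indicator_one (by measurability), Measure.real, h2, h3, h3,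
        ENNReal.toReal_mul, sq, Measure.real]
    have := hasSubgaussianMGF_of_mem_Icc (μ := Measure.pi fun _ : E ↦ ν) (a := 0) (b := 1)
      (X := fun ω : E → Bool ↦ if ω (a w) = c ∧ ω (b w) = c then (1 : ℝ) else 0)
      (measurable_of_finite _).aemeasurable
      (Filter.Eventually.of_forall fun ω ↦ by split_ifs <;> simp)
    rw [hmean] at this
    simp only [sub_zero, nnnorm_one] at this
    exact this
  induction s using Finset.induction_on with
  | empty => simp
  | insert w s hw ih =>
    have hI : IndepFun (fun ω : E → Bool ↦
          (if ω (a w) = c ∧ ω (b w) = c then (1 : ℝ) else 0) - ν.real {c} ^ 2)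
        (fun ω : E → Bool ↦ ∑ w ∈ s,
          ((if ω (a w) = c ∧ ω (b w) = c then (1 : ℝ) else 0) - ν.real {c} ^ 2))
        (Measure.pi fun _ : E ↦ ν) := by
      have hST : Disjoint ({a w, b w} : Finset E) (s.biUnion fun w' ↦ {a w', b w'}) := by
        rw [Finset.disjoint_biUnion_right]
        exact fun w' hw' ↦ hdisj _ _ fun h ↦ hw (h ▸ hw')
      have h := hind.indepFun_finset _ _ hST fun i ↦ measurable_pi_apply i
      have hmem : ∀ w' : s, a w' ∈ s.biUnion (fun w' ↦ ({a w', b w'} : Finset E)) ∧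
          b w' ∈ s.biUnion (fun w' ↦ ({a w', b w'} : Finset E)) := fun w' ↦
        ⟨Finset.mem_biUnion.2 ⟨w', w'.2, by simp⟩, Finset.mem_biUnion.2 ⟨w', w'.2, by simp⟩⟩
      have := h.comp
        (φ := fun x ↦ (if x ⟨a w, by simp⟩ = c ∧ x ⟨b w, by simp⟩ = c then (1 : ℝ) else 0) -
          ν.real {c} ^ 2)
        (ψ := fun x ↦ ∑ w' : s, ((if x ⟨a w', (hmem w').1⟩ = c ∧ x ⟨b w', (hmem w').2⟩ = c
          then (1 : ℝ) else 0) - ν.real {c} ^ 2))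
        (measurable_of_finite _) (measurable_of_finite _)
      have hsum : (fun ω : E → Bool ↦ ∑ w ∈ s,
          ((if ω (a w) = c ∧ ω (b w) = c then (1 : ℝ) else 0) - ν.real {c} ^ 2)) =
          fun ω ↦ ∑ w : s, ((if ω (a w) = c ∧ ω (b w) = c then (1 : ℝ) else 0) -
            ν.real {c} ^ 2) := funext fun ω ↦ (Finset.sum_coe_sort s (fun w ↦
              ((if ω (a w) = c ∧ ω (b w) = c then (1 : ℝ) else 0) - ν.real {c} ^ 2))).symm
      rw [hsum]
      exact this
    have := (hone w).add_of_indepFun ih hI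
    simp only [Finset.sum_insert hw, Finset.card_insert_of_notMem hw]
    convert this using 1
    push_cast
    ring

/-- A random graph of density `p` has few common neighbors and few common non-neighbors. -/
lemma exists_graph_codegree_lt (p : ℝ) (hp0 : 0 ≤ p) (hp1 : p ≤ 1) (ε : ℝ) (hε : 0 < ε) :
    ∃ N₀ : ℕ, ∀ N : ℕ, N₀ ≤ N → ∃ R : SimpleGraph (Fin N), ∀ u v, u ≠ v →
      ((({w | R.Adj u w ∧ R.Adj v w} : Set (Fin N)).ncard : ℝ) < (p ^ 2 + ε) * N) ∧
      ((({w | Rᶜ.Adj u w ∧ Rᶜ.Adj v w} : Set (Fin N)).ncard : ℝ) < ((1 - p) ^ 2 + ε) * N) := by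
  have hlim := ((Real.tendsto_pow_mul_exp_neg_atTop_nhds_zero 2).comp
    (tendsto_natCast_atTop_atTop.const_mul_atTop (show 0 < 2 * ε ^ 2 by positivity))).eventually
    (gt_mem_nhds (show (0 : ℝ) < (2 * ε ^ 2) ^ 2 / 2 by positivity))
  obtain ⟨N₀, hN₀⟩ := Filter.eventually_atTop.1 hlim
  refine ⟨N₀ + 3, fun N hN ↦ ?_⟩
  have hexp : (N : ℝ) ^ 2 * Real.exp (-(2 * ε ^ 2 * N)) < 1 / 2 := by
    have h := hN₀ N (by omega)
    simp only [Function.comp, mul_pow] at h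
    have h4 : (0 : ℝ) < 2 ^ 2 * (ε ^ 2) ^ 2 := by positivity
    refine lt_of_mul_lt_mul_left ?_ h4.le
    linarith
  set ν : Measure Bool := bernoulliMeasure true false ⟨p, hp0, hp1⟩ with hν
  have hνt : ν.real {true} = p := by simp [hν]
  have hνf : ν.real {false} = 1 - p := by simp [hν]
  set μ := Measure.pi fun _ : Sym2 (Fin N) ↦ ν with hμ
  let S : Fin N → Fin N → Finset (Fin N) := fun u v ↦ {w | w ≠ u ∧ w ≠ v}
  let bad : Fin N × Fin N × Bool → Set (Sym2 (Fin N) → Bool) := fun t ↦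
    if t.1 = t.2.1 then ∅ else {ω | ε * N ≤ ∑ w ∈ S t.1 t.2.1,
      ((if ω s(t.1, w) = t.2.2 ∧ ω s(t.2.1, w) = t.2.2 then (1 : ℝ) else 0) -
        ν.real {t.2.2} ^ 2)}
  have hbad : ∀ t, μ.real (bad t) ≤ Real.exp (-(2 * ε ^ 2 * N)) := by
    rintro ⟨u, v, c⟩
    simp only [bad]
    split_ifs with huv
    · simp [Real.exp_nonneg]
    have h := (hasSubgaussianMGF_sum_pairs (E := Sym2 (Fin N)) ν c (fun w : S u v ↦ s(u, w.1))
      (fun w ↦ s(v, w.1)) ?_ ?_ Finset.univ).measure_ge_le (ε := ε * N) (by positivity)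
    · have hcast : ∀ ω : Sym2 (Fin N) → Bool,
          ∑ w ∈ S u v, ((if ω s(u, w) = c ∧ ω s(v, w) = c then (1 : ℝ) else 0) -
            ν.real {c} ^ 2) =
          ∑ w : S u v, ((if ω s(u, w.1) = c ∧ ω s(v, w.1) = c then (1 : ℝ) else 0) -
            ν.real {c} ^ 2) := fun ω ↦ (Finset.sum_coe_sort _ (fun w ↦
              ((if ω s(u, w) = c ∧ ω s(v, w) = c then (1 : ℝ) else 0) - ν.real {c} ^ 2))).symm
      simp only [hcast]
      refine h.trans (Real.exp_le_exp.2 ?_)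
      have hSN : ((S u v).card : ℝ) ≤ N := by
        exact_mod_cast (Finset.card_le_univ _).trans (Fintype.card_fin N).le
      have hSpos : (0 : ℝ) < (S u v).card := by
        have : ∃ w : Fin N, w ∉ ({u, v} : Finset (Fin N)) := by
          by_contra! h
          have h2 := Finset.card_le_card (fun w _ ↦ h w : Finset.univ ⊆ ({u, v} : Finset (Fin N)))
          have h3 := Finset.card_le_two (a := u) (b := v)
          simp at h2
          omega
        obtain ⟨w, hw⟩ := this
        exact_mod_cast Finset.card_pos.2 ⟨w, by simpa [S] using hw⟩
      simp only [Finset.card_univ, Fintype.card_coe]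
      push_cast
      rw [neg_div, neg_le_neg_iff, le_div_iff₀ (by positivity)]
      nlinarith [mul_le_mul_of_nonneg_left hSN (show 0 ≤ ε ^ 2 * N by positivity)]
    · intro w h
      simp only [Sym2.eq_iff] at h
      have := w.2
      simp only [S, Finset.mem_filter, Finset.mem_univ, true_and] at this
      tauto
    · intro w w' hww
      have h1 := w.2
      have h2 := w'.2
      have h3 : w.1 ≠ w'.1 := fun h ↦ hww (Subtype.ext h)
      simp only [S, Finset.mem_filter, Finset.mem_univ, true_and] at h1 h2
      simp only [Finset.disjoint_left, Finset.mem_insert, Finset.mem_singleton]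
      rintro e (rfl | rfl) <;> simp only [Sym2.eq_iff] <;> tauto
  have hsum : μ.real (⋃ t, bad t) < 1 := by
    calc μ.real (⋃ t, bad t) ≤ ∑ t, μ.real (bad t) := measureReal_iUnion_fintype_le _
      _ ≤ ∑ _t : Fin N × Fin N × Bool, Real.exp (-(2 * ε ^ 2 * N)) :=
        Finset.sum_le_sum fun t _ ↦ hbad t
      _ = 2 * ((N : ℝ) ^ 2 * Real.exp (-(2 * ε ^ 2 * N))) := by
        simp
        ring
      _ < 1 := by linarith
  obtain ⟨ω, hω⟩ : ∃ ω, ω ∉ ⋃ t, bad t := by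
    by_contra! h
    rw [Set.eq_univ_of_forall h, probReal_univ] at hsum
    exact lt_irrefl _ hsum
  simp only [Set.mem_iUnion, not_exists] at hω
  have hcount : ∀ u v c, u ≠ v →
      (({w ∈ S u v | ω s(u, w) = c ∧ ω s(v, w) = c} : Finset (Fin N)).card : ℝ) <
        (ν.real {c} ^ 2 + ε) * N := by
    intro u v c huv
    have h := hω (u, v, c)
    simp only [bad, if_neg huv, Set.mem_ofPred_eq, not_le, Finset.sum_sub_distrib,
      Finset.sum_const, nsmul_eq_mul, Finset.sum_boole] at h
    have hS : ((S u v).card : ℝ) ≤ N := by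
      exact_mod_cast (Finset.card_le_univ _).trans (Fintype.card_fin N).le
    nlinarith [mul_le_mul_of_nonneg_right hS (sq_nonneg (ν.real {c}))]
  refine ⟨⟨fun u v ↦ u ≠ v ∧ ω s(u, v) = true,
    ⟨fun u v h ↦ ⟨h.1.symm, by rw [Sym2.eq_swap]; exact h.2⟩⟩, ⟨fun u h ↦ h.1 rfl⟩⟩,
    fun u v huv ↦ ⟨?_, ?_⟩⟩
  · refine lt_of_eq_of_lt ?_ (hνt ▸ hcount u v true huv)
    rw [← Set.ncard_coe_finset]
    congr 2
    ext w
    simp only [S, Finset.coe_filter, Finset.mem_filter, Finset.mem_univ, true_and,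
      Set.mem_ofPred_eq]
    tauto
  · refine lt_of_eq_of_lt ?_ (hνf ▸ hcount u v false huv)
    rw [← Set.ncard_coe_finset]
    congr 2
    ext w
    simp only [S, Finset.coe_filter, Finset.mem_filter, Finset.mem_univ, true_and,
      Set.mem_ofPred_eq, SimpleGraph.compl_adj, not_and, Bool.not_eq_true]
    tauto

end RandomGraph

section Upper

variable {V : Type*}

open Classical in
/-- The indicator of adjacency, as a real number. -/
noncomputable def SimpleGraph.ind (G : SimpleGraph V) (u v : V) : ℝ := if G.Adj u v then 1 else 0

namespace SimpleGraph

variable (G : SimpleGraph V)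

lemma ind_nonneg (u v : V) : 0 ≤ G.ind u v := by
  unfold ind
  split_ifs <;> norm_num

lemma ind_le_one (u v : V) : G.ind u v ≤ 1 := by
  unfold ind
  split_ifs <;> norm_num

lemma ind_of_adj {u v : V} (h : G.Adj u v) : G.ind u v = 1 := if_pos h

lemma ind_of_not_adj {u v : V} (h : ¬ G.Adj u v) : G.ind u v = 0 := if_neg h

end SimpleGraph

lemma avg_one_sub (f : V → V → ℝ) (A : Finset V) (k : ℕ) (hk : 0 < k) (hA : A.card = k) (z : V) :
    (∑ u ∈ A, (1 - f u z)) / k = 1 - (∑ u ∈ A, f u z) / k := by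
  have hk' : (k : ℝ) ≠ 0 := by exact_mod_cast hk.ne'
  rw [Finset.sum_sub_distrib]
  simp only [Finset.sum_const, hA, nsmul_eq_mul, mul_one]
  field_simp

variable [Fintype V]

lemma sum_mul_sum_le (f : V → V → ℝ) (hf0 : ∀ u v, 0 ≤ f u v) (hf1 : ∀ u v, f u v ≤ 1)
    (A B : Finset V) (c : ℝ) (hc : 0 ≤ c)
    (h : ∀ u ∈ A, ∀ v ∈ B, u ≠ v → ∑ z, f u z * f v z ≤ c) :
    ∑ z, (∑ u ∈ A, f u z) * (∑ v ∈ B, f v z) ≤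
      A.card * B.card * c + A.card * Fintype.card V := by
  classical
  have h1 : ∑ z, (∑ u ∈ A, f u z) * (∑ v ∈ B, f v z) =
      ∑ u ∈ A, ∑ v ∈ B, ∑ z, f u z * f v z := by
    simp_rw [Finset.sum_mul_sum]
    rw [Finset.sum_comm]
    exact Finset.sum_congr rfl fun u _ ↦ Finset.sum_comm
  have h2 : ∀ u ∈ A, ∀ v ∈ B,
      ∑ z, f u z * f v z ≤ c + if u = v then (Fintype.card V : ℝ) else 0 := by
    intro u hu v hv
    split_ifs with huv
    · have : ∑ z, f u z * f v z ≤ ∑ _z : V, (1 : ℝ) := Finset.sum_le_sum fun z _ ↦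
        mul_le_one₀ (hf1 u z) (hf0 v z) (hf1 v z)
      simp at this
      linarith
    · simpa using h u hu v hv huv
  have h3 : ∀ u ∈ A, ∑ v ∈ B, (c + if u = v then (Fintype.card V : ℝ) else 0) ≤
      B.card * c + Fintype.card V := by
    intro u _
    rw [Finset.sum_add_distrib, Finset.sum_ite_eq]
    simp only [Finset.sum_const, nsmul_eq_mul]
    split_ifs <;> simp
  rw [h1]
  calc ∑ u ∈ A, ∑ v ∈ B, ∑ z, f u z * f v z
      ≤ ∑ u ∈ A, ((B.card : ℝ) * c + Fintype.card V) := Finset.sum_le_sum fun u hu ↦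
        (Finset.sum_le_sum (h2 u hu)).trans (h3 u hu)
    _ = _ := by
      simp only [Finset.sum_const, nsmul_eq_mul]
      ring

/-- The averaged form of `sum_mul_sum_le`. -/
lemma sum_avg_mul_avg_le (f : V → V → ℝ) (hf0 : ∀ u v, 0 ≤ f u v) (hf1 : ∀ u v, f u v ≤ 1)
    (A B : Finset V) (k : ℕ) (hk : 0 < k) (hA : A.card = k) (hB : B.card = k)
    (c : ℝ) (hc : 0 ≤ c)
    (h : ∀ u ∈ A, ∀ v ∈ B, u ≠ v → ∑ z, f u z * f v z ≤ c) :
    ∑ z, ((∑ u ∈ A, f u z) / k) * ((∑ v ∈ B, f v z) / k) ≤ c + Fintype.card V / k := by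
  have h1 := sum_mul_sum_le f hf0 hf1 A B c hc h
  have hk' : (0 : ℝ) < k := by exact_mod_cast hk
  rw [hA, hB] at h1
  have h2 : ∑ z, ((∑ u ∈ A, f u z) / k) * ((∑ v ∈ B, f v z) / k) =
      (∑ z, (∑ u ∈ A, f u z) * (∑ v ∈ B, f v z)) / (k * k) := by
    rw [Finset.sum_div]
    exact Finset.sum_congr rfl fun z _ ↦ by ring
  rw [h2, div_le_iff₀ (by positivity)]
  refine h1.trans (le_of_eq ?_)
  field_simp

/-- Bounds on the sizes of the books in a graph and in its complement. -/
structure BookBound (R : SimpleGraph V) (a b : ℝ) : Prop where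
  nonneg_left : 0 ≤ a
  nonneg_right : 0 ≤ b
  red : ∀ u v, R.Adj u v → ∑ z, R.ind u z * R.ind v z ≤ a
  blue : ∀ u v, u ≠ v → ¬ R.Adj u v → ∑ z, (1 - R.ind u z) * (1 - R.ind v z) ≤ b

variable {R : SimpleGraph V} {a b : ℝ}

/-- Two red cliques that are completely joined by blue edges give large books. -/
lemma BookBound.le_of_red_red (H : BookBound R a b) (s : ℝ) (hs0 : 0 ≤ s) (hs1 : s ≤ 1)
    (k : ℕ) (hk : 0 < k) (A B : Finset V) (hAk : A.card = k) (hBk : B.card = k)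
    (hA : ∀ u ∈ A, ∀ v ∈ A, u ≠ v → R.Adj u v) (hB : ∀ u ∈ B, ∀ v ∈ B, u ≠ v → R.Adj u v)
    (hAB : ∀ u ∈ A, ∀ v ∈ B, ¬ R.Adj u v) :
    Fintype.card V * (s / (1 + s)) ≤ a + s * b + 2 * (Fintype.card V / k) := by
  have hAA := sum_avg_mul_avg_le R.ind R.ind_nonneg R.ind_le_one A A k hk hAk hAk a H.nonneg_left
    fun u hu v hv huv ↦ H.red u v (hA u hu v hv huv)
  have hBB := sum_avg_mul_avg_le R.ind R.ind_nonneg R.ind_le_one B B k hk hBk hBk a H.nonneg_left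
    fun u hu v hv huv ↦ H.red u v (hB u hu v hv huv)
  have hcross := sum_avg_mul_avg_le (fun u v ↦ 1 - R.ind u v)
    (fun u v ↦ sub_nonneg.2 (R.ind_le_one u v)) (fun u v ↦ sub_le_self _ (R.ind_nonneg u v))
    A B k hk hAk hBk b H.nonneg_right fun u hu v hv huv ↦ H.blue u v huv (hAB u hu v hv)
  simp only [avg_one_sub _ A k hk hAk, avg_one_sub _ B k hk hBk] at hcross
  have hpt : ∀ z, s / (1 + s) ≤ s * ((1 - (∑ u ∈ A, R.ind u z) / k) *
      (1 - (∑ u ∈ B, R.ind u z) / k)) + (((∑ u ∈ A, R.ind u z) / k) *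
      ((∑ u ∈ A, R.ind u z) / k) + ((∑ u ∈ B, R.ind u z) / k) * ((∑ u ∈ B, R.ind u z) / k)) / 2 := by
    intro z
    generalize (∑ u ∈ A, R.ind u z) / (k : ℝ) = x
    generalize (∑ u ∈ B, R.ind u z) / (k : ℝ) = y
    have h1 : 0 < 1 + s := by linarith
    rw [div_le_iff₀ h1]
    nlinarith [sq_nonneg ((1 + s) * (x + y) - 2 * s),
      mul_nonneg (mul_nonneg (sub_nonneg.2 hs1) h1.le) (sq_nonneg (x - y))]
  have hsum := Finset.sum_le_sum fun z (_ : z ∈ Finset.univ) ↦ hpt z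
  simp only [Finset.sum_add_distrib, ← Finset.mul_sum, ← Finset.sum_div, Finset.sum_const,
    Finset.card_univ, nsmul_eq_mul] at hsum
  have hNk : (0 : ℝ) ≤ Fintype.card V / k := by positivity
  rw [mul_div_assoc] at hsum
  nlinarith [mul_le_mul_of_nonneg_left hcross hs0, mul_le_mul_of_nonneg_right hs1 hNk]

/-- Three blue cliques that are completely joined by red edges give large books. -/
lemma BookBound.le_of_blue_blue_blue (H : BookBound R a b) (s : ℝ) (hs0 : 1 / 2 ≤ s) (hs1 : s ≤ 1)
    (k : ℕ) (hk : 0 < k) (A B C : Finset V)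
    (hAk : A.card = k) (hBk : B.card = k) (hCk : C.card = k)
    (hA : ∀ u ∈ A, ∀ v ∈ A, ¬ R.Adj u v) (hB : ∀ u ∈ B, ∀ v ∈ B, ¬ R.Adj u v)
    (hC : ∀ u ∈ C, ∀ v ∈ C, ¬ R.Adj u v) (hAB : ∀ u ∈ A, ∀ v ∈ B, R.Adj u v)
    (hBC : ∀ u ∈ B, ∀ v ∈ C, R.Adj u v) (hAC : ∀ u ∈ A, ∀ v ∈ C, R.Adj u v) :
    Fintype.card V * (s / (1 + s)) ≤ a + s * b + 2 * (Fintype.card V / k) := by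
  have hblue : ∀ A : Finset V, A.card = k → (∀ u ∈ A, ∀ v ∈ A, ¬ R.Adj u v) →
      ∑ z, (1 - (∑ u ∈ A, R.ind u z) / k) * (1 - (∑ u ∈ A, R.ind u z) / k) ≤
        b + Fintype.card V / k := by
    intro A hAk hA
    have h := sum_avg_mul_avg_le (fun u v ↦ 1 - R.ind u v)
      (fun u v ↦ sub_nonneg.2 (R.ind_le_one u v)) (fun u v ↦ sub_le_self _ (R.ind_nonneg u v))
      A A k hk hAk hAk b H.nonneg_right fun u hu v hv huv ↦ H.blue u v huv (hA u hu v hv)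
    simpa only [avg_one_sub _ A k hk hAk] using h
  have hAA := hblue A hAk hA
  have hBB := hblue B hBk hB
  have hCC := hblue C hCk hC
  have hred : ∀ A B : Finset V, A.card = k → B.card = k → (∀ u ∈ A, ∀ v ∈ B, R.Adj u v) →
      ∑ z, ((∑ u ∈ A, R.ind u z) / k) * ((∑ u ∈ B, R.ind u z) / k) ≤
        a + Fintype.card V / k := fun A B hAk hBk h ↦
    sum_avg_mul_avg_le R.ind R.ind_nonneg R.ind_le_one A B k hk hAk hBk a H.nonneg_left
      fun u hu v hv _ ↦ H.red u v (h u hu v hv)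
  have hab := hred A B hAk hBk hAB
  have hbc := hred B C hBk hCk hBC
  have hac := hred A C hAk hCk hAC
  have hpt : ∀ z, 3 * (s / (1 + s)) ≤
      (((∑ u ∈ A, R.ind u z) / k) * ((∑ u ∈ B, R.ind u z) / k) +
        ((∑ u ∈ B, R.ind u z) / k) * ((∑ u ∈ C, R.ind u z) / k) +
        ((∑ u ∈ A, R.ind u z) / k) * ((∑ u ∈ C, R.ind u z) / k)) +
      s * ((1 - (∑ u ∈ A, R.ind u z) / k) * (1 - (∑ u ∈ A, R.ind u z) / k) +
        (1 - (∑ u ∈ B, R.ind u z) / k) * (1 - (∑ u ∈ B, R.ind u z) / k) +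
        (1 - (∑ u ∈ C, R.ind u z) / k) * (1 - (∑ u ∈ C, R.ind u z) / k)) := by
    intro z
    generalize (∑ u ∈ A, R.ind u z) / (k : ℝ) = x
    generalize (∑ u ∈ B, R.ind u z) / (k : ℝ) = y
    generalize (∑ u ∈ C, R.ind u z) / (k : ℝ) = w
    have h1 : 0 < 1 + s := by linarith
    rw [← mul_div_assoc, div_le_iff₀ h1]
    have h2 : 0 ≤ (2 * s - 1) * (1 + s) := mul_nonneg (by linarith) h1.le
    nlinarith [sq_nonneg ((1 + s) * (x + y + w) - 3 * s), mul_nonneg h2 (sq_nonneg (x - y)),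
      mul_nonneg h2 (sq_nonneg (y - w)), mul_nonneg h2 (sq_nonneg (x - w))]
  have hsum := Finset.sum_le_sum fun z (_ : z ∈ Finset.univ) ↦ hpt z
  simp only [Finset.sum_add_distrib, ← Finset.mul_sum, Finset.sum_const,
    Finset.card_univ, nsmul_eq_mul] at hsum
  have hNk : (0 : ℝ) ≤ Fintype.card V / k := by positivity
  nlinarith [mul_le_mul_of_nonneg_left (add_le_add (add_le_add hAA hBB) hCC)
    (show (0 : ℝ) ≤ s by linarith), mul_le_mul_of_nonneg_right hs1 hNk]

/-- A set in which almost all pairs are edges spans a book of almost its size. -/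
lemma card_sq_le_of_few_nonadj (G : SimpleGraph V) (c δ : ℝ)
    (hG : ∀ u v, G.Adj u v → ∑ z, G.ind u z * G.ind v z ≤ c) (hc : 0 ≤ c) (S : Finset V)
    (h : ∑ u ∈ S, ∑ v ∈ S, (1 - G.ind u v) ≤ δ) :
    (S.card : ℝ) ^ 2 ≤ c * S.card + 3 * δ := by
  rcases S.eq_empty_or_nonempty with rfl | hS
  · simp at h ⊢
    exact h
  have h1 : ∀ u ∈ S, ∀ v ∈ S,
      ∑ z ∈ S, (1 - (1 - G.ind u v) - (1 - G.ind u z) - (1 - G.ind v z)) ≤ c := by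
    intro u _ v _
    by_cases huv : G.Adj u v
    · calc ∑ z ∈ S, (1 - (1 - G.ind u v) - (1 - G.ind u z) - (1 - G.ind v z))
          ≤ ∑ z ∈ S, G.ind u z * G.ind v z := Finset.sum_le_sum fun z _ ↦ by
            rw [G.ind_of_adj huv]
            nlinarith [mul_nonneg (sub_nonneg.2 (G.ind_le_one u z))
              (sub_nonneg.2 (G.ind_le_one v z))]
        _ ≤ ∑ z, G.ind u z * G.ind v z := Finset.sum_le_sum_of_subset_of_nonneg
            (Finset.subset_univ _) fun z _ _ ↦ mul_nonneg (G.ind_nonneg u z) (G.ind_nonneg v z)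
        _ ≤ c := hG u v huv
    · refine (Finset.sum_nonpos fun z _ ↦ ?_).trans hc
      rw [G.ind_of_not_adj huv]
      linarith [G.ind_le_one u z, G.ind_le_one v z]
  have h2 := Finset.sum_le_sum fun u hu ↦ Finset.sum_le_sum (h1 u hu)
  have h3 : ∑ u ∈ S, ∑ v ∈ S, ∑ z ∈ S,
      (1 - (1 - G.ind u v) - (1 - G.ind u z) - (1 - G.ind v z)) =
      (S.card : ℝ) ^ 3 - 3 * S.card * ∑ u ∈ S, ∑ v ∈ S, (1 - G.ind u v) := by
    have e1 : ∑ u ∈ S, ∑ v ∈ S, ∑ z ∈ S, (1 - G.ind u v) =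
        S.card * ∑ u ∈ S, ∑ v ∈ S, (1 - G.ind u v) := by
      simp only [Finset.sum_const, nsmul_eq_mul, Finset.mul_sum]
    have e2 : ∑ u ∈ S, ∑ _v ∈ S, ∑ z ∈ S, (1 - G.ind u z) =
        S.card * ∑ u ∈ S, ∑ v ∈ S, (1 - G.ind u v) := by
      simp only [Finset.sum_const, nsmul_eq_mul, Finset.mul_sum]
    have e3 : ∑ _u ∈ S, ∑ v ∈ S, ∑ z ∈ S, (1 - G.ind v z) =
        S.card * ∑ u ∈ S, ∑ v ∈ S, (1 - G.ind u v) := by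
      simp only [Finset.sum_const, nsmul_eq_mul]
    have e0 : ∑ _u ∈ S, ∑ _v ∈ S, ∑ _z ∈ S, (1 : ℝ) = (S.card : ℝ) ^ 3 := by
      simp only [Finset.sum_const, nsmul_eq_mul]
      ring
    calc _ = ∑ u ∈ S, ∑ v ∈ S, (∑ _z ∈ S, (1 : ℝ) - ∑ _z ∈ S, (1 - G.ind u v) -
          ∑ z ∈ S, (1 - G.ind u z) - ∑ z ∈ S, (1 - G.ind v z)) := by
          simp only [← Finset.sum_sub_distrib]
      _ = _ := by
          simp only [Finset.sum_sub_distrib (f := fun v ↦ _ - _ - _),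
            Finset.sum_sub_distrib (f := fun v ↦ _ - _), Finset.sum_sub_distrib]
          simp only [Finset.sum_sub_distrib] at e0 e1 e2 e3
          linarith
  have hSpos : (0 : ℝ) < S.card := by exact_mod_cast hS.card_pos
  rw [h3] at h2
  simp only [Finset.sum_const, nsmul_eq_mul] at h2
  refine le_of_mul_le_mul_left ?_ hSpos
  nlinarith [mul_le_mul_of_nonneg_left h (show (0 : ℝ) ≤ 3 * S.card by positivity)]

end Upper

section Counting

universe u v

lemma sum_le_card_mul_add {ι : Type*} (s : Finset ι) (f : ι → ℝ) (t c : ℝ) (ht : 0 ≤ t)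
    (hf : ∀ i ∈ s, f i ≤ c) :
    ∑ i ∈ s, f i ≤ t * s.card + c * (s.filter fun i ↦ t ≤ f i).card := by
  classical
  rw [← Finset.sum_filter_add_sum_filter_not s (fun i ↦ t ≤ f i)]
  have h1 : ∑ i ∈ s with t ≤ f i, f i ≤ c * (s.filter fun i ↦ t ≤ f i).card := by
    rw [mul_comm, ← nsmul_eq_mul]
    exact Finset.sum_le_card_nsmul _ _ _ fun i hi ↦ hf i (Finset.mem_filter.1 hi).1
  have h2 : ∑ i ∈ s with ¬ t ≤ f i, f i ≤ t * (s.filter fun i ↦ ¬ t ≤ f i).card := by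
    rw [mul_comm, ← nsmul_eq_mul]
    exact Finset.sum_le_card_nsmul _ _ _ fun i hi ↦ (not_le.1 (Finset.mem_filter.1 hi).2).le
  have h3 : ((s.filter fun i ↦ ¬ t ≤ f i).card : ℝ) ≤ s.card := by
    exact_mod_cast Finset.card_filter_le _ _
  nlinarith [mul_le_mul_of_nonneg_left h3 ht]

open Classical in
/-- Among many dense subsets of a finite set, some `k` have a large common intersection. -/
lemma exists_large_common_intersection (ε : ℝ) (hε : 0 < ε) (k : ℕ) :
    ∃ (M₀ : ℕ) (δ : ℝ), 0 < δ ∧ ∀ (ι : Type u) (U : Type v) (X : Finset U) (Y : Finset ι)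
      (r : ι → U → Prop) (N : ℝ), 0 < N → (X.card : ℝ) ≤ N → M₀ ≤ Y.card →
      ε * Y.card * N ≤ ∑ y ∈ Y, ((X.filter (r y)).card : ℝ) →
      ∃ B ⊆ Y, B.card = k ∧ δ * N ≤ (X.filter fun x ↦ ∀ y ∈ B, r y x).card := by
  obtain ⟨m, hm⟩ := exists_nat_gt (4 * k / ε)
  have hm0 : (0 : ℝ) < m := lt_of_le_of_lt (by positivity) hm
  rw [div_lt_iff₀ hε] at hm
  obtain ⟨M₀, hM₀⟩ := exists_nat_gt (2 * m / ε)
  rw [div_lt_iff₀ hε] at hM₀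
  refine ⟨M₀, ε / 4 / 2 ^ m, by positivity, fun ι U X Y r N hN hX hY h ↦ ?_⟩
  have h1 := sum_le_card_mul_add Y (fun y ↦ ((X.filter (r y)).card : ℝ)) (ε / 2 * N) N
    (by positivity) fun y _ ↦ (Nat.cast_le.2 (Finset.card_filter_le _ _)).trans hX
  have h2 : m ≤ (Y.filter fun y ↦ ε / 2 * N ≤ ((X.filter (r y)).card : ℝ)).card := by
    have hY' : (M₀ : ℝ) ≤ Y.card := by exact_mod_cast hY
    have : (m : ℝ) * N ≤ N * (Y.filter fun y ↦ ε / 2 * N ≤ ((X.filter (r y)).card : ℝ)).card := by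
      nlinarith [mul_le_mul_of_nonneg_left hY' (mul_pos hε hN).le, mul_pos hm0 hN]
    rw [mul_comm] at this
    exact_mod_cast le_of_mul_le_mul_left this hN
  obtain ⟨Y', hY', hY'm⟩ := Finset.exists_subset_card_eq h2
  have h3 : ∑ y ∈ Y', ((X.filter (r y)).card : ℝ) = ∑ x ∈ X, ((Y'.filter (r · x)).card : ℝ) := by
    exact_mod_cast Finset.sum_card_bipartiteAbove_eq_sum_card_bipartiteBelow (s := Y') (t := X) r
  have h4 : m * (ε / 2 * N) ≤ ∑ y ∈ Y', ((X.filter (r y)).card : ℝ) := by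
    rw [← hY'm, ← nsmul_eq_mul]
    exact Finset.card_nsmul_le_sum _ _ _ fun y hy ↦ (Finset.mem_filter.1 (hY' hy)).2
  have h5 := sum_le_card_mul_add X (fun x ↦ ((Y'.filter (r · x)).card : ℝ)) k m
    (by positivity) fun x _ ↦ by rw [← hY'm]; exact_mod_cast Finset.card_filter_le _ _
  set X' := X.filter fun x ↦ (k : ℝ) ≤ ((Y'.filter (r · x)).card : ℝ) with hX'
  have h6 : ε / 4 * N ≤ X'.card := by
    have : (m : ℝ) * (ε / 4 * N) ≤ m * X'.card := by
      nlinarith [mul_le_mul_of_nonneg_left hX (Nat.cast_nonneg (α := ℝ) k)]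
    exact le_of_mul_le_mul_left this hm0
  have h7 : X' ⊆ (Y'.powersetCard k).biUnion fun B ↦ X.filter fun x ↦ ∀ y ∈ B, r y x := by
    intro x hx
    obtain ⟨hx1, hx2⟩ := Finset.mem_filter.1 hx
    obtain ⟨B, hB, hBk⟩ := Finset.exists_subset_card_eq (Nat.cast_le.1 hx2)
    refine Finset.mem_biUnion.2 ⟨B, Finset.mem_powersetCard.2
      ⟨hB.trans (Finset.filter_subset _ _), hBk⟩, Finset.mem_filter.2 ⟨hx1, fun y hy ↦ ?_⟩⟩
    exact (Finset.mem_filter.1 (hB hy)).2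
  by_contra! hcon
  have h8 : ∀ B ∈ Y'.powersetCard k,
      ((X.filter fun x ↦ ∀ y ∈ B, r y x).card : ℝ) < ε / 4 / 2 ^ m * N := fun B hB ↦
    hcon B ((Finset.mem_powersetCard.1 hB).1.trans (hY'.trans (Finset.filter_subset _ _)))
      (Finset.mem_powersetCard.1 hB).2
  have h9 : (X'.card : ℝ) ≤
      ∑ B ∈ Y'.powersetCard k, ((X.filter fun x ↦ ∀ y ∈ B, r y x).card : ℝ) := by
    exact_mod_cast (Finset.card_le_card h7).trans Finset.card_biUnion_le
  have hne : (Y'.powersetCard k).Nonempty := by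
    rw [Finset.nonempty_iff_ne_empty]
    intro h0
    rw [h0, Finset.sum_empty] at h9
    linarith [mul_pos hε hN]
  have h10 := Finset.sum_lt_sum_of_nonempty hne h8
  rw [Finset.sum_const, nsmul_eq_mul] at h10
  have h11 : ((Y'.powersetCard k).card : ℝ) ≤ 2 ^ m := by
    rw [← hY'm]
    rw [Finset.card_powersetCard]
    exact_mod_cast Nat.choose_le_two_pow _ _
  have h12 : ((Y'.powersetCard k).card : ℝ) * (ε / 4 / 2 ^ m * N) ≤
      2 ^ m * (ε / 4 / 2 ^ m * N) := mul_le_mul_of_nonneg_right h11 (by positivity)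
  have h13 : (2 : ℝ) ^ m * (ε / 4 / 2 ^ m * N) = ε / 4 * N := by field_simp
  linarith

open Classical in
/-- A dense relation on the union of a family of disjoint large sets contains a complete
bipartite pair of `k`-sets, each lying inside a member of the family. -/
lemma exists_complete_pair (ε : ℝ) (hε : 0 < ε) (k : ℕ) :
    ∃ M₁ : ℕ, ∀ M ≥ M₁, ∀ (V : Type u) [Fintype V] [Nonempty V] (F : Finset (Finset V))
      (r : V → V → Prop), (F : Set (Finset V)).PairwiseDisjoint id → (∀ Q ∈ F, Q.card = M) →
      ε * (Fintype.card V : ℝ) ^ 2 ≤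
        ∑ y ∈ F.biUnion id, (((F.biUnion id).filter (r y)).card : ℝ) →
      ∃ Y ∈ F, ∃ Z ∈ F, ∃ B ⊆ Y, ∃ A ⊆ Z, B.card = k ∧ A.card = k ∧ ∀ y ∈ B, ∀ x ∈ A, r y x := by
  obtain ⟨M₀, δ, hδ, hI⟩ := exists_large_common_intersection.{u, u} ε hε k
  obtain ⟨M₁, hM₁⟩ := exists_nat_gt (k / δ)
  rw [div_lt_iff₀ hδ] at hM₁
  refine ⟨max M₀ M₁, fun M hM V _ _ F r hF hFM h ↦ ?_⟩
  set T := F.biUnion id with hT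
  have hN : (0 : ℝ) < Fintype.card V := by exact_mod_cast Fintype.card_pos
  have hTN : (T.card : ℝ) ≤ Fintype.card V := by exact_mod_cast Finset.card_le_univ T
  have hTM : (T.card : ℝ) = F.card * M := by
    rw [hT, Finset.card_biUnion fun x hx y hy hxy ↦ hF hx hy hxy]
    push_cast
    rw [Finset.sum_congr rfl fun Q hQ ↦ by rw [id, hFM Q hQ], Finset.sum_const, nsmul_eq_mul]
  have hFne : F.Nonempty := by
    rw [Finset.nonempty_iff_ne_empty]
    rintro rfl
    simp only [hT, Finset.biUnion_empty, Finset.sum_empty] at h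
    nlinarith [mul_pos hε (pow_pos hN 2)]
  have hM₁' : (M₁ : ℝ) ≤ M := by exact_mod_cast (le_max_right _ _).trans hM
  have h1 : ∑ y ∈ T, ((T.filter (r y)).card : ℝ) =
      ∑ Y ∈ F, ∑ y ∈ Y, ((T.filter (r y)).card : ℝ) :=
    Finset.sum_biUnion hF
  obtain ⟨Y, hYF, hY⟩ : ∃ Y ∈ F, ε * Fintype.card V * M ≤ ∑ y ∈ Y, ((T.filter (r y)).card : ℝ) := by
    refine Finset.exists_le_of_sum_le hFne ?_
    rw [← h1, Finset.sum_const, nsmul_eq_mul]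
    refine le_trans ?_ h
    have := mul_le_mul_of_nonneg_left (hTM ▸ hTN) (mul_pos hε hN).le
    linarith
  obtain ⟨B, hBY, hBk, hB⟩ := hI V V T Y r (Fintype.card V) hN hTN
    ((le_max_left _ _).trans (hM.trans (hFM Y hYF).ge)) (by rw [hFM Y hYF]; linarith)
  suffices ∃ Z ∈ F, k ≤ (Z.filter fun x ↦ ∀ y ∈ B, r y x).card by
    obtain ⟨Z, hZ, hkZ⟩ := this
    obtain ⟨A, hA, hAk⟩ := Finset.exists_subset_card_eq hkZ
    exact ⟨Y, hYF, Z, hZ, B, hBY, A, hA.trans (Finset.filter_subset _ _), hBk, hAk,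
      fun y hy x hx ↦ (Finset.mem_filter.1 (hA hx)).2 y hy⟩
  by_contra! hcon
  have h2 : δ * Fintype.card V ≤ F.card * k := by
    refine hB.trans ?_
    rw [hT, Finset.filter_biUnion]
    refine (Nat.cast_le.2 (Finset.card_biUnion_le_card_mul _ _ k fun Z hZ ↦ ?_)).trans_eq
      (Nat.cast_mul _ _)
    refine le_of_eq_of_le ?_ (hcon Z hZ).le
    simp only [id]
    congr!
  have hFpos : (0 : ℝ) < F.card := by exact_mod_cast hFne.card_pos
  have h3 := mul_le_mul_of_nonneg_left (hTM ▸ hTN) hδ.le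
  have h4 := mul_lt_mul_of_pos_left (hM₁.trans_le (mul_le_mul_of_nonneg_right hM₁' hδ.le)) hFpos
  linarith

/-- The multicolour Ramsey theorem for graphs, with prescribed clique sizes. -/
lemma exists_monochromatic_of_sizes {κ : Type v} [Fintype κ] (f : κ → ℕ) :
    ∃ M : ℕ, ∀ (V : Type u) (c : V → V → κ), (∀ u v, c u v = c v u) → ∀ S : Finset V, M ≤ S.card →
      ∃ i, ∃ T ⊆ S, T.card = f i ∧ ∀ u ∈ T, ∀ v ∈ T, u ≠ v → c u v = i := by
  classical
  induction hn : ∑ i, f i using Nat.strong_induction_on generalizing f with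
  | _ n ih =>
    by_cases h0 : ∃ i, f i = 0
    · obtain ⟨i, hi⟩ := h0
      exact ⟨0, fun V c _ S _ ↦ ⟨i, ∅, by simp, by simp [hi], by simp⟩⟩
    push Not at h0
    have hlt : ∀ i, ∑ j, Function.update f i (f i - 1) j < n := by
      intro i
      rw [← hn]
      refine Finset.sum_lt_sum (fun j _ ↦ ?_) ⟨i, Finset.mem_univ i, ?_⟩
      · by_cases hj : j = i
        · subst hj; simp
        · simp [Function.update_of_ne hj]
      · have := h0 i
        simp
        omega
    choose g hg using fun i ↦ ih _ (hlt i) _ rfl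
    refine ⟨∑ i, g i + 1, fun V c hc S hS ↦ ?_⟩
    obtain ⟨v, hv⟩ : S.Nonempty := Finset.card_pos.1 (by omega)
    have hS' : ∑ i, g i ≤ ∑ i, ((S.erase v).filter fun u ↦ c v u = i).card := by
      rw [← Finset.card_eq_sum_card_fiberwise (f := fun u ↦ c v u) (t := Finset.univ)
        (fun _ _ ↦ by simp), Finset.card_erase_of_mem hv]
      omega
    obtain ⟨j, -, hj⟩ := Finset.exists_le_of_sum_le (⟨c v v, Finset.mem_univ _⟩) hS'
    obtain ⟨i, T, hTS, hTc, hT⟩ := hg j V c hc _ hj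
    have hTS' : T ⊆ S := hTS.trans ((Finset.filter_subset _ _).trans (Finset.erase_subset _ _))
    by_cases hij : i = j
    · subst hij
      have hvT : v ∉ T := fun h ↦ by simpa using hTS h
      have hvc : ∀ u ∈ T, c v u = i := fun u hu ↦ (Finset.mem_filter.1 (hTS hu)).2
      refine ⟨i, insert v T, Finset.insert_subset hv hTS', ?_, ?_⟩
      · have := h0 i
        rw [Finset.card_insert_of_notMem hvT, hTc]
        simp
        omega
      · intro u hu w hw huw
        rcases Finset.mem_insert.1 hu with hu | hu <;> rcases Finset.mem_insert.1 hw with hw | hw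
        · exact absurd (hu.trans hw.symm) huw
        · rw [hu]
          exact hvc w hw
        · rw [hw, hc]
          exact hvc u hu
        · exact hT u hu w hw huw
    · exact ⟨i, T, hTS', by rw [hTc, Function.update_of_ne hij], hT⟩

/-- A family of disjoint `M`-subsets of `W` in which all pairs satisfy `P`. -/
structure IsPacking {V : Type*} (P : V → V → Prop) (M : ℕ) (W : Finset V)
    (F : Finset (Finset V)) : Prop where
  disjoint : (F : Set (Finset V)).PairwiseDisjoint id
  card : ∀ Q ∈ F, Q.card = M
  subset : ∀ Q ∈ F, Q ⊆ W
  pair : ∀ Q ∈ F, ∀ u ∈ Q, ∀ v ∈ Q, u ≠ v → P u v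

namespace IsPacking

variable {V : Type*} {P : V → V → Prop} {M : ℕ} {W W' : Finset V} {F : Finset (Finset V)}

lemma mono (h : IsPacking P M W F) (hW : W ⊆ W') : IsPacking P M W' F :=
  ⟨h.disjoint, h.card, fun Q hQ ↦ (h.subset Q hQ).trans hW, h.pair⟩

lemma empty : IsPacking P M W ∅ := ⟨by simp, by simp, by simp, by simp⟩

lemma insert [DecidableEq V] {Q : Finset V} (h : IsPacking P M (W \ Q) F) (hQW : Q ⊆ W)
    (hQ : Q.card = M) (hP : ∀ u ∈ Q, ∀ v ∈ Q, u ≠ v → P u v) :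
    IsPacking P M W (insert Q F) where
  disjoint := by
    rw [Finset.coe_insert]
    refine h.disjoint.insert fun Q' hQ' _ ↦ ?_
    exact Finset.disjoint_sdiff.mono_right (h.subset Q' hQ')
  card := Finset.forall_mem_insert _ _ _ |>.2 ⟨hQ, h.card⟩
  subset := Finset.forall_mem_insert _ _ _ |>.2
    ⟨hQW, fun Q' hQ' ↦ (h.subset Q' hQ').trans Finset.sdiff_subset⟩
  pair := Finset.forall_mem_insert _ _ _ |>.2 ⟨hP, h.pair⟩

lemma card_biUnion_insert [DecidableEq V] {Q : Finset V} (h : IsPacking P M (W \ Q) F) :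
    ((Insert.insert Q F).biUnion id).card = Q.card + (F.biUnion id).card := by
  rw [Finset.biUnion_insert, Finset.card_union_of_disjoint]
  · rfl
  · exact (Finset.disjoint_biUnion_right _ _ _).2 fun Q' hQ' ↦
      Finset.disjoint_sdiff.mono_right (h.subset Q' hQ')

end IsPacking

/-- All but boundedly many vertices are covered by two packings of monochromatic cliques. -/
lemma exists_packings (M : ℕ) (hM : 0 < M) :
    ∃ C : ℕ, ∀ (V : Type u) [DecidableEq V] (R : SimpleGraph V) (W : Finset V),
      ∃ F₁ F₂, IsPacking R.Adj M W F₁ ∧ IsPacking (fun u v ↦ ¬ R.Adj u v) M W F₂ ∧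
        W.card ≤ (F₁.biUnion id).card + (F₂.biUnion id).card + C := by
  classical
  obtain ⟨C, hC⟩ := exists_monochromatic_of_sizes.{u, 0} fun _ : Prop ↦ M
  refine ⟨C, fun V _ R W ↦ ?_⟩
  induction hn : W.card using Nat.strong_induction_on generalizing W with
  | _ n ih =>
    by_cases hW : C ≤ W.card
    · obtain ⟨i, Q, hQW, hQM, hQ⟩ := hC V (fun u v ↦ R.Adj u v)
        (fun u v ↦ propext (R.adj_comm u v)) W hW
      have hsd : (W \ Q).card = W.card - M := by rw [Finset.card_sdiff_of_subset hQW, hQM]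
      have hle : M ≤ W.card := hQM ▸ Finset.card_le_card hQW
      obtain ⟨F₁, F₂, h1, h2, h3⟩ := ih _ (by omega) (W \ Q) rfl
      by_cases hi : i
      · refine ⟨_, F₂, h1.insert hQW hQM fun u hu v hv huv ↦ (hQ u hu v hv huv).symm ▸ hi,
          h2.mono Finset.sdiff_subset, ?_⟩
        rw [h1.card_biUnion_insert]
        omega
      · refine ⟨F₁, _, h1.mono Finset.sdiff_subset,
          h2.insert hQW hQM fun u hu v hv huv ↦ (hQ u hu v hv huv).symm ▸ hi, ?_⟩
        rw [h2.card_biUnion_insert]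
        omega
    · exact ⟨∅, ∅, .empty, .empty, by omega⟩

end Counting

section Variance

variable {ι V : Type*} [Fintype V]

lemma sum_sum_sq_sub_eq (x : ι → V → ℝ) (Q : Finset ι) :
    ∑ y, ∑ z, (Q.card * ∑ i ∈ Q, x i y * x i z - (∑ i ∈ Q, x i y) * ∑ i ∈ Q, x i z) ^ 2 =
      (Q.card : ℝ) ^ 2 * ∑ i ∈ Q, ∑ j ∈ Q, (∑ z, x i z * x j z) ^ 2
        - 2 * Q.card * ∑ i ∈ Q, (∑ j ∈ Q, ∑ z, x i z * x j z) ^ 2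
        + (∑ i ∈ Q, ∑ j ∈ Q, ∑ z, x i z * x j z) ^ 2 := by
  have hrow : ∀ i, ∑ j ∈ Q, ∑ z, x i z * x j z = ∑ z, x i z * ∑ j ∈ Q, x j z := by
    intro i
    rw [Finset.sum_comm]
    simp only [Finset.mul_sum]
  have h1 : ∑ y, ∑ z, (∑ i ∈ Q, x i y * x i z) ^ 2 =
      ∑ i ∈ Q, ∑ j ∈ Q, (∑ z, x i z * x j z) ^ 2 := by
    simp only [sq, Finset.sum_mul_sum]
    calc ∑ y, ∑ z, ∑ i ∈ Q, ∑ j ∈ Q, x i y * x i z * (x j y * x j z)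
        = ∑ y, ∑ i ∈ Q, ∑ z, ∑ j ∈ Q, x i y * x i z * (x j y * x j z) :=
          Finset.sum_congr rfl fun _ _ ↦ Finset.sum_comm
      _ = ∑ i ∈ Q, ∑ y, ∑ z, ∑ j ∈ Q, x i y * x i z * (x j y * x j z) := Finset.sum_comm
      _ = ∑ i ∈ Q, ∑ y, ∑ j ∈ Q, ∑ z, x i y * x i z * (x j y * x j z) :=
          Finset.sum_congr rfl fun _ _ ↦ Finset.sum_congr rfl fun _ _ ↦ Finset.sum_comm
      _ = ∑ i ∈ Q, ∑ j ∈ Q, ∑ y, ∑ z, x i y * x i z * (x j y * x j z) :=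
          Finset.sum_congr rfl fun _ _ ↦ Finset.sum_comm
      _ = _ := by
          refine Finset.sum_congr rfl fun i _ ↦ Finset.sum_congr rfl fun j _ ↦
            Finset.sum_congr rfl fun y _ ↦ Finset.sum_congr rfl fun z _ ↦ by ring
  have h2 : ∑ y, ∑ z, (∑ i ∈ Q, x i y * x i z) * ((∑ i ∈ Q, x i y) * ∑ i ∈ Q, x i z) =
      ∑ i ∈ Q, (∑ j ∈ Q, ∑ z, x i z * x j z) ^ 2 := by
    simp only [hrow, sq, Finset.sum_mul_sum (s := (Finset.univ : Finset V)), Finset.sum_mul (s := Q)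
      (f := fun i ↦ x i _ * x i _)]
    rw [Finset.sum_congr rfl fun _ _ ↦ Finset.sum_comm, Finset.sum_comm]
    exact Finset.sum_congr rfl fun i _ ↦ Finset.sum_congr rfl fun y _ ↦
      Finset.sum_congr rfl fun z _ ↦ by ring
  have h3 : ∑ y, ∑ z, ((∑ i ∈ Q, x i y) * ∑ i ∈ Q, x i z) ^ 2 =
      (∑ i ∈ Q, ∑ j ∈ Q, ∑ z, x i z * x j z) ^ 2 := by
    have : ∑ i ∈ Q, ∑ j ∈ Q, ∑ z, x i z * x j z = ∑ z, (∑ j ∈ Q, x j z) ^ 2 := by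
      simp only [hrow]
      rw [Finset.sum_comm]
      simp only [sq, Finset.sum_mul]
    rw [this, sq, Finset.sum_mul_sum]
    simp only [mul_pow]
  rw [← h1, ← h2, ← h3]
  simp only [Finset.mul_sum (s := (Finset.univ : Finset V)), ← Finset.sum_sub_distrib,
    ← Finset.sum_add_distrib]
  exact Finset.sum_congr rfl fun y _ ↦ Finset.sum_congr rfl fun z _ ↦ by ring

lemma sum_sum_sq_sub_le (x : ι → V → ℝ) (Q : Finset ι) (t : ℝ) :
    ∑ y, ∑ z, (Q.card * ∑ i ∈ Q, x i y * x i z - (∑ i ∈ Q, x i y) * ∑ i ∈ Q, x i z) ^ 2 ≤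
      (Q.card : ℝ) ^ 2 * ∑ i ∈ Q, ∑ j ∈ Q, (∑ z, x i z * x j z - t) ^ 2 := by
  rw [sum_sum_sq_sub_eq]
  generalize hG : (fun i j ↦ ∑ z, x i z * x j z) = G
  simp only [funext_iff] at hG
  simp only [hG]
  have h1 : ∑ i ∈ Q, ∑ j ∈ Q, (G i j - t) ^ 2 = ∑ i ∈ Q, ∑ j ∈ Q, G i j ^ 2
      - 2 * t * ∑ i ∈ Q, ∑ j ∈ Q, G i j + (Q.card : ℝ) ^ 2 * t ^ 2 := by
    have : ∑ i ∈ Q, ∑ j ∈ Q, t ^ 2 = (Q.card : ℝ) ^ 2 * t ^ 2 := by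
      simp only [Finset.sum_const, nsmul_eq_mul]
      ring
    rw [← this]
    simp only [Finset.mul_sum, ← Finset.sum_sub_distrib, ← Finset.sum_add_distrib]
    exact Finset.sum_congr rfl fun y _ ↦ Finset.sum_congr rfl fun z _ ↦ by ring
  have h2 := sq_sum_le_card_mul_sum_sq (s := Q) (f := fun i ↦ ∑ j ∈ Q, G i j)
  rw [h1]
  nlinarith [sq_nonneg (∑ i ∈ Q, ∑ j ∈ Q, G i j - (Q.card : ℝ) ^ 2 * t)]

/-- If the pairwise inner products of the indicators `x i` are nearly equal, then the average of
`x i y * x i z` is mostly close to the product of the averages. -/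
lemma sum_weighted_avg_le (x : ι → V → ℝ) (hx0 : ∀ i z, 0 ≤ x i z) (hx1 : ∀ i z, x i z ≤ 1)
    (Q : Finset ι) (q : ℕ) (hq : 0 < q) (hQ : Q.card = q) (t τ σ : ℝ) (ht0 : 0 ≤ t)
    (ht1 : t ≤ Fintype.card V) (hσ : 0 < σ)
    (h : ∀ i ∈ Q, ∀ j ∈ Q, i ≠ j → |∑ z, x i z * x j z - t| ≤ τ)
    (w : V → V → ℝ) (hw0 : ∀ y z, 0 ≤ w y z) (hw1 : ∀ y z, w y z ≤ 1) (T : Finset V) :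
    ∑ y ∈ T, ∑ z ∈ T, w y z * (((∑ i ∈ Q, x i y) / q) * ((∑ i ∈ Q, x i z) / q)) ≤
      (∑ y ∈ T, ∑ z ∈ T, w y z * ∑ i ∈ Q, x i y * x i z) / q +
        (τ ^ 2 + (Fintype.card V : ℝ) ^ 2 / q) / (4 * σ) + σ * (Fintype.card V : ℝ) ^ 2 := by
  classical
  have hq' : (0 : ℝ) < q := by exact_mod_cast hq
  set N : ℝ := (Fintype.card V : ℝ) with hN
  set D : V → V → ℝ := fun y z ↦
    ((∑ i ∈ Q, x i y) / q) * ((∑ i ∈ Q, x i z) / q) - (∑ i ∈ Q, x i y * x i z) / q with hD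
  have hdev : ∑ i ∈ Q, ∑ j ∈ Q, (∑ z, x i z * x j z - t) ^ 2 ≤ (q : ℝ) ^ 2 * τ ^ 2 + q * N ^ 2 := by
    have h1 : ∀ i ∈ Q, ∀ j ∈ Q,
        (∑ z, x i z * x j z - t) ^ 2 ≤ τ ^ 2 + if i = j then N ^ 2 else 0 := by
      intro i hi j hj
      split_ifs with hij
      · have h2 : ∑ z, x i z * x j z ≤ ∑ _z : V, (1 : ℝ) := Finset.sum_le_sum fun z _ ↦
          mul_le_one₀ (hx1 i z) (hx0 j z) (hx1 j z)
        have h3 : 0 ≤ ∑ z, x i z * x j z := Finset.sum_nonneg fun z _ ↦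
          mul_nonneg (hx0 i z) (hx0 j z)
        simp only [Finset.sum_const, Finset.card_univ, nsmul_eq_mul, mul_one, ← hN] at h2
        have h4 : (∑ z, x i z * x j z - t) ^ 2 ≤ N ^ 2 := sq_le_sq' (by linarith) (by linarith)
        linarith [sq_nonneg τ]
      · rw [add_zero]
        exact sq_le_sq' (abs_le.1 (h i hi j hj hij)).1 (abs_le.1 (h i hi j hj hij)).2
    refine (Finset.sum_le_sum fun i hi ↦ Finset.sum_le_sum (h1 i hi)).trans (le_of_eq ?_)
    have h5 : ∀ i ∈ Q, ∑ j ∈ Q, (τ ^ 2 + if i = j then N ^ 2 else 0) = q * τ ^ 2 + N ^ 2 := by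
      intro i hi
      rw [Finset.sum_add_distrib, Finset.sum_ite_eq, if_pos hi, Finset.sum_const, hQ, nsmul_eq_mul]
    rw [Finset.sum_congr rfl h5, Finset.sum_const, hQ, nsmul_eq_mul]
    ring
  have hDsq : ∑ y, ∑ z, D y z ^ 2 ≤ τ ^ 2 + N ^ 2 / q := by
    have h1 := (sum_sum_sq_sub_le x Q t).trans (mul_le_mul_of_nonneg_left hdev (sq_nonneg _))
    rw [hQ] at h1
    have h2 : ∀ y z, (q * ∑ i ∈ Q, x i y * x i z - (∑ i ∈ Q, x i y) * ∑ i ∈ Q, x i z) ^ 2 =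
        q ^ 4 * D y z ^ 2 := by
      intro y z
      rw [hD]
      field_simp
      ring
    simp only [h2, ← Finset.mul_sum] at h1
    have h3 : (q : ℝ) ^ 2 * (q ^ 2 * τ ^ 2 + q * N ^ 2) = q ^ 4 * (τ ^ 2 + N ^ 2 / q) := by
      field_simp
    rw [h3] at h1
    exact le_of_mul_le_mul_left h1 (by positivity)
  have hpt : ∀ y z, w y z * (((∑ i ∈ Q, x i y) / q) * ((∑ i ∈ Q, x i z) / q)) ≤
      (w y z * ∑ i ∈ Q, x i y * x i z) / q + (D y z ^ 2 / (4 * σ) + σ) := by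
    intro y z
    have h1 : w y z * (((∑ i ∈ Q, x i y) / q) * ((∑ i ∈ Q, x i z) / q)) =
        (w y z * ∑ i ∈ Q, x i y * x i z) / q + w y z * D y z := by
      rw [hD]
      ring
    have h2 : |D y z| ≤ D y z ^ 2 / (4 * σ) + σ := by
      rw [← sq_abs, ← sub_nonneg]
      have : |D y z| ^ 2 / (4 * σ) + σ - |D y z| = (|D y z| - 2 * σ) ^ 2 / (4 * σ) := by
        field_simp
        ring
      rw [this]
      positivity
    have h3 : w y z * D y z ≤ |D y z| :=
      (mul_le_mul_of_nonneg_left (le_abs_self _) (hw0 y z)).trans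
        (mul_le_of_le_one_left (abs_nonneg _) (hw1 y z))
    linarith
  have hext : ∑ y ∈ T, ∑ z ∈ T, (D y z ^ 2 / (4 * σ) + σ) ≤
      ∑ y, ∑ z, (D y z ^ 2 / (4 * σ) + σ) := by
    have hnn : ∀ y z, 0 ≤ D y z ^ 2 / (4 * σ) + σ := fun y z ↦ by positivity
    refine (Finset.sum_le_sum fun y _ ↦ Finset.sum_le_sum_of_subset_of_nonneg
      (Finset.subset_univ T) fun z _ _ ↦ hnn y z).trans ?_
    exact Finset.sum_le_sum_of_subset_of_nonneg (Finset.subset_univ T)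
      fun y _ _ ↦ Finset.sum_nonneg fun z _ ↦ hnn y z
  have hval : ∑ y, ∑ z, (D y z ^ 2 / (4 * σ) + σ) = (∑ y, ∑ z, D y z ^ 2) / (4 * σ) + σ * N ^ 2 := by
    simp only [Finset.sum_add_distrib, Finset.sum_div, Finset.sum_const, Finset.card_univ,
      nsmul_eq_mul, ← hN]
    ring
  have hfin := Finset.sum_le_sum fun y (_ : y ∈ T) ↦ Finset.sum_le_sum fun z (_ : z ∈ T) ↦ hpt y z
  have hsplit : ∑ y ∈ T, ∑ z ∈ T,
      ((w y z * ∑ i ∈ Q, x i y * x i z) / q + (D y z ^ 2 / (4 * σ) + σ)) =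
      (∑ y ∈ T, ∑ z ∈ T, w y z * ∑ i ∈ Q, x i y * x i z) / q +
        ∑ y ∈ T, ∑ z ∈ T, (D y z ^ 2 / (4 * σ) + σ) := by
    simp only [Finset.sum_add_distrib, Finset.sum_div]
  have hbound : (∑ y, ∑ z, D y z ^ 2) / (4 * σ) ≤ (τ ^ 2 + N ^ 2 / q) / (4 * σ) := by gcongr
  linarith

end Variance

section Packings

universe u

/-- The red part of a packing is at most as large as the largest red book. -/
lemma BookBound.card_biUnion_red_le (γ : ℝ) (hγ : 0 < γ) (k : ℕ) (hk : 0 < k) :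
    ∃ M₁ : ℕ, ∀ M ≥ M₁, ∀ (V : Type u) [Fintype V] [Nonempty V] [DecidableEq V] (R : SimpleGraph V)
      (a b s : ℝ) (F : Finset (Finset V)), BookBound R a b → 0 ≤ s → s ≤ 1 →
      a + s * b + 2 * (Fintype.card V / k) < Fintype.card V * (s / (1 + s)) →
      IsPacking R.Adj M Finset.univ F →
      ((F.biUnion id).card : ℝ) ≤ a + γ * Fintype.card V := by
  classical
  obtain ⟨M₁, hM₁⟩ := exists_complete_pair.{u} (γ ^ 2 / 4) (by positivity) k
  refine ⟨M₁, fun M hM V _ _ _ R a b s F H hs0 hs1 hlt hF ↦ ?_⟩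
  have hpair := hM₁ M hM V F (fun u v ↦ ¬ R.Adj u v) hF.disjoint hF.card
  by_cases hden : γ ^ 2 / 4 * (Fintype.card V : ℝ) ^ 2 ≤
      ∑ y ∈ F.biUnion id, (((F.biUnion id).filter fun v ↦ ¬ R.Adj y v).card : ℝ)
  · obtain ⟨Y, hY, Z, hZ, B, hBY, A, hAZ, hB, hA, hBA⟩ := hpair (by convert hden)
    refine absurd (H.le_of_red_red s hs0 hs1 k hk B A hB hA
      (fun u hu v hv huv ↦ hF.pair Y hY u (hBY hu) v (hBY hv) huv)
      (fun u hu v hv huv ↦ hF.pair Z hZ u (hAZ hu) v (hAZ hv) huv) hBA) (not_le.2 hlt)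
  · have h1 : ∑ u ∈ F.biUnion id, ∑ v ∈ F.biUnion id, (1 - R.ind u v) ≤
        γ ^ 2 / 4 * (Fintype.card V : ℝ) ^ 2 := by
      refine le_trans (le_of_eq ?_) (not_le.1 hden).le
      refine Finset.sum_congr rfl fun u _ ↦ ?_
      rw [Finset.card_filter]
      push_cast
      refine Finset.sum_congr rfl fun v _ ↦ ?_
      by_cases huv : R.Adj u v
      · simp [R.ind_of_adj huv, huv]
      · simp [R.ind_of_not_adj huv, huv]
    have h2 := card_sq_le_of_few_nonadj R a _ H.red H.nonneg_left _ h1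
    by_contra! hcon
    have hN : (0 : ℝ) < Fintype.card V := by exact_mod_cast Fintype.card_pos
    have ha := H.nonneg_left
    nlinarith [mul_pos hγ hN, sq_nonneg (γ * Fintype.card V)]

/-- Large sets of vertices contain `q`-subsets with nearly equal pairwise codegrees. -/
lemma exists_homogeneous_codegree (L q : ℕ) (hL : 0 < L) :
    ∃ M : ℕ, ∀ (V : Type u) [Fintype V] [Nonempty V] (R : SimpleGraph V) (S : Finset V),
      M ≤ S.card → ∃ Q ⊆ S, Q.card = q ∧ ∃ t : ℝ, 0 ≤ t ∧ t ≤ Fintype.card V ∧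
        ∀ u ∈ Q, ∀ v ∈ Q, u ≠ v → |∑ z, R.ind u z * R.ind v z - t| ≤ Fintype.card V / L := by
  obtain ⟨M, hM⟩ := exists_monochromatic_of_sizes.{u, 0} fun _ : Fin (L + 1) ↦ q
  refine ⟨M, fun V _ _ R S hS ↦ ?_⟩
  have hN : (0 : ℝ) < Fintype.card V := by exact_mod_cast Fintype.card_pos
  have hL' : (0 : ℝ) < L := by exact_mod_cast hL
  have hG0 : ∀ u v, 0 ≤ ∑ z, R.ind u z * R.ind v z := fun u v ↦
    Finset.sum_nonneg fun z _ ↦ mul_nonneg (R.ind_nonneg u z) (R.ind_nonneg v z)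
  have hG1 : ∀ u v, ∑ z, R.ind u z * R.ind v z ≤ Fintype.card V := by
    intro u v
    have : ∑ z, R.ind u z * R.ind v z ≤ ∑ _z : V, (1 : ℝ) := Finset.sum_le_sum fun z _ ↦
      mul_le_one₀ (R.ind_le_one u z) (R.ind_nonneg v z) (R.ind_le_one v z)
    simpa using this
  have hfl : ∀ u v, ⌊(∑ z, R.ind u z * R.ind v z) / (Fintype.card V / L)⌋₊ < L + 1 := by
    intro u v
    rw [Nat.lt_succ_iff]
    refine Nat.floor_le_of_le ?_
    rw [div_le_iff₀ (by positivity), mul_div_cancel₀ _ hL'.ne']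
    exact hG1 u v
  obtain ⟨i, Q, hQS, hQ, hi⟩ := hM V (fun u v ↦ ⟨_, hfl u v⟩) (fun u v ↦ by
    simp only [mul_comm (R.ind u _)]) S hS
  refine ⟨Q, hQS, hQ, i * (Fintype.card V / L), by positivity, ?_, fun u hu v hv huv ↦ ?_⟩
  · have : (i : ℝ) ≤ L := by exact_mod_cast Nat.lt_succ_iff.1 i.2
    calc (i : ℝ) * (Fintype.card V / L) ≤ L * (Fintype.card V / L) := by gcongr
      _ = _ := mul_div_cancel₀ _ hL'.ne'
  · have h1 : ⌊(∑ z, R.ind u z * R.ind v z) / (Fintype.card V / L)⌋₊ = i :=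
      congrArg Fin.val (hi u hu v hv huv)
    have hd : (0 : ℝ) < Fintype.card V / L := by positivity
    obtain ⟨h2, h3⟩ := (Nat.floor_eq_iff (div_nonneg (hG0 u v) hd.le)).1 h1
    rw [le_div_iff₀ hd] at h2
    rw [div_lt_iff₀ hd] at h3
    rw [abs_le]
    constructor <;> linarith

lemma BookBound.compl_book_le {V : Type*} [Fintype V] {R : SimpleGraph V} {a b : ℝ}
    (H : BookBound R a b) (u v : V) (h : Rᶜ.Adj u v) : ∑ z, Rᶜ.ind u z * Rᶜ.ind v z ≤ b := by
  have hind : ∀ x y, Rᶜ.ind x y ≤ 1 - R.ind x y := by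
    intro x y
    by_cases hxy : R.Adj x y
    · rw [R.ind_of_adj hxy, Rᶜ.ind_of_not_adj fun h ↦ h.2 hxy]
      norm_num
    · rw [R.ind_of_not_adj hxy]
      linarith [Rᶜ.ind_le_one x y]
  exact (Finset.sum_le_sum fun z _ ↦ mul_le_mul (hind u z) (hind v z) (Rᶜ.ind_nonneg v z)
    (sub_nonneg.2 (R.ind_le_one u z))).trans (H.blue u v h.1 h.2)

/-- A set of vertices with few red pairs is at most slightly larger than the largest blue book. -/
lemma BookBound.card_le_of_few_adj {V : Type*} [Fintype V] {R : SimpleGraph V} {a b : ℝ}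
    (H : BookBound R a b) (S : Finset V) (γ : ℝ) (hγ : 0 < γ)
    (hN : 8 ≤ γ ^ 2 * Fintype.card V)
    (h : ∑ u ∈ S, ∑ v ∈ S, R.ind u v ≤ γ ^ 2 / 8 * (Fintype.card V : ℝ) ^ 2) :
    (S.card : ℝ) ≤ b + γ * Fintype.card V := by
  classical
  have h1 : ∑ u ∈ S, ∑ v ∈ S, (1 - Rᶜ.ind u v) ≤ γ ^ 2 / 4 * (Fintype.card V : ℝ) ^ 2 := by
    have h2 : ∀ u ∈ S, ∑ v ∈ S, (1 - Rᶜ.ind u v) ≤ ∑ v ∈ S, R.ind u v + 1 := by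
      intro u hu
      have : ∑ v ∈ S, (if u = v then (1 : ℝ) else 0) = 1 := by
        rw [Finset.sum_ite_eq, if_pos hu]
      rw [← this, ← Finset.sum_add_distrib]
      refine Finset.sum_le_sum fun v _ ↦ ?_
      split_ifs with huv
      · linarith [Rᶜ.ind_nonneg u v, R.ind_nonneg u v]
      · by_cases hR : R.Adj u v
        · linarith [Rᶜ.ind_nonneg u v, R.ind_of_adj hR]
        · linarith [Rᶜ.ind_of_adj ⟨huv, hR⟩, R.ind_nonneg u v]
    have h3 := Finset.sum_le_sum h2
    rw [Finset.sum_add_distrib, Finset.sum_const, nsmul_eq_mul, mul_one] at h3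
    have h4 : (S.card : ℝ) ≤ Fintype.card V := by exact_mod_cast Finset.card_le_univ S
    nlinarith [Nat.cast_nonneg (α := ℝ) (Fintype.card V)]
  have h2 := card_sq_le_of_few_nonadj Rᶜ b _ H.compl_book_le H.nonneg_right _ h1
  by_contra! hcon
  have hN' : (0 : ℝ) < Fintype.card V := by
    by_contra! h0
    nlinarith [sq_nonneg γ]
  have hb := H.nonneg_right
  nlinarith [mul_pos hγ hN', sq_nonneg (γ * Fintype.card V)]

/-- If the average red neighbourhood of a blue clique spans few red edges in `T`, then `T` is not
much larger than twice the largest blue book. -/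
lemma BookBound.card_le_of_avg {V : Type*} [Fintype V] {R : SimpleGraph V} {a b : ℝ}
    (H : BookBound R a b) (T Q : Finset V) (q : ℕ) (hq : 0 < q) (hQ : Q.card = q)
    (hQb : ∀ u ∈ Q, ∀ v ∈ Q, u ≠ v → ¬ R.Adj u v) (γ : ℝ) (hγ : 0 < γ)
    (hN : 8 ≤ γ ^ 2 * Fintype.card V)
    (h : ∑ y ∈ T, ∑ z ∈ T, R.ind y z * (((∑ i ∈ Q, R.ind i y) / q) * ((∑ i ∈ Q, R.ind i z) / q))
      ≤ γ ^ 4 / 8 * (Fintype.card V : ℝ) ^ 2) :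
    (T.card : ℝ) ≤ 2 * b + (3 * γ + 1 / q) * Fintype.card V := by
  classical
  have hq' : (0 : ℝ) < q := by exact_mod_cast hq
  set f : V → ℝ := fun y ↦ (∑ i ∈ Q, R.ind i y) / q with hf
  have hf0 : ∀ y, 0 ≤ f y := fun y ↦
    div_nonneg (Finset.sum_nonneg fun i _ ↦ R.ind_nonneg i y) hq'.le
  have hS : ((T.filter fun y ↦ γ ≤ f y).card : ℝ) ≤ b + γ * Fintype.card V := by
    refine H.card_le_of_few_adj _ γ hγ hN ?_
    have h1 : γ ^ 2 * ∑ u ∈ T with γ ≤ f u, ∑ v ∈ T with γ ≤ f v, R.ind u v ≤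
        ∑ y ∈ T, ∑ z ∈ T, R.ind y z * (f y * f z) := by
      rw [Finset.mul_sum]
      have hnn : ∀ y z, 0 ≤ R.ind y z * (f y * f z) := fun y z ↦
        mul_nonneg (R.ind_nonneg y z) (mul_nonneg (hf0 y) (hf0 z))
      refine (Finset.sum_le_sum fun y hy ↦ ?_).trans (Finset.sum_le_sum_of_subset_of_nonneg
        (Finset.filter_subset _ _) fun y _ _ ↦ Finset.sum_nonneg fun z _ ↦ hnn y z)
      rw [Finset.mul_sum]
      refine (Finset.sum_le_sum fun z hz ↦ ?_).trans (Finset.sum_le_sum_of_subset_of_nonneg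
        (Finset.filter_subset _ _) fun z _ _ ↦ hnn y z)
      have := mul_le_mul (Finset.mem_filter.1 hy).2 (Finset.mem_filter.1 hz).2 hγ.le (hf0 y)
      nlinarith [mul_le_mul_of_nonneg_left this (R.ind_nonneg y z)]
    refine le_of_mul_le_mul_left ((h1.trans h).trans_eq ?_) (pow_pos hγ 2)
    ring
  have hsq : ∑ z, (1 - f z) * (1 - f z) ≤ b + Fintype.card V / q := by
    have h1 := sum_avg_mul_avg_le (fun u v ↦ 1 - R.ind u v)
      (fun u v ↦ sub_nonneg.2 (R.ind_le_one u v)) (fun u v ↦ sub_le_self _ (R.ind_nonneg u v))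
      Q Q q hq hQ hQ b H.nonneg_right fun u hu v hv huv ↦ H.blue u v huv (hQb u hu v hv huv)
    simpa only [avg_one_sub _ Q q hq hQ] using h1
  have hS' : ((T.filter fun y ↦ ¬ γ ≤ f y).card : ℝ) * (1 - 2 * γ) ≤ b + Fintype.card V / q := by
    refine le_trans ?_ hsq
    rw [← nsmul_eq_mul]
    refine (Finset.card_nsmul_le_sum _ (fun z ↦ (1 - f z) * (1 - f z)) _ fun z hz ↦ ?_).trans
      (Finset.sum_le_sum_of_subset_of_nonneg (Finset.subset_univ _)
        fun z _ _ ↦ mul_self_nonneg _)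
    nlinarith [not_le.1 (Finset.mem_filter.1 hz).2, sq_nonneg (f z)]
  have hcard : ((T.filter fun y ↦ γ ≤ f y).card : ℝ) + (T.filter fun y ↦ ¬ γ ≤ f y).card =
      T.card := by
    exact_mod_cast Finset.card_filter_add_card_filter_not (s := T) fun y ↦ γ ≤ f y
  have hle : ((T.filter fun y ↦ ¬ γ ≤ f y).card : ℝ) ≤ Fintype.card V := by
    exact_mod_cast Finset.card_le_univ _
  have : (3 * γ + 1 / q) * (Fintype.card V : ℝ) =
    3 * (γ * Fintype.card V) + Fintype.card V / q := by ring
  nlinarith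

/-- The blue part of a packing is at most about twice as large as the largest blue book. -/
lemma BookBound.card_biUnion_blue_le (γ : ℝ) (hγ : 0 < γ) (k : ℕ) (hk : 0 < k) :
    ∃ M₁ : ℕ, ∀ M ≥ M₁, ∀ (V : Type u) [Fintype V] [Nonempty V] [DecidableEq V] (R : SimpleGraph V)
      (a b s : ℝ) (F : Finset (Finset V)), BookBound R a b → 1 / 2 ≤ s → s ≤ 1 →
      a + s * b + 2 * (Fintype.card V / k) < Fintype.card V * (s / (1 + s)) →
      8 ≤ γ ^ 2 * Fintype.card V →
      IsPacking (fun u v ↦ ¬ R.Adj u v) M Finset.univ F →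
      ((F.biUnion id).card : ℝ) ≤ 2 * b + 4 * γ * Fintype.card V := by
  classical
  set ε : ℝ := γ ^ 4 / 32 with hε
  have hε0 : 0 < ε := by positivity
  obtain ⟨M₀, δ, hδ, hI⟩ := exists_large_common_intersection.{u, u} ε hε0 k
  obtain ⟨M₁, hM₁⟩ := exists_complete_pair.{u} δ hδ k
  obtain ⟨L, hL⟩ := exists_nat_gt (1 / ε)
  have hL0 : (0 : ℝ) < L := lt_trans (by positivity) hL
  obtain ⟨q', hq'⟩ := exists_nat_gt (1 / ε ^ 2 + 1 / γ)
  set q := max q' (M₀ + 1) with hq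
  have hq0 : 0 < q := by omega
  have hqq : 1 / ε ^ 2 + 1 / γ < q := hq'.trans_le (by exact_mod_cast le_max_left _ _)
  have hq0' : (0 : ℝ) < q := by exact_mod_cast hq0
  have hq1 : 1 / (q : ℝ) ≤ ε ^ 2 := by
    rw [div_le_iff₀ hq0', ← div_le_iff₀' (by positivity)]
    linarith [show 0 < 1 / γ by positivity]
  have hq2 : 1 / (q : ℝ) ≤ γ := by
    rw [div_le_iff₀ hq0', ← div_le_iff₀' hγ]
    linarith [show 0 < 1 / ε ^ 2 by positivity]
  have hL1 : 1 / (L : ℝ) ≤ ε := by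
    rw [div_le_iff₀ hL0, ← div_le_iff₀' hε0]
    exact hL.le
  obtain ⟨M₂, hM₂⟩ := exists_homogeneous_codegree.{u} L q (by exact_mod_cast hL0)
  refine ⟨max M₁ M₂, fun M hM V _ _ _ R a b s F H hs0 hs1 hlt hN8 hF ↦ ?_⟩
  have hN : (0 : ℝ) < Fintype.card V := by exact_mod_cast Fintype.card_pos
  set N : ℝ := (Fintype.card V : ℝ) with hNdef
  rcases F.eq_empty_or_nonempty with rfl | ⟨Q₀, hQ₀⟩
  · have := H.nonneg_right
    simp only [Finset.biUnion_empty, Finset.card_empty, Nat.cast_zero]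
    positivity
  obtain ⟨Q, hQQ₀, hQ, t, ht0, htN, ht⟩ := hM₂ V R Q₀ (by
    rw [hF.card Q₀ hQ₀]
    exact (le_max_right _ _).trans hM)
  set T := F.biUnion id with hT
  have hQb : ∀ u ∈ Q, ∀ v ∈ Q, u ≠ v → ¬ R.Adj u v := fun u hu v hv ↦
    hF.pair Q₀ hQ₀ u (hQQ₀ hu) v (hQQ₀ hv)
  have hblue : ∀ Y ∈ F, ∀ u ∈ Y, ∀ v ∈ Y, ¬ R.Adj u v := by
    intro Y hY u hu v hv
    by_cases huv : u = v
    · exact huv ▸ R.irrefl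
    · exact hF.pair Y hY u hu v hv huv
  have htriple : ∑ i ∈ Q, (((T ×ˢ T).filter fun p ↦
      R.Adj p.1 p.2 ∧ R.Adj i p.1 ∧ R.Adj i p.2).card : ℝ) ≤ ε * q * N ^ 2 := by
    by_contra! hcon
    obtain ⟨A, hAQ, hAk, hA⟩ := hI V (V × V) (T ×ˢ T) Q
      (fun i p ↦ R.Adj p.1 p.2 ∧ R.Adj i p.1 ∧ R.Adj i p.2) (N ^ 2) (by positivity) (by
        have : (T.card : ℝ) ≤ N := Nat.cast_le.2 (Finset.card_le_univ T)
        rw [Finset.card_product]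
        push_cast
        nlinarith) (by omega) (by
        rw [hQ]
        refine hcon.le.trans (le_of_eq ?_)
        congr!)
    obtain ⟨Y, hY, Z, hZ, B, hBY, C, hCZ, hBk, hCk, hBC⟩ := hM₁ M ((le_max_left _ _).trans hM) V F
      (fun y z ↦ ∀ i ∈ A, R.Adj y z ∧ R.Adj i y ∧ R.Adj i z) hF.disjoint hF.card (by
        refine hA.trans (le_of_eq ?_)
        rw [Finset.card_filter, Finset.sum_product]
        push_cast
        refine Finset.sum_congr (by congr!) fun y _ ↦ ?_
        rw [Finset.card_filter]
        push_cast
        refine Finset.sum_congr (by congr!) fun z _ ↦ ?_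
        congr!)
    obtain ⟨i₀, hi₀⟩ : A.Nonempty := Finset.card_pos.1 (hAk ▸ hk)
    obtain ⟨y₀, hy₀⟩ : B.Nonempty := Finset.card_pos.1 (hBk ▸ hk)
    obtain ⟨z₀, hz₀⟩ : C.Nonempty := Finset.card_pos.1 (hCk ▸ hk)
    refine absurd (H.le_of_blue_blue_blue s hs0 hs1 k hk A B C hAk hBk hCk
      (fun u hu v hv ↦ hblue Q₀ hQ₀ u (hQQ₀ (hAQ hu)) v (hQQ₀ (hAQ hv)))
      (fun u hu v hv ↦ hblue Y hY u (hBY hu) v (hBY hv))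
      (fun u hu v hv ↦ hblue Z hZ u (hCZ hu) v (hCZ hv))
      (fun i hi y hy ↦ (hBC y hy z₀ hz₀ i hi).2.1)
      (fun y hy z hz ↦ (hBC y hy z hz i₀ hi₀).1)
      (fun i hi z hz ↦ (hBC y₀ hy₀ z hz i hi).2.2)) (not_le.2 hlt)
  have hsum : ∑ y ∈ T, ∑ z ∈ T, R.ind y z * ∑ i ∈ Q, R.ind i y * R.ind i z ≤ ε * q * N ^ 2 := by
    refine le_trans (le_of_eq ?_) htriple
    simp only [Finset.mul_sum]
    rw [Finset.sum_congr rfl fun _ _ ↦ Finset.sum_comm, Finset.sum_comm]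
    refine Finset.sum_congr rfl fun i _ ↦ ?_
    rw [Finset.card_filter, Finset.sum_product]
    push_cast
    refine Finset.sum_congr rfl fun y _ ↦ Finset.sum_congr rfl fun z _ ↦ ?_
    unfold SimpleGraph.ind
    by_cases h1 : R.Adj y z <;> by_cases h2 : R.Adj i y <;> by_cases h3 : R.Adj i z <;>
      simp [h1, h2, h3]
  have havg := sum_weighted_avg_le R.ind R.ind_nonneg R.ind_le_one Q q hq0 hQ t (N / L) ε ht0 htN
    hε0 ht R.ind R.ind_nonneg R.ind_le_one T
  have hfin := H.card_le_of_avg T Q q hq0 hQ hQb γ hγ hN8 (havg.trans ?_)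
  · have : 1 / (q : ℝ) * N ≤ γ * N := mul_le_mul_of_nonneg_right hq2 hN.le
    linarith
  · have h1 : (∑ y ∈ T, ∑ z ∈ T, R.ind y z * ∑ i ∈ Q, R.ind i y * R.ind i z) / q ≤ ε * N ^ 2 := by
      rw [div_le_iff₀ hq0']
      linarith
    have h2 : ((N / L) ^ 2 + N ^ 2 / q) / (4 * ε) ≤ ε * N ^ 2 := by
      rw [div_le_iff₀ (by positivity)]
      have h3 : (N / L) ^ 2 + N ^ 2 / q = N ^ 2 * ((1 / L) ^ 2 + 1 / q) := by ring
      have h4 : (1 / (L : ℝ)) ^ 2 ≤ ε ^ 2 := by gcongr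
      rw [h3]
      nlinarith [mul_le_mul_of_nonneg_left (add_le_add h4 hq1) (sq_nonneg N), sq_nonneg (ε * N)]
    have h5 : γ ^ 4 / 8 * N ^ 2 = 4 * (ε * N ^ 2) := by
      rw [hε]
      ring
    rw [h5]
    have h6 : 0 ≤ ε * N ^ 2 := by positivity
    linarith

/-- Large graphs cannot have all red and all blue books small. -/
lemma BookBound.exists_card_lt (s : ℝ) (hs0 : 1 / 2 ≤ s) (hs1 : s ≤ 1) (ξ : ℝ) (hξ : 0 < ξ) :
    ∃ N₀ : ℕ, ∀ (V : Type u) [Fintype V] (R : SimpleGraph V) (a b : ℝ), BookBound R a b →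
      a + 2 * b ≤ (1 - ξ) * Fintype.card V + 3 →
      a + s * b + ξ / 3 * Fintype.card V ≤ Fintype.card V * (s / (1 + s)) + 2 →
      Fintype.card V < N₀ := by
  classical
  obtain ⟨k, hk⟩ := exists_nat_gt (12 / ξ)
  have hk0 : (0 : ℝ) < k := lt_trans (by positivity) hk
  have hk0' : 0 < k := by exact_mod_cast hk0
  rw [div_lt_iff₀ hξ] at hk
  obtain ⟨M₁, h₁⟩ := BookBound.card_biUnion_red_le.{u} (ξ / 16) (by positivity) k hk0'
  obtain ⟨M₂, h₂⟩ := BookBound.card_biUnion_blue_le.{u} (ξ / 16) (by positivity) k hk0'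
  set M := max M₁ (M₂ + 1) with hM
  obtain ⟨C, hC⟩ := exists_packings.{u} M (by omega)
  obtain ⟨N₀, hN₀⟩ := exists_nat_gt ((12 + 2 * (C + 3)) / ξ + 8 / (ξ / 16) ^ 2)
  refine ⟨N₀, fun V _ R a b H hi hii ↦ ?_⟩
  by_contra! hV
  have hV' : (N₀ : ℝ) ≤ Fintype.card V := by exact_mod_cast hV
  have hN : (0 : ℝ) < Fintype.card V := lt_of_lt_of_le (lt_trans (by positivity) hN₀) hV'
  have : Nonempty V := Fintype.card_pos_iff.1 (by exact_mod_cast hN)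
  set N : ℝ := (Fintype.card V : ℝ) with hNdef
  have hN1 : 12 + 2 * (C + 3) < ξ * N := by
    rw [← div_lt_iff₀' hξ]
    linarith [show 0 < 8 / (ξ / 16) ^ 2 by positivity]
  have hN2 : 8 ≤ (ξ / 16) ^ 2 * N := by
    rw [← div_le_iff₀' (by positivity)]
    linarith [show 0 < (12 + 2 * ((C : ℝ) + 3)) / ξ by positivity]
  have hlt : a + s * b + 2 * (N / k) < N * (s / (1 + s)) := by
    have : N / k ≤ ξ / 12 * N := by
      rw [div_le_iff₀ hk0]
      nlinarith
    have : (0 : ℝ) ≤ C := Nat.cast_nonneg C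
    linarith
  obtain ⟨F₁, F₂, hF₁, hF₂, hcov⟩ := hC V R Finset.univ
  have hred := h₁ M (le_max_left _ _) V R a b s F₁ H (by linarith) hs1 hlt hF₁
  have hblue := h₂ M ((Nat.le_succ _).trans (le_max_right _ _)) V R a b s F₂ H hs0 hs1 hlt hN2 hF₂
  have hcov' : N ≤ (F₁.biUnion id).card + (F₂.biUnion id).card + C := by
    rw [Finset.card_univ] at hcov
    rw [hNdef]
    exact_mod_cast hcov
  linarith

lemma BookBound.of_not_hasBook {V : Type*} [Fintype V] {R : SimpleGraph V} {m n : ℕ}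
    (hm : ¬ HasBook R m) (hn : ¬ HasBook Rᶜ n) : BookBound R m (n + 1) where
  nonneg_left := by positivity
  nonneg_right := by positivity
  red u v huv := by
    classical
    have h : ({w | R.Adj u w ∧ R.Adj v w} : Set V).ncard ≤ m :=
      (not_le.1 fun h ↦ hm ⟨u, v, huv, h⟩).le
    refine le_trans (le_of_eq ?_) (Nat.cast_le.2 h)
    rw [Set.ncard_eq_toFinset_card', Set.toFinset_ofPred, Finset.card_filter]
    push_cast
    refine Finset.sum_congr rfl fun z _ ↦ ?_
    by_cases h1 : R.Adj u z <;> by_cases h2 : R.Adj v z <;> simp [SimpleGraph.ind, h1, h2]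
  blue u v huv hR := by
    classical
    have h : ({w | Rᶜ.Adj u w ∧ Rᶜ.Adj v w} : Set V).ncard < n :=
      not_le.1 fun h ↦ hn ⟨u, v, ⟨huv, hR⟩, h⟩
    rw [Set.ncard_eq_toFinset_card', Set.toFinset_ofPred] at h
    have h1 : (Finset.univ.filter fun z ↦ ¬ R.Adj u z ∧ ¬ R.Adj v z).card ≤ n + 1 := by
      have hsub : (Finset.univ.filter fun z ↦ ¬ R.Adj u z ∧ ¬ R.Adj v z) ⊆
          (Finset.univ.filter fun w ↦ Rᶜ.Adj u w ∧ Rᶜ.Adj v w) ∪ {u, v} := by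
        intro z hz
        simp only [Finset.mem_union, Finset.mem_filter, Finset.mem_univ, true_and,
          SimpleGraph.compl_adj, Finset.mem_insert, Finset.mem_singleton] at hz ⊢
        by_cases h2 : z = u
        · exact Or.inr (Or.inl h2)
        by_cases h3 : z = v
        · exact Or.inr (Or.inr h3)
        exact Or.inl ⟨⟨Ne.symm h2, hz.1⟩, Ne.symm h3, hz.2⟩
      have h4 := (Finset.card_le_card hsub).trans (Finset.card_union_le _ _)
      have h5 := Finset.card_le_two (a := u) (b := v)
      omega
    have h2 : ((Finset.univ.filter fun z ↦ ¬ R.Adj u z ∧ ¬ R.Adj v z).card : ℝ) ≤ n + 1 := by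
      exact_mod_cast h1
    refine le_trans (le_of_eq ?_) h2
    rw [Finset.card_filter]
    push_cast
    refine Finset.sum_congr rfl fun z _ ↦ ?_
    by_cases h1 : R.Adj u z <;> by_cases h2 : R.Adj v z <;> simp [SimpleGraph.ind, h1, h2]

/-- The upper bound for the Ramsey number of books. -/
lemma exists_forall_hasBook (α η : ℝ) (hα1 : 1 / 4 ≤ α) (hα2 : α ≤ 1) (hη : 0 < η) :
    ∃ n₀ : ℕ, ∀ n : ℕ, n₀ ≤ n → ∀ N : ℕ, ((√α + 1) ^ 2 + η) * (n : ℝ) ≤ (N : ℝ) →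
      ∀ R : SimpleGraph (Fin N), HasBook R ⌈α * (n : ℝ)⌉₊ ∨ HasBook Rᶜ n := by
  have hs0 : 1 / 2 ≤ √α := Real.le_sqrt_of_sq_le (by linarith)
  have hs1 : √α ≤ 1 := Real.sqrt_le_one.2 hα2
  have hsq : √α ^ 2 = α := Real.sq_sqrt (by linarith)
  generalize √α = s at *
  subst hsq
  have hξ : 0 < η / (4 + η) := by positivity
  obtain ⟨N₀, hN₀⟩ := BookBound.exists_card_lt.{0} s hs0 hs1 _ hξ
  refine ⟨N₀, fun n hn N hN R ↦ ?_⟩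
  by_contra! hcon
  have H := BookBound.of_not_hasBook hcon.1 hcon.2
  have hn0 : (0 : ℝ) ≤ n := Nat.cast_nonneg n
  have hnN : n ≤ N := by
    have : (n : ℝ) ≤ N := by nlinarith
    exact_mod_cast this
  have hceil : (⌈s ^ 2 * (n : ℝ)⌉₊ : ℝ) ≤ s ^ 2 * n + 1 := (Nat.ceil_lt_add_one (by positivity)).le
  have hN' : (s + 1) ^ 2 * n ≤ (1 - η / (4 + η)) * N := by
    have h1 : 1 - η / (4 + η) = 4 / (4 + η) := by
      field_simp
      ring
    rw [h1, div_mul_eq_mul_div, le_div_iff₀ (by positivity)]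
    have h2 : (s + 1) ^ 2 ≤ 4 := by nlinarith
    nlinarith [mul_nonneg hη.le hn0, mul_nonneg (mul_nonneg hη.le hn0) (sub_nonneg.2 h2)]
  have hs3 : 1 / 3 ≤ s / (1 + s) := by
    rw [div_le_div_iff₀ (by norm_num) (by linarith)]
    linarith
  have hlt := hN₀ (Fin N) R _ _ H (by
    rw [Fintype.card_fin]
    nlinarith) (by
    rw [Fintype.card_fin]
    have h1 := mul_le_mul_of_nonneg_right hN' (show 0 ≤ s / (1 + s) by linarith)
    have h2 : (s + 1) ^ 2 * n * (s / (1 + s)) = s * (1 + s) * n := by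
      field_simp
      ring
    have h3 := mul_le_mul_of_nonneg_left hs3 (mul_nonneg hξ.le (Nat.cast_nonneg (α := ℝ) N))
    nlinarith)
  rw [Fintype.card_fin] at hlt
  omega

/-- The lower bound for the Ramsey number of books. -/
lemma exists_not_hasBook (α η : ℝ) (hα1 : 1 / 4 ≤ α) (hα2 : α ≤ 1) (hη : 0 < η) :
    ∃ n₀ : ℕ, ∀ n : ℕ, n₀ ≤ n → ∃ R : SimpleGraph (Fin ⌊((√α + 1) ^ 2 - η) * (n : ℝ)⌋₊),
      ¬ HasBook R ⌈α * (n : ℝ)⌉₊ ∧ ¬ HasBook Rᶜ n := by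
  have hs0 : 1 / 2 ≤ √α := Real.le_sqrt_of_sq_le (by linarith)
  have hs1 : √α ≤ 1 := Real.sqrt_le_one.2 hα2
  have hsq : √α ^ 2 = α := Real.sq_sqrt (by linarith)
  generalize √α = s at *
  subst hsq
  obtain ⟨p, hp⟩ : ∃ p, p = s / (1 + s) := ⟨_, rfl⟩
  have hp1 : 1 / 3 ≤ p := by
    rw [hp, div_le_div_iff₀ (by norm_num) (by linarith)]
    linarith
  have hp2 : p ≤ 1 / 2 := by
    rw [hp, div_le_div_iff₀ (by linarith) (by norm_num)]
    linarith
  have hps : p * (s + 1) = s := by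
    rw [hp]
    field_simp
    ring
  obtain ⟨N₀, hN₀⟩ := exists_graph_codegree_lt p (by linarith) (by linarith) (η / 36) (by positivity)
  refine ⟨N₀ + 1, fun n hn ↦ ?_⟩
  have hn0 : (0 : ℝ) ≤ n := Nat.cast_nonneg n
  have hfloor : ((s + 1) ^ 2 - η) * (n : ℝ) < 1 ∨
      (⌊((s + 1) ^ 2 - η) * (n : ℝ)⌋₊ : ℝ) ≤ ((s + 1) ^ 2 - η) * n := by
    rcases lt_or_ge (((s + 1) ^ 2 - η) * (n : ℝ)) 1 with h | h
    · exact Or.inl h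
    · exact Or.inr (Nat.floor_le (by linarith))
  rw [← Nat.floor_eq_zero] at hfloor
  generalize ⌊((s + 1) ^ 2 - η) * (n : ℝ)⌋₊ = N at *
  by_cases hN : N₀ ≤ N
  · obtain ⟨R, hR⟩ := hN₀ N hN
    have hD : (s + 1) ^ 2 ≤ 4 := by nlinarith
    have hbound : ∀ x : ℝ, 1 / 3 ≤ x → (x ^ 2 + η / 36) * N ≤ (x * (s + 1)) ^ 2 * n := by
      intro x hx
      rcases hfloor with h | h
      · rw [h, Nat.cast_zero, mul_zero]
        positivity
      · refine (mul_le_mul_of_nonneg_left h (by positivity)).trans ?_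
        rw [← mul_assoc]
        refine mul_le_mul_of_nonneg_right ?_ hn0
        nlinarith [mul_nonneg hη.le (show 0 ≤ x ^ 2 - 1 / 9 by nlinarith),
          mul_nonneg hη.le (sub_nonneg.2 hD), mul_nonneg hη.le hη.le]
    refine ⟨R, ?_, ?_⟩
    · rintro ⟨u, v, huv, h⟩
      have h1 := (hR u v huv.ne).1
      have h2 := hbound p hp1
      have h3 : (s ^ 2 * n : ℝ) ≤ ({w | R.Adj u w ∧ R.Adj v w} : Set (Fin N)).ncard :=
        Nat.ceil_le.1 h
      rw [hps] at h2
      linarith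
    · rintro ⟨u, v, huv, h⟩
      have h1 := (hR u v huv.ne).2
      have h2 := hbound (1 - p) (by linarith)
      have h3 : (n : ℝ) ≤ ({w | Rᶜ.Adj u w ∧ Rᶜ.Adj v w} : Set (Fin N)).ncard := by
        exact_mod_cast h
      rw [show (1 - p) * (s + 1) = 1 by linarith, one_pow, one_mul] at h2
      linarith
  · refine ⟨⊥, fun ⟨u, v, huv, _⟩ ↦ huv, fun ⟨u, v, _, h⟩ ↦ ?_⟩
    have h1 := h.trans (Set.ncard_le_card _)
    rw [Nat.card_eq_fintype_card, Fintype.card_fin] at h1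
    omega

end Packings

/-- For `1/4 ≤ α ≤ 1`, `r(B_{⌈αn⌉}, B_n) = (√α + 1)² n + o(n)`. -/
theorem ramsey_book_asymptotic (α η : ℝ) (hα1 : 1/4 ≤ α) (hα2 : α ≤ 1) (hη : 0 < η) :
    ∃ n₀ : ℕ, ∀ n : ℕ, n₀ ≤ n →
      ((∀ N : ℕ, ((Real.sqrt α + 1) ^ 2 + η) * (n : ℝ) ≤ (N : ℝ) →
          ∀ R : SimpleGraph (Fin N), HasBook R ⌈α * (n : ℝ)⌉₊ ∨ HasBook Rᶜ n) ∧
       (∃ R : SimpleGraph (Fin ⌊((Real.sqrt α + 1) ^ 2 - η) * (n : ℝ)⌋₊),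
          ¬ HasBook R ⌈α * (n : ℝ)⌉₊ ∧ ¬ HasBook Rᶜ n)) := by
  obtain ⟨n₁, h₁⟩ := exists_forall_hasBook α η hα1 hα2 hη
  obtain ⟨n₂, h₂⟩ := exists_not_hasBook α η hα1 hα2 hη
  exact ⟨max n₁ n₂, fun n hn ↦
    ⟨h₁ n ((le_max_left _ _).trans hn), h₂ n ((le_max_right _ _).trans hn)⟩⟩
end

section
/- For every fixed real α with 0 < α ≤ 1 and every η > 0 there exists n₀ such that for all integers n ≥ n₀ there is a simple graph R on N = ⌊((√α + 1)² − η)·n⌋ vertices such that R contains no book B_{⌈αn⌉} and the complement of R contains no book B_n. Consequently, r(B_{⌈αn⌉}, B_n) ≥ (√α + 1)²·n − o(n). -/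
open MeasureTheory ProbabilityTheory

lemma measure_pi_forall_mem_eq {ι : Type*} [Fintype ι] (ν : Measure Bool) [IsProbabilityMeasure ν]
    (b : Bool) (T : Finset ι) :
    Measure.pi (fun _ : ι ↦ ν) {ω | ∀ e ∈ T, ω e = b} = ν {b} ^ T.card := by
  classical
  have h : {ω : ι → Bool | ∀ e ∈ T, ω e = b} =
      Set.univ.pi fun e ↦ if e ∈ T then {b} else Set.univ := by
    ext ω
    simp only [Set.mem_ofPred_eq, Set.mem_univ_pi]
    refine forall_congr' fun e ↦ ?_
    split_ifs with he <;> simp [he]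
  rw [h, Measure.pi_pi]
  have h_univ : ν Set.univ = 1 := measure_univ
  simp [apply_ite ν, -Bool.univ_eq, h_univ]

lemma iIndepSet_forall_mem_eq {ι κ : Type*} [Fintype ι] (ν : Measure Bool)
    [IsProbabilityMeasure ν] (b : Bool) (S : κ → Finset ι)
    (hS : Pairwise fun i j ↦ Disjoint (S i) (S j)) :
    iIndepSet (fun i ↦ {ω : ι → Bool | ∀ e ∈ S i, ω e = b}) (Measure.pi fun _ ↦ ν) := by
  classical
  rw [iIndepSet_iff_meas_biInter fun i ↦ (Set.toFinite _).measurableSet]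
  intro s
  have h : ⋂ i ∈ s, {ω : ι → Bool | ∀ e ∈ S i, ω e = b} =
      {ω | ∀ e ∈ s.biUnion S, ω e = b} := by
    ext ω
    simp only [Set.mem_iInter, Set.mem_ofPred_eq, Finset.mem_biUnion]
    grind
  rw [h, measure_pi_forall_mem_eq, Finset.card_biUnion fun i _ j _ hij ↦ hS hij,
    ← Finset.prod_pow_eq_pow_sum]
  simp only [measure_pi_forall_mem_eq]

/-- Hoeffding's inequality for the number of independent, equally likely events that occur. -/
lemma measureReal_le_ncard_le_exp {Ω κ : Type*} [MeasurableSpace Ω] [Fintype κ] (μ : Measure Ω)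
    (A : κ → Set Ω) (hA : iIndepSet A μ) (hm : ∀ i, MeasurableSet (A i)) (r : ℝ)
    (hr : ∀ i, μ.real (A i) = r) (ε : ℝ) (hε : 0 ≤ ε) :
    μ.real {ω | r * Fintype.card κ + ε ≤ ({i | ω ∈ A i} : Set κ).ncard} ≤
      Real.exp (-2 * ε ^ 2 / Fintype.card κ) := by
  classical
  have := hA.isProbabilityMeasure
  have hind := (hA.iIndepFun_indicator (β := ℝ)).comp (fun _ x ↦ x - r)
    (fun _ ↦ measurable_id.sub_const r)
  have hsub : ∀ i ∈ Finset.univ, HasSubgaussianMGF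
      ((fun x : ℝ ↦ x - r) ∘ (A i).indicator fun _ ↦ 1) ((‖(1 : ℝ) - 0‖₊ / 2) ^ 2) μ := by
    intro i _
    have h := hasSubgaussianMGF_of_mem_Icc (μ := μ) (a := 0) (b := 1)
      (X := (A i).indicator fun _ ↦ (1 : ℝ))
      (measurable_const.indicator (hm i)).aemeasurable
      (.of_forall fun ω ↦ by by_cases h : ω ∈ A i <;> simp [h])
    have hmean : ∫ ω, (A i).indicator (fun _ ↦ (1 : ℝ)) ω ∂μ = r := by
      rw [integral_indicator (hm i)]
      simpa using hr i
    rw [hmean] at h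
    exact h
  have h := HasSubgaussianMGF.measure_sum_ge_le_of_iIndepFun hind hsub hε
  have hset : {ω | r * Fintype.card κ + ε ≤ ({i | ω ∈ A i} : Set κ).ncard} =
      {ω | ε ≤ ∑ i, ((fun x : ℝ ↦ x - r) ∘ (A i).indicator fun _ ↦ 1) ω} := by
    ext ω
    have hsum : ∑ i, ((fun x : ℝ ↦ x - r) ∘ (A i).indicator fun _ ↦ 1) ω =
        ({i | ω ∈ A i} : Set κ).ncard - Fintype.card κ * r := by
      simp [Finset.sum_sub_distrib, Set.indicator_apply, Set.ncard_eq_toFinset_card']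
    simp only [Set.mem_ofPred_eq, hsum]
    constructor <;> intro <;> linarith
  rw [hset]
  refine h.trans_eq ?_
  congr 1
  simp
  ring

/-- The graph formed by the edges of color `b` in an edge-coloring of a complete graph. -/
def colorGraph {V : Type*} (ω : Sym2 V → Bool) (b : Bool) : SimpleGraph V where
  Adj u v := u ≠ v ∧ ω s(u, v) = b
  symm := ⟨fun u v h ↦ ⟨h.1.symm, by rw [Sym2.eq_swap]; exact h.2⟩⟩
  loopless := ⟨fun _ h ↦ h.1 rfl⟩

lemma compl_colorGraph_true {V : Type*} (ω : Sym2 V → Bool) :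
    (colorGraph ω true)ᶜ = colorGraph ω false := by
  ext u v
  simp only [SimpleGraph.compl_adj, colorGraph]
  grind

lemma measureReal_commonNeighbors_le {V : Type*} [Fintype V] (ν : Measure Bool)
    [IsProbabilityMeasure ν] (b : Bool) (ε : ℝ) (hε : 0 < ε) {u v : V} (huv : u ≠ v) :
    (Measure.pi fun _ : Sym2 V ↦ ν).real {ω | ν.real {b} ^ 2 * Fintype.card V + ε ≤
      ({w | (colorGraph ω b).Adj u w ∧ (colorGraph ω b).Adj v w} : Set V).ncard} ≤
      Real.exp (-2 * ε ^ 2 / Fintype.card V) := by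
  classical
  let κ := {w : V // w ≠ u ∧ w ≠ v}
  let S : κ → Finset (Sym2 V) := fun w ↦ {s(u, w.1), s(v, w.1)}
  have hS : Pairwise fun i j ↦ Disjoint (S i) (S j) := by
    rintro ⟨i, hi⟩ ⟨j, hj⟩ hij
    simp only [S, Finset.disjoint_left, Finset.mem_insert, Finset.mem_singleton]
    have : i ≠ j := fun h ↦ hij (Subtype.ext h)
    rintro e (rfl | rfl) <;> simp only [Sym2.eq_iff] <;> grind
  have hcard : ∀ w, (S w).card = 2 := by
    rintro ⟨w, hw⟩
    refine Finset.card_pair ?_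
    simp only [ne_eq, Sym2.eq_iff]
    grind
  have hκ : Fintype.card κ ≤ Fintype.card V := Fintype.card_subtype_le _
  have h := measureReal_le_ncard_le_exp _ _ (iIndepSet_forall_mem_eq ν b S hS)
    (fun i ↦ (Set.toFinite _).measurableSet) (ν.real {b} ^ 2)
    (fun i ↦ by rw [measureReal_def, measure_pi_forall_mem_eq, hcard, ENNReal.toReal_pow]; rfl)
    ε hε.le
  have hncard (ω : Sym2 V → Bool) :
      ({w | (colorGraph ω b).Adj u w ∧ (colorGraph ω b).Adj v w} : Set V).ncard =
      ({i | ω ∈ {ω : Sym2 V → Bool | ∀ e ∈ S i, ω e = b}} : Set κ).ncard := by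
    rw [← Set.ncard_image_of_injective _ (Subtype.val_injective)]
    congr 1
    ext w
    simp only [colorGraph, S, Set.mem_ofPred_eq, Finset.mem_insert, Finset.mem_singleton,
      forall_eq_or_imp, forall_eq, Set.mem_image, Subtype.exists, κ]
    grind
  simp only [hncard]
  obtain hκ₀ | hκ₀ := isEmpty_or_nonempty κ
  · refine (measureReal_mono (s₂ := ∅) fun ω hω ↦ ?_).trans (by simp [Real.exp_nonneg])
    have hω' : ν.real {b} ^ 2 * Fintype.card V + ε ≤ 0 := by
      simpa [Set.eq_empty_of_isEmpty] using hω
    have : 0 ≤ ν.real {b} ^ 2 * Fintype.card V := by positivity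
    linarith
  refine (measureReal_mono fun ω hω ↦ ?_).trans (h.trans ?_)
  · refine le_trans ?_ (Set.mem_ofPred_eq ▸ hω)
    gcongr
  · have : (0 : ℝ) < Fintype.card κ := by exact_mod_cast Fintype.card_pos
    simp only [neg_mul, neg_div]
    gcongr

lemma measureReal_hasBook_le {V : Type*} [Fintype V] (ν : Measure Bool)
    [IsProbabilityMeasure ν] (b : Bool) (ε : ℝ) (hε : 0 < ε) (m : ℕ)
    (hm : ν.real {b} ^ 2 * Fintype.card V + ε ≤ m) :
    (Measure.pi fun _ : Sym2 V ↦ ν).real {ω | HasBook (colorGraph ω b) m} ≤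
      (Fintype.card V : ℝ) ^ 2 * Real.exp (-2 * ε ^ 2 / Fintype.card V) := by
  classical
  set μ := Measure.pi fun _ : Sym2 V ↦ ν
  have hsub : {ω | HasBook (colorGraph ω b) m} ⊆
      ⋃ p ∈ (Finset.univ : Finset (V × V)), {ω | p.1 ≠ p.2 ∧ ν.real {b} ^ 2 * Fintype.card V + ε ≤
      ({w | (colorGraph ω b).Adj p.1 w ∧ (colorGraph ω b).Adj p.2 w} : Set V).ncard} := by
    rintro ω ⟨u, v, huv, h⟩
    simp only [Set.mem_iUnion]
    exact ⟨(u, v), Finset.mem_univ _, huv.1, hm.trans (by exact_mod_cast h)⟩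
  calc μ.real {ω | HasBook (colorGraph ω b) m}
      ≤ ∑ p : V × V, μ.real {ω | p.1 ≠ p.2 ∧ ν.real {b} ^ 2 * Fintype.card V + ε ≤
      ({w | (colorGraph ω b).Adj p.1 w ∧ (colorGraph ω b).Adj p.2 w} : Set V).ncard} :=
        (measureReal_mono hsub (measure_ne_top _ _)).trans (measureReal_biUnion_finset_le _ _)
    _ ≤ ∑ p : V × V, Real.exp (-2 * ε ^ 2 / Fintype.card V) := by
        refine Finset.sum_le_sum fun p _ ↦ ?_
        by_cases hp : p.1 = p.2
        · simp [hp, Real.exp_nonneg]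
        · simpa [hp] using measureReal_commonNeighbors_le ν b ε hε hp
    _ = _ := by simp [sq]

open unitInterval in
lemma exists_graph_not_hasBook {V : Type*} [Fintype V] (p : ℝ) (hp₀ : 0 ≤ p) (hp₁ : p ≤ 1)
    (ε : ℝ) (hε : 0 < ε) (m n : ℕ) (hm : p ^ 2 * Fintype.card V + ε ≤ m)
    (hn : (1 - p) ^ 2 * Fintype.card V + ε ≤ n)
    (hlt : 2 * (Fintype.card V : ℝ) ^ 2 * Real.exp (-2 * ε ^ 2 / Fintype.card V) < 1) :
    ∃ R : SimpleGraph V, ¬ HasBook R m ∧ ¬ HasBook Rᶜ n := by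
  classical
  let P : I := ⟨p, hp₀, hp₁⟩
  let ν : Measure Bool := bernoulliMeasure true false P
  have htrue : ν.real {true} = p := by simp [ν, P]
  have hfalse : ν.real {false} = 1 - p := by simp [ν, P]
  have h₁ := measureReal_hasBook_le (V := V) ν true ε hε m (by rwa [htrue])
  have h₂ := measureReal_hasBook_le (V := V) ν false ε hε n (by rwa [hfalse])
  by_contra! hcon
  have huniv : {ω : Sym2 V → Bool | HasBook (colorGraph ω true) m} ∪
      {ω | HasBook (colorGraph ω false) n} = Set.univ := by
    ext ω
    have := hcon (colorGraph ω true)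
    rw [compl_colorGraph_true] at this
    simp only [Set.mem_union, Set.mem_ofPred_eq, Set.mem_univ, iff_true]
    tauto
  have h := measureReal_union_le (μ := Measure.pi fun _ : Sym2 V ↦ ν)
    {ω : Sym2 V → Bool | HasBook (colorGraph ω true) m} {ω | HasBook (colorGraph ω false) n}
  rw [huniv, probReal_univ] at h
  linarith

/-- The random lower bound: `r(B_{⌈αn⌉}, B_n) ≥ (√α + 1)² n − o(n)` for `0 < α ≤ 1`. -/
theorem ramsey_book_random_lower_bound (α η : ℝ) (hα1 : 0 < α) (hα2 : α ≤ 1) (hη : 0 < η) :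
    ∃ n₀ : ℕ, ∀ n : ℕ, n₀ ≤ n →
      ∃ R : SimpleGraph (Fin ⌊((Real.sqrt α + 1) ^ 2 - η) * (n : ℝ)⌋₊),
        ¬ HasBook R ⌈α * (n : ℝ)⌉₊ ∧ ¬ HasBook Rᶜ n := by
  set s := Real.sqrt α
  have hs0 : 0 < s := Real.sqrt_pos.2 hα1
  have hsα : s ^ 2 = α := Real.sq_sqrt hα1.le
  set C := (s + 1) ^ 2 with hC
  have hC0 : 0 < C := by positivity
  set κ := η * α / C with hκ
  have hκ0 : 0 < κ := by positivity
  have hlim : Filter.Tendsto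
      (fun n : ℕ ↦ 2 * C ^ 2 * ((n : ℝ) ^ 2 * Real.exp (-(2 * κ ^ 2 / C) * n)))
      Filter.atTop (nhds 0) := by
    have h := (tendsto_rpow_mul_exp_neg_mul_atTop_nhds_zero 2 (2 * κ ^ 2 / C)
      (by positivity)).comp tendsto_natCast_atTop_atTop
    simpa using h.const_mul (2 * C ^ 2)
  obtain ⟨n₀, hn₀⟩ := Filter.eventually_atTop.1 (hlim.eventually (gt_mem_nhds one_pos))
  refine ⟨n₀, fun n hn ↦ ?_⟩
  set N := ⌊(C - η) * (n : ℝ)⌋₊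
  obtain hN0 | hN0 := Nat.eq_zero_or_pos N
  · have : IsEmpty (Fin N) := by rw [hN0]; infer_instance
    exact ⟨⊥, fun ⟨u, _⟩ ↦ isEmptyElim u, fun ⟨u, _⟩ ↦ isEmptyElim u⟩
  have hNle : (N : ℝ) ≤ (C - η) * n :=
    Nat.floor_le (zero_le_one.trans (Nat.floor_pos.1 hN0))
  have hNpos : (0 : ℝ) < N := by exact_mod_cast hN0
  have hn_pos : (0 : ℝ) < n := n.cast_nonneg.lt_of_ne fun h ↦ by
    rw [← h, mul_zero] at hNle
    linarith
  have hNC : (N : ℝ) ≤ C * n := by nlinarith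
  refine exists_graph_not_hasBook (s / (s + 1)) (by positivity)
    (by rw [div_le_one (by positivity)]; linarith) (κ * n) (by positivity) _ _ ?_ ?_ ?_
  · refine le_trans ?_ (Nat.le_ceil _)
    rw [Fintype.card_fin, div_pow, hsα, ← hC]
    calc α / C * N + κ * n ≤ α / C * ((C - η) * n) + κ * n := by gcongr
      _ = α * n := by rw [hκ]; field_simp; ring
  · have hp : 1 - s / (s + 1) = 1 / (s + 1) := by field_simp; ring
    rw [Fintype.card_fin, hp, div_pow, one_pow, ← hC]
    calc 1 / C * N + κ * n ≤ 1 / C * ((C - η) * n) + η * 1 / C * n := by rw [hκ]; gcongr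
      _ = n := by field_simp; ring
  · rw [Fintype.card_fin]
    refine lt_of_le_of_lt ?_ (hn₀ n hn)
    have hexp : -2 * (κ * n) ^ 2 / N ≤ -(2 * κ ^ 2 / C) * n := by
      rw [div_le_iff₀ hNpos]
      have h : (2 * κ ^ 2 / C) * n * N ≤ (2 * κ ^ 2 / C) * n * (C * n) := by gcongr
      have h' : (2 * κ ^ 2 / C) * n * (C * n) = 2 * (κ * n) ^ 2 := by field_simp
      linarith
    calc 2 * (N : ℝ) ^ 2 * Real.exp (-2 * (κ * n) ^ 2 / N)
        ≤ 2 * (C * n) ^ 2 * Real.exp (-(2 * κ ^ 2 / C) * n) := by gcongr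
      _ = _ := by ring
end

section
/- For every integer k ≥ 2, every fixed real α with 0 < α ≤ 1, and every η > 0, there exists n₀ such that for all integers n ≥ n₀ there is a simple graph R on N = ⌊((α^{1/k} + 1)^k − η)·n⌋ vertices such that R contains no k-book B^{(k)}_{⌈αn⌉} and the complement of R contains no k-book B^{(k)}_n. Consequently, r(B^{(k)}_{⌈αn⌉}, B^{(k)}_n) ≥ (α^{1/k} + 1)^k·n − o(n). -/
/-- A simple graph `G` contains the `k`-book `B^{(k)}_n`: a clique on `k` vertices whose
vertices have at least `n` common neighbors. -/
def HasKBook {V : Type*} (G : SimpleGraph V) (k n : ℕ) : Prop :=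
  ∃ S : Finset V, S.card = k ∧ G.IsClique (S : Set V) ∧
    n ≤ ({w | ∀ v ∈ S, G.Adj v w} : Set V).ncard

/-- For independent edge colors with weights `wt`, the expectation of a product of functions of
distinct edges factors. -/
lemma sum_prod_mul_prod_eq_pow {E ι : Type*} [Fintype E] [DecidableEq E]
    (wt x : Bool → ℝ) (hwt : ∑ b, wt b = 1) (I : Finset ι) (g : ι → E)
    (hg : Set.InjOn g I) :
    ∑ f : E → Bool, (∏ e, wt (f e)) * ∏ i ∈ I, x (f (g i)) =
      (∑ b, wt b * x b) ^ I.card := by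
  have h1 : ∀ f : E → Bool, (∏ e, wt (f e)) * ∏ i ∈ I, x (f (g i)) =
      ∏ e, wt (f e) * (if e ∈ I.image g then x (f e) else 1) := by
    intro f
    rw [Finset.prod_mul_distrib, Finset.prod_ite_mem, Finset.univ_inter,
      Finset.prod_image hg]
  have h2 := Finset.prod_univ_sum (fun _ : E => (Finset.univ : Finset Bool))
    (fun e b => wt b * (if e ∈ I.image g then x b else 1))
  rw [Fintype.piFinset_univ] at h2
  rw [Finset.sum_congr rfl fun f _ => h1 f, ← h2, ← Finset.card_image_of_injOn hg,
    ← Finset.prod_const, ← Finset.univ_inter (I.image g), ← Finset.prod_ite_mem,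
    Finset.univ_inter]
  refine Finset.prod_congr rfl fun e _ => ?_
  split_ifs
  · rfl
  · simpa using hwt

/-- The exponential moment of the number of common neighbors of `S` in color `b`. -/
lemma sum_prod_mul_prod_one_add {V : Type*} [Fintype V] [DecidableEq V]
    (wt : Bool → ℝ) (hwt : ∑ b, wt b = 1) (b : Bool) (c : ℝ) (S : Finset V) :
    ∑ f : Sym2 V → Bool, (∏ e, wt (f e)) *
        ∏ w ∈ Sᶜ, (1 + c * ∏ v ∈ S, if f s(v, w) = b then 1 else 0) =
      (1 + c * wt b ^ S.card) ^ (Sᶜ).card := by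
  have h1 : ∀ f : Sym2 V → Bool, (∏ e, wt (f e)) *
      ∏ w ∈ Sᶜ, (1 + c * ∏ v ∈ S, if f s(v, w) = b then (1 : ℝ) else 0) =
      ∑ T ∈ (Sᶜ).powerset, c ^ T.card * ((∏ e, wt (f e)) *
        ∏ i ∈ S ×ˢ T, if f s(i.1, i.2) = b then (1 : ℝ) else 0) := by
    intro f
    rw [Finset.prod_one_add, Finset.mul_sum]
    refine Finset.sum_congr rfl fun T _ => ?_
    rw [Finset.prod_mul_distrib, Finset.prod_const, Finset.prod_product_right]
    ring
  rw [Finset.sum_congr rfl fun f _ => h1 f, Finset.sum_comm]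
  have h2 : ∀ T ∈ (Sᶜ).powerset, ∑ f : Sym2 V → Bool, c ^ T.card * ((∏ e, wt (f e)) *
      ∏ i ∈ S ×ˢ T, if f s(i.1, i.2) = b then (1 : ℝ) else 0) =
      ∏ w ∈ T, c * wt b ^ S.card := by
    intro T hT
    have hinj : Set.InjOn (fun i : V × V => s(i.1, i.2)) (S ×ˢ T : Finset (V × V)) := by
      rintro ⟨v, w⟩ h ⟨v', w'⟩ h' heq
      simp only [Finset.mem_coe, Finset.mem_product] at h h'
      have hw := Finset.mem_compl.1 (Finset.mem_powerset.1 hT h.2)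
      rcases Sym2.eq_iff.1 heq with h3 | h3
      · exact Prod.ext h3.1 h3.2
      · exact absurd (show w ∈ S from (show w = v' from h3.2) ▸ h'.1) hw
    rw [← Finset.mul_sum, sum_prod_mul_prod_eq_pow wt (fun b' => if b' = b then 1 else 0) hwt
      (S ×ˢ T) (fun i => s(i.1, i.2)) hinj, Finset.prod_const, Finset.card_product, mul_pow,
      pow_mul]
    simp
  rw [Finset.sum_congr rfl h2, ← Finset.prod_one_add, Finset.prod_const]

/-- A book in color `b` makes one of the exponential-moment terms large. -/
lemma one_add_pow_le_of_hasKBook {V : Type*} [Fintype V] [DecidableEq V]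
    (G : SimpleGraph V) (f : Sym2 V → Bool) (b : Bool)
    (hG : ∀ v w, G.Adj v w → f s(v, w) = b) {c : ℝ} (hc : 0 ≤ c) {k t : ℕ}
    (h : HasKBook G k t) :
    ∃ S ∈ Finset.powersetCard k (Finset.univ : Finset V), (1 + c) ^ t ≤
      ∏ w ∈ Sᶜ, (1 + c * ∏ v ∈ S, if f s(v, w) = b then (1 : ℝ) else 0) := by
  classical
  obtain ⟨S, hS, -, ht⟩ := h
  refine ⟨S, by simp [hS], ?_⟩
  set A : Finset V := {w | ∀ v ∈ S, G.Adj v w} with hA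
  have hAt : t ≤ A.card := by
    refine ht.trans (le_of_eq ?_)
    rw [← Set.ncard_coe_finset]
    simp [hA]
  have hAS : A ⊆ Sᶜ := by
    intro w hw
    simp only [hA, Finset.mem_filter, Finset.mem_univ, true_and] at hw
    exact Finset.mem_compl.2 fun hwS => G.irrefl (hw w hwS)
  have hx : ∀ w, 0 ≤ c * ∏ v ∈ S, if f s(v, w) = b then (1 : ℝ) else 0 := fun w =>
    mul_nonneg hc (Finset.prod_nonneg fun v _ => by positivity)
  calc (1 + c) ^ t ≤ (1 + c) ^ A.card := pow_le_pow_right₀ (by linarith) hAt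
    _ = ∏ w ∈ A, (1 + c * ∏ v ∈ S, if f s(v, w) = b then (1 : ℝ) else 0) := by
        rw [← Finset.prod_const]
        refine Finset.prod_congr rfl fun w hw => ?_
        simp only [hA, Finset.mem_filter, Finset.mem_univ, true_and] at hw
        rw [Finset.prod_eq_one fun v hv => if_pos (hG v w (hw v hv)), mul_one]
    _ ≤ _ := by
        refine Finset.prod_le_prod_of_subset_of_one_le hAS (fun w _ => ?_) fun w _ _ => ?_
        · have := hx w
          linarith
        · have := hx w
          linarith

/-- First-moment criterion for a graph avoiding a `k`-book with `t₁` pages whose complement avoids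
a `k`-book with `t₂` pages. -/
lemma exists_not_hasKBook {V : Type*} [Fintype V] {k t₁ t₂ : ℕ} {p q c : ℝ}
    (hp : 0 ≤ p) (hq : 0 ≤ q) (hpq : p + q = 1) (hc : 0 ≤ c)
    (h₁ : (Fintype.card V : ℝ) ^ k * (1 + c * p ^ k) ^ Fintype.card V < 1 / 2 * (1 + c) ^ t₁)
    (h₂ : (Fintype.card V : ℝ) ^ k * (1 + c * q ^ k) ^ Fintype.card V < 1 / 2 * (1 + c) ^ t₂) :
    ∃ R : SimpleGraph V, ¬ HasKBook R k t₁ ∧ ¬ HasKBook Rᶜ k t₂ := by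
  classical
  let wt : Bool → ℝ := fun b => if b then p else q
  have hwt : ∑ b, wt b = 1 := by simpa [wt] using hpq
  have hwt0 : ∀ b, 0 ≤ wt b := by simp [wt, hp, hq]
  let W : (Sym2 V → Bool) → ℝ := fun f => ∏ e, wt (f e)
  have hW0 : ∀ f, 0 ≤ W f := fun f => Finset.prod_nonneg fun e _ => hwt0 _
  have hW1 : ∑ f, W f = 1 := by
    simpa [W] using sum_prod_mul_prod_eq_pow wt 1 hwt (∅ : Finset (Sym2 V)) id (by simp)
  let X : Bool → Finset V → (Sym2 V → Bool) → ℝ := fun b S f =>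
    ∏ w ∈ Sᶜ, (1 + c * ∏ v ∈ S, if f s(v, w) = b then (1 : ℝ) else 0)
  have hX0 : ∀ b S f, 0 ≤ X b S f := fun b S f => Finset.prod_nonneg fun w _ =>
    add_nonneg zero_le_one (mul_nonneg hc (Finset.prod_nonneg fun v _ => by positivity))
  let Y : Bool → (Sym2 V → Bool) → ℝ := fun b f =>
    ∑ S ∈ Finset.powersetCard k (Finset.univ : Finset V), X b S f
  have hY : ∀ b, ∑ f, W f * Y b f ≤
      (Fintype.card V : ℝ) ^ k * (1 + c * wt b ^ k) ^ Fintype.card V := by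
    intro b
    have hb : 1 ≤ 1 + c * wt b ^ k := by
      have := mul_nonneg hc (pow_nonneg (hwt0 b) k)
      linarith
    simp only [Y, Finset.mul_sum]
    rw [Finset.sum_comm]
    calc _ ≤ ∑ S ∈ Finset.powersetCard k (Finset.univ : Finset V),
          (1 + c * wt b ^ k) ^ Fintype.card V := by
          refine Finset.sum_le_sum fun S hS => ?_
          have := sum_prod_mul_prod_one_add wt hwt b c S
          rw [(Finset.mem_powersetCard.1 hS).2] at this
          exact this.le.trans (pow_le_pow_right₀ hb (Finset.card_le_univ _))
      _ ≤ _ := by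
          rw [Finset.sum_const, Finset.card_powersetCard, nsmul_eq_mul, Finset.card_univ]
          refine mul_le_mul_of_nonneg_right ?_ (by positivity)
          exact_mod_cast Nat.choose_le_pow _ _
  have hlt : ∑ f, W f * (Y true f / (1 + c) ^ t₁ + Y false f / (1 + c) ^ t₂) < ∑ f, W f * 1 := by
    have e₁ : (∑ f, W f * Y true f) / (1 + c) ^ t₁ < 1 / 2 := by
      rw [div_lt_iff₀ (by positivity)]
      exact (hY true).trans_lt (by simpa [wt] using h₁)
    have e₂ : (∑ f, W f * Y false f) / (1 + c) ^ t₂ < 1 / 2 := by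
      rw [div_lt_iff₀ (by positivity)]
      exact (hY false).trans_lt (by simpa [wt] using h₂)
    simp only [mul_one, hW1, mul_add, Finset.sum_add_distrib, ← mul_div_assoc, ← Finset.sum_div]
    linarith
  obtain ⟨f, -, hf⟩ := Finset.exists_lt_of_sum_lt hlt
  have hf1 := lt_of_mul_lt_mul_left hf (hW0 f)
  have key : ∀ (b : Bool) (t : ℕ) (G : SimpleGraph V), Y b f / (1 + c) ^ t < 1 →
      (∀ v w, G.Adj v w → f s(v, w) = b) → ¬ HasKBook G k t := by
    intro b t G hlt hG hbook
    obtain ⟨S, hS, hle⟩ := one_add_pow_le_of_hasKBook G f b hG hc hbook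
    rw [div_lt_one (by positivity)] at hlt
    exact absurd (hle.trans (Finset.single_le_sum (fun S _ => hX0 b S f) hS)) hlt.not_ge
  have n₁ : 0 ≤ Y true f / (1 + c) ^ t₁ :=
    div_nonneg (Finset.sum_nonneg fun S _ => hX0 _ S f) (by positivity)
  have n₂ : 0 ≤ Y false f / (1 + c) ^ t₂ :=
    div_nonneg (Finset.sum_nonneg fun S _ => hX0 _ S f) (by positivity)
  refine ⟨SimpleGraph.fromEdgeSet {e | f e = true}, key true t₁ _ (by linarith) ?_,
    key false t₂ _ (by linarith) ?_⟩
  · intro v w h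
    simpa using ((SimpleGraph.fromEdgeSet_adj _).1 h).1
  · intro v w h
    rw [SimpleGraph.compl_adj, SimpleGraph.fromEdgeSet_adj] at h
    simpa [h.1] using h.2

/-- Exponential decay beats the number of `k`-sets in the union bound. -/
lemma eventually_pow_mul_one_add_pow_lt (k : ℕ) {τ δ C P : ℝ} (hτ : 0 < τ) (hδ : 0 < δ)
    (hP : 0 ≤ P) (hPC : P * C ≤ τ * (1 - δ)) :
    ∀ᶠ n : ℕ in Filter.atTop, ∀ N t : ℕ, (N : ℝ) ≤ C * n → τ * n ≤ t →
      (N : ℝ) ^ k * (1 + δ * P) ^ N < 1 / 2 * (1 + δ) ^ t := by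
  set β : ℝ := τ * δ ^ 3 / (1 + δ) with hβdef
  have hβ : 0 < β := by positivity
  have hlim : Filter.Tendsto (fun n : ℕ => C ^ k * ((n : ℝ) ^ k / Real.exp (β * n)))
      Filter.atTop (nhds 0) := by
    have h := (isLittleO_pow_exp_pos_mul_atTop k hβ).tendsto_div_nhds_zero.comp
      (tendsto_natCast_atTop_atTop (R := ℝ))
    simpa using h.const_mul (C ^ k)
  filter_upwards [hlim.eventually (gt_mem_nhds (show (0 : ℝ) < 1 / 2 by norm_num))]
    with n hn N t hN ht
  have hpow : (N : ℝ) ^ k ≤ C ^ k * (n : ℝ) ^ k := by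
    rw [← mul_pow]
    exact pow_le_pow_left₀ (Nat.cast_nonneg N) hN k
  have hsmall : C ^ k * (n : ℝ) ^ k < 1 / 2 * Real.exp (β * n) := by
    rwa [← mul_div_assoc, div_lt_iff₀ (Real.exp_pos _)] at hn
  have hupper : (1 + δ * P) ^ N ≤ Real.exp (δ * (τ * (1 - δ)) * n) := by
    calc (1 + δ * P) ^ N ≤ Real.exp (δ * P) ^ N :=
          pow_le_pow_left₀ (by positivity) (by linarith [Real.add_one_le_exp (δ * P)]) N
      _ = Real.exp (N * (δ * P)) := (Real.exp_nat_mul _ _).symm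
      _ ≤ _ := by
          refine Real.exp_le_exp.2 ?_
          calc (N : ℝ) * (δ * P) ≤ C * n * (δ * P) := by gcongr
            _ = δ * n * (P * C) := by ring
            _ ≤ δ * n * (τ * (1 - δ)) := by gcongr
            _ = _ := by ring
  have hlower : Real.exp (δ / (1 + δ) * (τ * n)) ≤ (1 + δ) ^ t := by
    have hlog : δ / (1 + δ) ≤ Real.log (1 + δ) := by
      have h := Real.one_sub_inv_le_log_of_pos (show 0 < 1 + δ by linarith)
      refine le_trans (le_of_eq ?_) h
      field_simp
      ring
    rw [← Real.exp_log (show 0 < (1 + δ) ^ t by positivity), Real.log_pow]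
    refine Real.exp_le_exp.2 ?_
    calc δ / (1 + δ) * (τ * n) ≤ Real.log (1 + δ) * t := by
          gcongr
          exact Real.log_nonneg (by linarith)
      _ = _ := mul_comm _ _
  calc (N : ℝ) ^ k * (1 + δ * P) ^ N
      ≤ (C ^ k * (n : ℝ) ^ k) * Real.exp (δ * (τ * (1 - δ)) * n) :=
        mul_le_mul hpow hupper (by positivity) (hpow.trans' (by positivity))
    _ < (1 / 2 * Real.exp (β * n)) * Real.exp (δ * (τ * (1 - δ)) * n) := by gcongr
    _ = 1 / 2 * Real.exp (δ / (1 + δ) * (τ * n)) := by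
        rw [mul_assoc, ← Real.exp_add]
        congr 2
        rw [hβdef]
        field_simp
        ring
    _ ≤ _ := by gcongr

/-- The random lower bound: `r(B^{(k)}_{⌈αn⌉}, B^{(k)}_n) ≥ (α^{1/k} + 1)^k n − o(n)`
for every `k ≥ 2` and `0 < α ≤ 1`. -/
theorem ramsey_kbook_random_lower_bound (k : ℕ) (hk : 2 ≤ k)
    (α η : ℝ) (hα1 : 0 < α) (hα2 : α ≤ 1) (hη : 0 < η) :
    ∃ n₀ : ℕ, ∀ n : ℕ, n₀ ≤ n →
      ∃ R : SimpleGraph (Fin ⌊((α ^ ((1 : ℝ) / (k : ℝ)) + 1) ^ k - η) * (n : ℝ)⌋₊),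
        ¬ HasKBook R k ⌈α * (n : ℝ)⌉₊ ∧ ¬ HasKBook Rᶜ k n := by
  set a : ℝ := α ^ ((1 : ℝ) / (k : ℝ)) with ha
  have ha0 : 0 < a := Real.rpow_pos_of_pos hα1 _
  have hak : a ^ k = α := by
    rw [ha, one_div]
    exact Real.rpow_inv_natCast_pow hα1.le (by lia)
  set C : ℝ := (a + 1) ^ k - η with hC
  rcases le_or_gt C 0 with hC0 | hC0
  · refine ⟨0, fun n _ => ⟨⊥, ?_⟩⟩
    have hN : ⌊C * (n : ℝ)⌋₊ = 0 :=
      Nat.floor_of_nonpos (mul_nonpos_of_nonpos_of_nonneg hC0 (Nat.cast_nonneg n))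
    have hno : ∀ (G : SimpleGraph (Fin ⌊C * (n : ℝ)⌋₊)) (t : ℕ), ¬ HasKBook G k t := by
      rintro G t ⟨S, hS, -⟩
      have := S.card_le_univ
      rw [Fintype.card_fin] at this
      lia
    exact ⟨hno _ _, hno _ _⟩
  have hδ : 0 < η / (a + 1) ^ k := by positivity
  have h₁ := eventually_pow_mul_one_add_pow_lt k (C := C) (P := (a / (a + 1)) ^ k) hα1 hδ
    (by positivity) (le_of_eq (by rw [hC, div_pow, hak]; field_simp))
  have h₂ := eventually_pow_mul_one_add_pow_lt k (C := C) (P := (1 / (a + 1)) ^ k) one_pos hδ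
    (by positivity) (le_of_eq (by rw [hC, div_pow, one_pow]; field_simp))
  obtain ⟨n₀, hn₀⟩ := Filter.eventually_atTop.1 (h₁.and h₂)
  refine ⟨n₀, fun n hn => ?_⟩
  have hN : (⌊C * (n : ℝ)⌋₊ : ℝ) ≤ C * n := Nat.floor_le (by positivity)
  refine exists_not_hasKBook (p := a / (a + 1)) (q := 1 / (a + 1)) (c := η / (a + 1) ^ k)
    (by positivity) (by positivity) (by field_simp) hδ.le ?_ ?_
  · rw [Fintype.card_fin]
    exact (hn₀ n hn).1 _ _ hN (Nat.le_ceil _)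
  · rw [Fintype.card_fin]
    exact (hn₀ n hn).2 _ _ hN (by simp)
end

section
/- For every fixed real α with 1/6 ≤ α ≤ 1/4 and every η > 0 there exists n₀ such that for all integers n ≥ n₀ and every N ≥ (3/2 + 3α + η)·n, every simple graph R on N vertices either contains a book B_{⌈αn⌉} or its complement contains a book B_n. Consequently, r(B_{⌈αn⌉}, B_n) ≤ (3/2 + 3α)·n + o(n). -/
section BookRamsey

open Finset

open Classical in
/-- Ramsey's theorem for graphs, with cliques inside a prescribed vertex set. -/
theorem exists_ramsey_bound (k l : ℕ) : ∃ M : ℕ, ∀ {V : Type} (G : SimpleGraph V)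
    (S : Finset V), M ≤ #S →
      (∃ T ⊆ S, #T = k ∧ G.IsClique T) ∨ ∃ T ⊆ S, #T = l ∧ Gᶜ.IsClique T := by
  induction k generalizing l with
  | zero => exact ⟨0, fun G S _ => Or.inl ⟨∅, by simp, by simp, by simp⟩⟩
  | succ k ihk =>
    induction l with
    | zero => exact ⟨0, fun G S _ => Or.inr ⟨∅, by simp, by simp, by simp⟩⟩
    | succ l ihl =>
      obtain ⟨M₁, h₁⟩ := ihk (l + 1)
      obtain ⟨M₂, h₂⟩ := ihl
      refine ⟨M₁ + M₂ + 1, fun {V} G S hS => ?_⟩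
      obtain ⟨v, hv⟩ : S.Nonempty := card_pos.mp (by omega)
      have hcard : #((S.erase v).filter (G.Adj v)) + #((S.erase v).filter (fun w => ¬ G.Adj v w))
          = #S - 1 := by
        rw [card_filter_add_card_filter_not, card_erase_of_mem hv]
      rcases le_or_gt M₁ #((S.erase v).filter (G.Adj v)) with h | h
      · rcases h₁ G _ h with ⟨T, hT, hTc, hTq⟩ | ⟨T, hT, hTc, hTq⟩
        · left
          have hadj : ∀ w ∈ T, G.Adj v w := fun w hw => (mem_filter.mp (hT hw)).2
          refine ⟨insert v T, insert_subset hv (hT.trans ((filter_subset _ _).trans (erase_subset _ _))), ?_, ?_⟩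
          · rw [card_insert_of_notMem (fun h => (hadj v h).ne rfl), hTc]
          · rw [coe_insert]
            exact hTq.insert (fun w hw _ => hadj w hw)
        · exact Or.inr ⟨T, hT.trans ((filter_subset _ _).trans (erase_subset _ _)), hTc, hTq⟩
      · rcases h₂ G ((S.erase v).filter (fun w => ¬ G.Adj v w)) (by omega) with
          ⟨T, hT, hTc, hTq⟩ | ⟨T, hT, hTc, hTq⟩
        · exact Or.inl ⟨T, hT.trans ((filter_subset _ _).trans (erase_subset _ _)), hTc, hTq⟩
        · right
          have hmem : ∀ w ∈ T, v ≠ w ∧ ¬ G.Adj v w := fun w hw =>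
            ⟨(ne_of_mem_erase (mem_filter.mp (hT hw)).1).symm, (mem_filter.mp (hT hw)).2⟩
          refine ⟨insert v T, insert_subset hv (hT.trans ((filter_subset _ _).trans (erase_subset _ _))), ?_, ?_⟩
          · rw [card_insert_of_notMem (fun h => (hmem v h).1 rfl), hTc]
          · rw [coe_insert]
            exact hTq.insert (fun w hw _ => (SimpleGraph.compl_adj G v w).mpr (hmem w hw))

open Classical in
/-- A greedily chosen maximal disjoint family of `t`-subsets of `S` with a given property. -/
theorem exists_maximal_disjoint_family {V : Type} (p : Finset V → Prop) {t : ℕ} (ht : 0 < t)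
    (S : Finset V) : ∃ F : Finset (Finset V), (∀ T ∈ F, T ⊆ S ∧ #T = t ∧ p T) ∧
      (F : Set (Finset V)).PairwiseDisjoint id ∧ ∀ T ⊆ S \ F.biUnion id, #T = t → ¬ p T := by
  induction S using Finset.strongInduction with
  | H S ih =>
    by_cases h : ∃ T ⊆ S, #T = t ∧ p T
    · obtain ⟨T, hTS, hTc, hTp⟩ := h
      have hne : T.Nonempty := card_pos.mp (by omega)
      obtain ⟨F, hF, hd, hmax⟩ := ih (S \ T) (sdiff_ssubset hTS hne)
      refine ⟨insert T F, ?_, ?_, ?_⟩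
      · intro T' hT'
        rcases mem_insert.mp hT' with rfl | h
        · exact ⟨hTS, hTc, hTp⟩
        · exact ⟨(hF T' h).1.trans sdiff_subset, (hF T' h).2⟩
      · rw [coe_insert]
        refine hd.insert fun T' hT' _ => ?_
        exact (disjoint_sdiff (s := T) (t := S)).mono_right (hF T' hT').1
      · intro T' hT'
        refine hmax T' (hT'.trans ?_)
        rw [biUnion_insert, id, ← sup_eq_union, ← sdiff_sdiff_left]
    · push Not at h
      exact ⟨∅, by simp, by simp, fun T hT hc => h T (hT.trans sdiff_subset) hc⟩

/-- Some subset of prescribed size has at least the average density. -/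
theorem exists_subset_dense {ι : Type} (f : ι → ℝ) (c : ℝ) (Z : Finset ι) (M : ℕ)
    (hZ : M ≤ #Z) (h : c * #Z ≤ ∑ z ∈ Z, f z) :
    ∃ Z₀ ⊆ Z, #Z₀ = M ∧ c * M ≤ ∑ z ∈ Z₀, f z := by
  classical
  induction Z using Finset.strongInduction with
  | H Z ih =>
    rcases hZ.eq_or_lt with h' | h'
    · exact ⟨Z, Subset.rfl, h'.symm, by rwa [h']⟩
    · by_cases hz : ∃ z ∈ Z, f z ≤ c
      · obtain ⟨z, hzZ, hz⟩ := hz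
        have hc : #(Z.erase z) + 1 = #Z := card_erase_add_one hzZ
        have hc' : (#(Z.erase z) : ℝ) + 1 = #Z := by exact_mod_cast hc
        obtain ⟨Z₀, h₀, h₁, h₂⟩ := ih (Z.erase z) (erase_ssubset hzZ) (by omega) (by
          have := add_sum_erase Z f hzZ
          rw [← hc'] at h
          linarith)
        exact ⟨Z₀, h₀.trans (erase_subset _ _), h₁, h₂⟩
      · push Not at hz
        obtain ⟨Z₀, h₀, h₁⟩ := exists_subset_card_eq hZ
        refine ⟨Z₀, h₀, h₁, ?_⟩
        rw [← h₁, mul_comm, ← nsmul_eq_mul]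
        exact card_nsmul_le_sum _ _ _ fun z hz' => (hz z (h₀ hz')).le

open Classical in
/-- In a dense bipartite relation, some `s`-set is fully related to a positive proportion. -/
theorem exists_common_related {ε : ℝ} (hε : 0 < ε) (hε₁ : ε ≤ 1) (s : ℕ) :
    ∃ M : ℕ, ∃ ε' : ℝ, 0 < ε' ∧
    ∀ {ι κ : Type} (P : ι → κ → Prop) (A : Finset ι) (Z : Finset κ), M ≤ #Z →
      ε * (#A * #Z) ≤ ∑ a ∈ A, ∑ z ∈ Z, (if P a z then (1 : ℝ) else 0) →
      ∃ T ⊆ Z, #T = s ∧ ε' * #A ≤ #{a ∈ A | ∀ z ∈ T, P a z} := by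
  obtain ⟨M, hM⟩ := exists_nat_gt (2 * s / ε)
  have hM' : 2 * s < ε * M := by rwa [div_lt_iff₀' hε] at hM
  have hM0 : (0 : ℝ) < M := lt_of_le_of_lt (by positivity) hM
  refine ⟨M, ε / 2 / 2 ^ M, by positivity, fun P A Z hZ h => ?_⟩
  rw [sum_comm] at h
  obtain ⟨Z₀, hZ₀, hc, hd⟩ := exists_subset_dense (fun z => ∑ a ∈ A, (if P a z then (1 : ℝ) else 0))
    (ε * #A) Z M hZ (by linarith)
  rw [sum_comm] at hd
  set A' := {a ∈ A | s ≤ #{z ∈ Z₀ | P a z}} with hA'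
  have hA'c : ε / 2 * #A ≤ #A' := by
    have h1 : ∑ a ∈ A, ∑ z ∈ Z₀, (if P a z then (1 : ℝ) else 0)
        ≤ ∑ a ∈ A, ((if s ≤ #{z ∈ Z₀ | P a z} then (M : ℝ) else 0) + s) := by
      refine sum_le_sum fun a _ => ?_
      rw [sum_boole]
      split_ifs with hs
      · have : (#{z ∈ Z₀ | P a z} : ℝ) ≤ M := by
          rw [← hc]; exact_mod_cast card_filter_le _ _
        have : (0 : ℝ) ≤ s := by positivity
        linarith
      · have : (#{z ∈ Z₀ | P a z} : ℝ) ≤ s := by exact_mod_cast (not_le.mp hs).le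
        linarith
    rw [sum_add_distrib, ← sum_filter, sum_const, sum_const, nsmul_eq_mul, nsmul_eq_mul] at h1
    have h2 : ε * #A * M ≤ #A' * M + #A * s := hd.trans h1
    have h3 : (#A : ℝ) * (2 * s) ≤ #A * (ε * M) := by gcongr
    refine le_of_mul_le_mul_right ?_ hM0
    nlinarith
  have hchoose : ∀ a ∈ A', ∃ T ∈ powersetCard s Z₀, ∀ z ∈ T, P a z := by
    intro a ha
    obtain ⟨T, hT, hTc⟩ := exists_subset_card_eq (mem_filter.mp ha).2
    exact ⟨T, mem_powersetCard.mpr ⟨hT.trans (filter_subset _ _), hTc⟩,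
      fun z hz => (mem_filter.mp (hT hz)).2⟩
  choose! g hg hgP using hchoose
  have hsM : s ≤ M := by
    have : (s : ℝ) ≤ M := by nlinarith [(Nat.cast_nonneg s : (0 : ℝ) ≤ s)]
    exact_mod_cast this
  have hcard : (#(powersetCard s Z₀) : ℝ) ≤ 2 ^ M := by
    rw [card_powersetCard, hc]
    exact_mod_cast Nat.choose_le_two_pow M s
  obtain ⟨T, hT, hTA⟩ := exists_le_card_fiber_of_nsmul_le_card_of_maps_to
    (b := ε / 2 / 2 ^ M * (#A : ℝ)) hg (powersetCard_nonempty.mpr (hc ▸ hsM)) (by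
      rw [nsmul_eq_mul]
      calc (#(powersetCard s Z₀) : ℝ) * (ε / 2 / 2 ^ M * #A)
          ≤ 2 ^ M * (ε / 2 / 2 ^ M * #A) := by gcongr
        _ = ε / 2 * #A := by field_simp
        _ ≤ #A' := hA'c)
  obtain ⟨hTZ, hTc⟩ := mem_powersetCard.mp hT
  refine ⟨T, hTZ.trans hZ₀, hTc, hTA.trans ?_⟩
  refine Nat.cast_le.mpr (card_le_card fun a ha => ?_)
  obtain ⟨haA, rfl⟩ := mem_filter.mp ha
  exact mem_filter.mpr ⟨(mem_filter.mp haA).1, hgP a haA⟩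

open Classical in
/-- A dense bipartite relation contains a complete `s × s` relation. -/
theorem exists_complete_bipartite {ε : ℝ} (hε : 0 < ε) (hε₁ : ε ≤ 1) (s : ℕ) :
    ∃ M : ℕ, ∀ {ι κ : Type} (P : ι → κ → Prop) (X : Finset ι) (Y : Finset κ), M ≤ #X → M ≤ #Y →
      ε * (#X * #Y) ≤ ∑ x ∈ X, ∑ y ∈ Y, (if P x y then (1 : ℝ) else 0) →
      ∃ X' ⊆ X, ∃ Y' ⊆ Y, #X' = s ∧ #Y' = s ∧ ∀ x ∈ X', ∀ y ∈ Y', P x y := by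
  obtain ⟨M₁, ε', hε', h⟩ := exists_common_related hε hε₁ s
  obtain ⟨M₂, hM₂⟩ := exists_nat_gt (s / ε')
  refine ⟨max M₁ M₂, fun P X Y hX hY hd => ?_⟩
  obtain ⟨Y', hY', hYc, hXY⟩ := h P X Y ((le_max_left _ _).trans hY) hd
  have hs : s ≤ #{x ∈ X | ∀ y ∈ Y', P x y} := by
    have h1 : (M₂ : ℝ) ≤ #X := by exact_mod_cast (le_max_right _ _).trans hX
    have h2 : (s : ℝ) < ε' * M₂ := by rwa [div_lt_iff₀' hε'] at hM₂
    have h3 : (s : ℝ) ≤ #{x ∈ X | ∀ y ∈ Y', P x y} :=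
      h2.le.trans ((mul_le_mul_of_nonneg_left h1 hε'.le).trans hXY)
    exact_mod_cast h3
  obtain ⟨X', hX', hXc⟩ := exists_subset_card_eq hs
  exact ⟨X', hX'.trans (filter_subset _ _), Y', hY', hXc, hYc,
    fun x hx => (mem_filter.mp (hX' hx)).2⟩

open Classical in
/-- A dense tripartite relation contains a complete `s × s × s` relation. -/
theorem exists_complete_tripartite {ε : ℝ} (hε : 0 < ε) (hε₁ : ε ≤ 1) (s : ℕ) :
    ∃ M : ℕ, ∀ {V : Type} (P : V → V → V → Prop) (X Y Z : Finset V),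
      M ≤ #X → M ≤ #Y → M ≤ #Z →
      ε * (#X * #Y * #Z) ≤ ∑ x ∈ X, ∑ y ∈ Y, ∑ z ∈ Z, (if P x y z then (1 : ℝ) else 0) →
      ∃ X' ⊆ X, ∃ Y' ⊆ Y, ∃ Z' ⊆ Z, #X' = s ∧ #Y' = s ∧ #Z' = s ∧
        ∀ x ∈ X', ∀ y ∈ Y', ∀ z ∈ Z', P x y z := by
  obtain ⟨M₁, ε', hε', h⟩ := exists_common_related hε hε₁ s
  obtain ⟨M₂, h₂⟩ := exists_complete_bipartite (lt_min hε' one_pos) (min_le_right ε' 1) s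
  refine ⟨max M₁ M₂, fun P X Y Z hX hY hZ hd => ?_⟩
  obtain ⟨Z', hZ', hZc, hXY⟩ := h (fun (a : _ × _) z => P a.1 a.2 z) (X ×ˢ Y) Z
    ((le_max_left _ _).trans hZ) (by
      rw [sum_product, card_product]
      push_cast
      exact hd)
  obtain ⟨X', hX', Y', hY', hXc, hYc, hP⟩ := h₂ (fun x y => ∀ z ∈ Z', P x y z) X Y
    ((le_max_right _ _).trans hX) ((le_max_right _ _).trans hY) (by
      rw [← sum_product']
      rw [natCast_card_filter, card_product] at hXY
      refine le_trans ?_ (hXY.trans (le_of_eq (sum_congr rfl fun _ _ => by congr)))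
      push_cast
      gcongr
      exact min_le_left _ _)
  exact ⟨X', hX', Y', hY', Z', hZ', hXc, hYc, hZc, hP⟩

/-- The average over `X` of the functions `f x`. -/
noncomputable def averageOver {V : Type} (f : V → V → ℝ) (X : Finset V) (w : V) : ℝ :=
  (∑ x ∈ X, f x w) / #X

theorem averageOver_nonneg {V : Type} {f : V → V → ℝ} (hf : ∀ x w, 0 ≤ f x w) (X : Finset V)
    (w : V) : 0 ≤ averageOver f X w :=
  div_nonneg (sum_nonneg fun x _ => hf x w) (Nat.cast_nonneg _)

theorem averageOver_one_sub {V : Type} (f : V → V → ℝ) {X : Finset V} (hX : X.Nonempty) (w : V) :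
    averageOver (fun x w => 1 - f x w) X w = 1 - averageOver f X w := by
  have h0 : (#X : ℝ) ≠ 0 := by exact_mod_cast hX.card_pos.ne'
  simp only [averageOver, sum_sub_distrib, sum_const, nsmul_eq_mul, mul_one]
  field_simp

theorem sum_averageOver {V : Type} (f : V → V → ℝ) (X S : Finset V) :
    ∑ w ∈ S, averageOver f X w = (∑ x ∈ X, ∑ w ∈ S, f x w) / #X := by
  simp only [averageOver]
  rw [← sum_div, sum_comm]

theorem sum_averageOver_mul {V : Type} (f : V → V → ℝ) (X Y S : Finset V) :
    ∑ w ∈ S, averageOver f X w * averageOver f Y w =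
      (∑ x ∈ X, ∑ y ∈ Y, ∑ w ∈ S, f x w * f y w) / (#X * #Y) := by
  simp only [averageOver, div_mul_div_comm]
  rw [← sum_div]
  congr 1
  simp only [sum_mul_sum]
  rw [sum_comm]
  exact sum_congr rfl fun x _ => sum_comm

theorem sum_averageOver_mul_le {V : Type} {f : V → V → ℝ} {X Y S : Finset V} (hX : X.Nonempty)
    (hY : Y.Nonempty) {c : ℝ} (h : ∀ x ∈ X, ∀ y ∈ Y, ∑ w ∈ S, f x w * f y w ≤ c) :
    ∑ w ∈ S, averageOver f X w * averageOver f Y w ≤ c := by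
  have hX0 : (0 : ℝ) < #X := by exact_mod_cast hX.card_pos
  have hY0 : (0 : ℝ) < #Y := by exact_mod_cast hY.card_pos
  rw [sum_averageOver_mul, div_le_iff₀ (by positivity)]
  calc ∑ x ∈ X, ∑ y ∈ Y, ∑ w ∈ S, f x w * f y w ≤ ∑ x ∈ X, ∑ y ∈ Y, c :=
        sum_le_sum fun x hx => sum_le_sum fun y hy => h x hx y hy
    _ = c * (#X * #Y) := by simp; ring

theorem sum_averageOver_sq_le {V : Type} [Fintype V] {f : V → V → ℝ} (h0 : ∀ x w, 0 ≤ f x w)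
    (h1 : ∀ x w, f x w ≤ 1) {X : Finset V} (hX : X.Nonempty) {c : ℝ} (hc : 0 ≤ c)
    (h : ∀ x ∈ X, ∀ y ∈ X, x ≠ y → ∑ w, f x w * f y w ≤ c) :
    ∑ w, averageOver f X w ^ 2 ≤ c + Fintype.card V / #X := by
  classical
  have hX0 : (0 : ℝ) < #X := by exact_mod_cast hX.card_pos
  simp only [sq]
  rw [sum_averageOver_mul, div_le_iff₀ (by positivity)]
  calc ∑ x ∈ X, ∑ y ∈ X, ∑ w, f x w * f y w
      ≤ ∑ x ∈ X, ∑ y ∈ X, (c + if x = y then (Fintype.card V : ℝ) else 0) := by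
        refine sum_le_sum fun x hx => sum_le_sum fun y hy => ?_
        split_ifs with hxy
        · have : ∑ w, f x w * f y w ≤ ∑ _w : V, (1 : ℝ) :=
            sum_le_sum fun w _ => mul_le_one₀ (h1 x w) (h0 y w) (h1 y w)
          simp at this
          linarith
        · rw [add_zero]
          exact h x hx y hy hxy
    _ = (c + Fintype.card V / #X) * (#X * #X) := by
        simp [sum_add_distrib]
        field_simp

open Classical in
/-- The indicator of adjacency in `R`. -/
noncomputable def redIndicator {V : Type} (R : SimpleGraph V) (x w : V) : ℝ :=
  if R.Adj x w then 1 else 0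

theorem redIndicator_nonneg {V : Type} (R : SimpleGraph V) (x w : V) : 0 ≤ redIndicator R x w := by
  unfold redIndicator; split_ifs <;> norm_num

theorem redIndicator_le_one {V : Type} (R : SimpleGraph V) (x w : V) :
    redIndicator R x w ≤ 1 := by
  unfold redIndicator; split_ifs <;> norm_num

theorem redIndicator_comm {V : Type} (R : SimpleGraph V) (x w : V) :
    redIndicator R x w = redIndicator R w x := by
  by_cases h : R.Adj x w
  · rw [redIndicator, redIndicator, if_pos h, if_pos h.symm]
  · rw [redIndicator, redIndicator, if_neg h, if_neg fun h' => h h'.symm]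

/-- Red edges have codegree at most `c`, and blue edges at most `d` common non-neighbours. -/
structure BookBounded {V : Type} [Fintype V] (R : SimpleGraph V) (c d : ℝ) : Prop where
  nonneg_red : 0 ≤ c
  nonneg_blue : 0 ≤ d
  red : ∀ x y, R.Adj x y → ∑ w, redIndicator R x w * redIndicator R y w ≤ c
  blue : ∀ x y, Rᶜ.Adj x y → ∑ w, (1 - redIndicator R x w) * (1 - redIndicator R y w) ≤ d

namespace BookBounded

variable {V : Type} [Fintype V] {R : SimpleGraph V} {c d : ℝ}

theorem sum_density_mul_le (h : BookBounded R c d) {X Y : Finset V} (hX : X.Nonempty)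
    (hY : Y.Nonempty) (hXY : ∀ x ∈ X, ∀ y ∈ Y, R.Adj x y) :
    ∑ w, averageOver (redIndicator R) X w * averageOver (redIndicator R) Y w ≤ c :=
  sum_averageOver_mul_le hX hY fun x hx y hy => h.red x y (hXY x hx y hy)

theorem sum_density_sq_le (h : BookBounded R c d) {X : Finset V} (hX : X.Nonempty)
    (hR : R.IsClique X) :
    ∑ w, averageOver (redIndicator R) X w ^ 2 ≤ c + Fintype.card V / #X :=
  sum_averageOver_sq_le (redIndicator_nonneg R) (redIndicator_le_one R) hX h.nonneg_red
    fun x hx y hy hxy => h.red x y (hR hx hy hxy)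

theorem sum_one_sub_density_mul_le (h : BookBounded R c d) {X Y : Finset V} (hX : X.Nonempty)
    (hY : Y.Nonempty) (hXY : ∀ x ∈ X, ∀ y ∈ Y, Rᶜ.Adj x y) :
    ∑ w, (1 - averageOver (redIndicator R) X w) * (1 - averageOver (redIndicator R) Y w) ≤ d := by
  simp only [← averageOver_one_sub _ hX, ← averageOver_one_sub _ hY]
  exact sum_averageOver_mul_le hX hY fun x hx y hy => h.blue x y (hXY x hx y hy)

theorem sum_one_sub_density_sq_le (h : BookBounded R c d) {X : Finset V} (hX : X.Nonempty)
    (hB : Rᶜ.IsClique X) :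
    ∑ w, (1 - averageOver (redIndicator R) X w) ^ 2 ≤ d + Fintype.card V / #X := by
  simp only [← averageOver_one_sub _ hX]
  exact sum_averageOver_sq_le (fun x w => sub_nonneg.mpr (redIndicator_le_one R x w))
    (fun x w => sub_le_self _ (redIndicator_nonneg R x w)) hX h.nonneg_blue
    fun x hx y hy hxy => h.blue x y (hB hx hy hxy)

/-- Three blue cliques joined completely in red force a small vertex set. -/
theorem card_le_of_red_tripartite (h : BookBounded R c d) {s : ℕ} (hs : 0 < s) {X Y Z : Finset V}
    (hX : #X = s) (hY : #Y = s) (hZ : #Z = s) (hXB : Rᶜ.IsClique X) (hYB : Rᶜ.IsClique Y)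
    (hZB : Rᶜ.IsClique Z) (hXY : ∀ x ∈ X, ∀ y ∈ Y, R.Adj x y)
    (hXZ : ∀ x ∈ X, ∀ z ∈ Z, R.Adj x z) (hYZ : ∀ y ∈ Y, ∀ z ∈ Z, R.Adj y z) :
    2 * (Fintype.card V : ℝ) ≤ 6 * c + 3 * (d + Fintype.card V / s) := by
  have hX' : X.Nonempty := card_pos.mp (by omega)
  have hY' : Y.Nonempty := card_pos.mp (by omega)
  have hZ' : Z.Nonempty := card_pos.mp (by omega)
  have h1 := h.sum_density_mul_le hX' hY' hXY
  have h2 := h.sum_density_mul_le hX' hZ' hXZ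
  have h3 := h.sum_density_mul_le hY' hZ' hYZ
  have h4 := h.sum_one_sub_density_sq_le hX' hXB
  have h5 := h.sum_one_sub_density_sq_le hY' hYB
  have h6 := h.sum_one_sub_density_sq_le hZ' hZB
  rw [hX] at h4; rw [hY] at h5; rw [hZ] at h6
  set a := averageOver (redIndicator R) X
  set b := averageOver (redIndicator R) Y
  set e := averageOver (redIndicator R) Z
  have key : ∑ _w : V, (2 : ℝ) ≤ ∑ w, ((1 - a w) ^ 2 + (1 - b w) ^ 2 + (1 - e w) ^ 2
      + 2 * (a w * b w) + 2 * (a w * e w) + 2 * (b w * e w)) :=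
    sum_le_sum fun w _ => by nlinarith [sq_nonneg (a w + b w + e w - 1)]
  simp only [sum_add_distrib, ← mul_sum] at key
  simp at key
  linarith

/-- Two red cliques joined completely in blue force a small vertex set. -/
theorem card_le_of_blue_bipartite (h : BookBounded R c d) {s : ℕ} (hs : 0 < s) {X Y : Finset V}
    (hX : #X = s) (hY : #Y = s) (hXR : R.IsClique X) (hYR : R.IsClique Y)
    (hXY : ∀ x ∈ X, ∀ y ∈ Y, Rᶜ.Adj x y) :
    2 * (Fintype.card V : ℝ) ≤ 3 * d + 6 * (c + Fintype.card V / s) := by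
  have hX' : X.Nonempty := card_pos.mp (by omega)
  have hY' : Y.Nonempty := card_pos.mp (by omega)
  have h1 := h.sum_one_sub_density_mul_le hX' hY' hXY
  have h4 := h.sum_density_sq_le hX' hXR
  have h5 := h.sum_density_sq_le hY' hYR
  rw [hX] at h4; rw [hY] at h5
  set a := averageOver (redIndicator R) X
  set b := averageOver (redIndicator R) Y
  have key : ∑ _w : V, (2 / 3 : ℝ) ≤ ∑ w, (a w ^ 2 + b w ^ 2 + (1 - a w) * (1 - b w)) :=
    sum_le_sum fun w _ => by
      nlinarith [sq_nonneg (a w + b w - 2 / 3), sq_nonneg (a w - b w)]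
  simp only [sum_add_distrib] at key
  simp at key
  linarith

end BookBounded

/-- Bounds for the red degrees into a set `U` whose induced graph misses few red edges. -/
theorem BookBounded.degree_bounds {V : Type} [Fintype V] {R : SimpleGraph V} {c d : ℝ}
    (h : BookBounded R c d) {U W : Finset V} (hUW : Disjoint U W) {q : ℝ}
    (hq : ∑ x ∈ U, ∑ y ∈ U, (1 - redIndicator R x y) ≤ q) :
    (#U : ℝ) ^ 3 - 2 * #U * q ≤ (#U : ℝ) ^ 2 * c + q * Fintype.card V ∧
    #U * ∑ x ∈ W, ∑ w ∈ U, redIndicator R x w ≤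
      (#U : ℝ) ^ 2 * #W / 8 + 2 * ((#U : ℝ) ^ 2 * c + q * Fintype.card V)
        - 2 * ((#U : ℝ) ^ 3 - 2 * #U * q) := by
  classical
  set u : ℝ := (#U : ℝ) with hu
  set D : V → ℝ := fun x => ∑ w ∈ U, redIndicator R x w with hD
  have hsq : ∑ v, D v ^ 2 ≤ u ^ 2 * c + q * Fintype.card V := by
    have h1 : ∑ v, D v ^ 2
        = ∑ x ∈ U, ∑ y ∈ U, ∑ v, redIndicator R x v * redIndicator R y v := by
      simp only [hD, sq, sum_mul_sum]
      rw [sum_comm]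
      refine sum_congr rfl fun x _ => ?_
      rw [sum_comm]
      refine sum_congr rfl fun y _ => sum_congr rfl fun v _ => ?_
      rw [redIndicator_comm R v x, redIndicator_comm R v y]
    have h2 : ∑ x ∈ U, ∑ y ∈ U, ∑ v, redIndicator R x v * redIndicator R y v
        ≤ ∑ x ∈ U, ∑ y ∈ U, (c + (1 - redIndicator R x y) * Fintype.card V) := by
      refine sum_le_sum fun x _ => sum_le_sum fun y _ => ?_
      by_cases hxy : R.Adj x y
      · have : redIndicator R x y = 1 := if_pos hxy
        rw [this]
        linarith [h.red x y hxy]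
      · have hz : redIndicator R x y = 0 := if_neg hxy
        have : ∑ v, redIndicator R x v * redIndicator R y v ≤ ∑ _v : V, (1 : ℝ) :=
          sum_le_sum fun v _ => mul_le_one₀ (redIndicator_le_one R x v)
            (redIndicator_nonneg R y v) (redIndicator_le_one R y v)
        simp at this
        rw [hz]
        linarith [h.nonneg_red]
    have h3 : ∑ x ∈ U, ∑ y ∈ U, (c + (1 - redIndicator R x y) * Fintype.card V)
        = u ^ 2 * c + (∑ x ∈ U, ∑ y ∈ U, (1 - redIndicator R x y)) * Fintype.card V := by
      simp only [sum_add_distrib, ← sum_mul]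
      simp [u]
      ring
    rw [h1]
    refine h2.trans (h3.trans_le ?_)
    gcongr
  have hlow : u ^ 3 - 2 * u * q ≤ ∑ x ∈ U, D x ^ 2 := by
    have h1 : ∑ x ∈ U, (2 * u * D x - u ^ 2) ≤ ∑ x ∈ U, D x ^ 2 :=
      sum_le_sum fun x _ => by nlinarith [sq_nonneg (D x - u)]
    have h2 : u ^ 2 - q ≤ ∑ x ∈ U, D x := by
      simp only [sum_sub_distrib, sum_const, nsmul_eq_mul] at hq
      simp only [hD]
      have : u * (u * 1) = u ^ 2 := by ring
      linarith
    rw [sum_sub_distrib, ← mul_sum, sum_const, nsmul_eq_mul] at h1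
    have : 2 * u * (u ^ 2 - q) ≤ 2 * u * ∑ x ∈ U, D x := by gcongr
    rw [← hu] at h1
    nlinarith
  have hsplit : ∑ x ∈ U, D x ^ 2 + ∑ x ∈ W, D x ^ 2 ≤ ∑ v, D v ^ 2 := by
    rw [← sum_union hUW]
    exact sum_le_sum_of_subset_of_nonneg (subset_univ _) fun _ _ _ => sq_nonneg _
  have hWsq : 0 ≤ ∑ x ∈ W, D x ^ 2 := sum_nonneg fun _ _ => sq_nonneg _
  refine ⟨by linarith, ?_⟩
  have hW : u * ∑ x ∈ W, D x ≤ ∑ x ∈ W, (u ^ 2 / 8 + 2 * D x ^ 2) := by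
    rw [mul_sum]
    exact sum_le_sum fun x _ => by nlinarith [sq_nonneg (u / 4 - D x)]
  rw [sum_add_distrib, ← mul_sum, sum_const, nsmul_eq_mul] at hW
  have : (#W : ℝ) * (u ^ 2 / 8) = u ^ 2 * #W / 8 := by ring
  linarith

/-- A large set without blue `t`-cliques is almost a red clique. -/
theorem exists_sum_blue_le {ε : ℝ} (hε : 0 < ε) (hε₁ : ε ≤ 1) {s : ℕ} (hs : 0 < s) (t : ℕ) :
    ∃ M : ℕ, ∀ {V : Type} [Fintype V] {R : SimpleGraph V} {c d : ℝ} (U : Finset V),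
      BookBounded R c d → 3 * d + 6 * (c + Fintype.card V / s) < 2 * (Fintype.card V : ℝ) →
      (∀ T ⊆ U, #T = t → ¬ Rᶜ.IsClique T) → M ≤ #U →
      ∑ x ∈ U, ∑ y ∈ U, (1 - redIndicator R x y) ≤ 2 * ε * (#U : ℝ) ^ 2 := by
  classical
  obtain ⟨Q, hQ⟩ := exists_ramsey_bound s t
  obtain ⟨M₁, h₁⟩ := exists_complete_bipartite hε hε₁ Q
  obtain ⟨M₂, h₂⟩ := exists_nat_gt (1 / ε)
  refine ⟨max M₁ M₂, fun {V} _ R c d U h hN hU hM => ?_⟩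
  have hu : 1 ≤ ε * #U := by
    rw [div_lt_iff₀' hε] at h₂
    have : (M₂ : ℝ) ≤ #U := by exact_mod_cast (le_max_right _ _).trans hM
    nlinarith
  have hlt : ∑ x ∈ U, ∑ y ∈ U, (if Rᶜ.Adj x y then (1 : ℝ) else 0) ≤ ε * (#U * #U) := by
    by_contra! hcon
    obtain ⟨X, hX, Y, hY, hXc, hYc, hXY⟩ := h₁ (fun x y => Rᶜ.Adj x y) U U
      ((le_max_left _ _).trans hM) ((le_max_left _ _).trans hM)
      (hcon.le.trans (le_of_eq (sum_congr rfl fun _ _ => sum_congr rfl fun _ _ => by congr)))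
    have red : ∀ S ⊆ U, #S = Q → ∃ T ⊆ S, #T = s ∧ R.IsClique T := fun S hS hSc =>
      (hQ R S hSc.ge).resolve_right fun ⟨T, hT, hTc, hTq⟩ => hU T (hT.trans hS) hTc hTq
    obtain ⟨X', hX', hXc', hXq⟩ := red X hX hXc
    obtain ⟨Y', hY', hYc', hYq⟩ := red Y hY hYc
    have := h.card_le_of_blue_bipartite hs hXc' hYc' hXq hYq
      fun x hx y hy => hXY x (hX' hx) y (hY' hy)
    linarith
  have hle : ∑ x ∈ U, ∑ y ∈ U, (1 - redIndicator R x y)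
      ≤ ∑ x ∈ U, ∑ y ∈ U, ((if Rᶜ.Adj x y then (1 : ℝ) else 0) + if x = y then 1 else 0) := by
    refine sum_le_sum fun x _ => sum_le_sum fun y _ => ?_
    rw [redIndicator]
    by_cases hxy : x = y <;> by_cases ha : R.Adj x y <;> simp [hxy, ha]
  simp only [sum_add_distrib, sum_ite_eq, sum_ite_mem, inter_self, sum_const, nsmul_eq_mul,
    mul_one] at hle
  have : (#U : ℝ) ≤ ε * #U * #U := by nlinarith [(Nat.cast_nonneg #U : (0 : ℝ) ≤ #U)]
  nlinarith

/-- Between two of the blue cliques of a family with many red edges in between, there are complete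
red pairs with few common neighbours inside the family. -/
theorem exists_red_pair {ε : ℝ} (hε : 0 < ε) (hε₁ : ε ≤ 1) {s : ℕ} (hs : 0 < s) (r : ℕ) :
    ∃ M : ℕ, ∀ {V : Type} [Fintype V] {R : SimpleGraph V} {c d : ℝ} (t : ℕ)
      (F : Finset (Finset V)), BookBounded R c d →
      6 * c + 3 * (d + Fintype.card V / s) < 2 * (Fintype.card V : ℝ) → M ≤ t →
      (∀ X ∈ F, #X = t ∧ Rᶜ.IsClique X) → ∀ X ∈ F, ∀ Y ∈ F,
      ε * (t : ℝ) ^ 2 ≤ ∑ x ∈ X, ∑ y ∈ Y, redIndicator R x y →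
      ∃ X' ⊆ X, ∃ Y' ⊆ Y, #X' = #Y' ∧ 0 < #X' ∧ r ≤ #X' ∧ ∀ Z ∈ F,
        ∑ w ∈ Z, averageOver (redIndicator R) X' w * averageOver (redIndicator R) Y' w
          ≤ ε * t := by
  classical
  obtain ⟨M₃, h₃⟩ := exists_complete_tripartite hε hε₁ s
  set k := max (max r M₃) 1 with hk
  obtain ⟨M₂, h₂⟩ := exists_complete_bipartite hε hε₁ k
  refine ⟨max M₂ M₃, fun {V} _ R c d t F h hN hM hF X hX Y hY hXY => ?_⟩
  obtain ⟨X', hX', Y', hY', hXc, hYc, hred⟩ := h₂ R.Adj X Y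
    ((le_max_left _ _).trans (hM.trans (hF X hX).1.ge))
    ((le_max_left _ _).trans (hM.trans (hF Y hY).1.ge)) (by
      rw [(hF X hX).1, (hF Y hY).1, ← sq]
      exact hXY)
  have hk0 : 0 < k := lt_of_lt_of_le one_pos (le_max_right _ _)
  have hk3 : M₃ ≤ k := (le_max_right _ _).trans (le_max_left _ _)
  refine ⟨X', hX', Y', hY', hXc.trans hYc.symm, hXc ▸ hk0,
    hXc ▸ (le_max_left _ _).trans (le_max_left _ _), fun Z hZ => ?_⟩
  by_contra! hcon
  rw [sum_averageOver_mul, hXc, hYc] at hcon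
  have hk0' : (0 : ℝ) < k := by exact_mod_cast hk0
  rw [lt_div_iff₀ (by positivity)] at hcon
  obtain ⟨X₁, hX₁, Y₁, hY₁, Z₁, hZ₁, hX₁c, hY₁c, hZ₁c, hP⟩ :=
    h₃ (fun x y z => R.Adj x z ∧ R.Adj y z) X' Y' Z (hXc ▸ hk3) (hYc ▸ hk3)
    ((le_max_right _ _).trans (hM.trans (hF Z hZ).1.ge)) (by
      rw [hXc, hYc, (hF Z hZ).1]
      have : ε * ((k : ℝ) * k * t) = ε * t * (k * k) := by ring
      rw [this]
      refine hcon.le.trans (le_of_eq ?_)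
      refine sum_congr rfl fun x _ => sum_congr rfl fun y _ => sum_congr rfl fun z _ => ?_
      simp only [redIndicator]
      by_cases h1 : R.Adj x z <;> by_cases h2 : R.Adj y z <;> simp [h1, h2])
  have hpos : 0 < s := hs
  obtain ⟨y₀, hy₀⟩ : Y₁.Nonempty := card_pos.mp (by omega)
  obtain ⟨x₀, hx₀⟩ : X₁.Nonempty := card_pos.mp (by omega)
  have := h.card_le_of_red_tripartite hs hX₁c hY₁c hZ₁c
    ((hF X hX).2.subset (by exact_mod_cast hX₁.trans hX'))
    ((hF Y hY).2.subset (by exact_mod_cast hY₁.trans hY'))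
    ((hF Z hZ).2.subset (by exact_mod_cast hZ₁))
    (fun x hx y hy => hred x (hX₁ hx) y (hY₁ hy))
    (fun x hx z hz => (hP x hx y₀ hy₀ z hz).1) (fun y hy z hz => (hP x₀ hx₀ y hy z hz).2)
  linarith

/-- A weighted star argument: if adjacent weights have sum at least `E`, and lighter elements have
more neighbours, then the total weight is almost that of a constant weight `E / 2`. -/
theorem star_weight_bound {ι : Type} {F : Finset ι} (hF : F.Nonempty) {D : ι → ℝ} {H : ι → ι → Prop}
    [∀ X, DecidablePred (H X)] {t E L κ : ℝ} (ht : 0 ≤ t) (hE : 0 ≤ E) (hD : ∀ X ∈ F, 0 ≤ D X)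
    (hκ : 0 ≤ κ) (hκ' : L + 3 / 4 * E - t * #F / 2 ≤ κ)
    (hH : ∀ X ∈ F, ∀ Y ∈ F, H X Y → E ≤ D X + D Y)
    (hL : ∀ X ∈ F, t * #{Y ∈ F | ¬ H X Y} ≤ L + 3 / 2 * D X) :
    t * #F * E / 2 - E * κ ≤ t * ∑ X ∈ F, D X := by
  obtain ⟨X, hX, hmin⟩ := exists_min_image F D hF
  have hEκ : 0 ≤ E * κ := mul_nonneg hE hκ
  rcases le_or_gt (E / 2) (D X) with h | h
  · have h1 : #F • (E / 2) ≤ ∑ X ∈ F, D X :=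
      card_nsmul_le_sum _ _ _ fun Y hY => h.trans (hmin Y hY)
    rw [nsmul_eq_mul] at h1
    have := mul_le_mul_of_nonneg_left h1 ht
    nlinarith
  · have hsum : ∑ Y ∈ F, (if H X Y then E - D X else D X) ≤ ∑ Y ∈ F, D Y := by
      refine sum_le_sum fun Y hY => ?_
      split_ifs with hXY
      · linarith [hH X hX Y hY hXY]
      · exact hmin Y hY
    rw [sum_ite, sum_const, sum_const, nsmul_eq_mul, nsmul_eq_mul] at hsum
    have hcard : (#{Y ∈ F | H X Y} : ℝ) + #{Y ∈ F | ¬ H X Y} = #F := by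
      exact_mod_cast card_filter_add_card_filter_not _
    have hLX := hL X hX
    have hDX := hD X hX
    have h1 := mul_le_mul_of_nonneg_left hsum ht
    have h2 : t * #F / 2 - κ ≤ t * #{Y ∈ F | H X Y} := by
      have : t * (#{Y ∈ F | H X Y} : ℝ) = t * #F - t * #{Y ∈ F | ¬ H X Y} := by
        rw [← hcard]; ring
      linarith
    have h3 := mul_le_mul_of_nonneg_right h2 (show 0 ≤ E - 2 * D X by linarith)
    have h4 : 0 ≤ D X * κ := mul_nonneg hDX hκ
    have h5 : (#{Y ∈ F | ¬ H X Y} : ℝ) = #F - #{Y ∈ F | H X Y} := by linarith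
    rw [h5] at h1
    nlinarith

/-- A disjoint family of large cliques can be refined to one of small cliques on each of which a
given function is almost constant, covering almost the same set. -/
theorem exists_leveled_family {V : Type} [DecidableEq V] (G : SimpleGraph V) {g : V → ℝ} {τ : ℝ}
    (hτ : 0 < τ) {K t J : ℕ} (ht : 0 < t) (hg : ∀ x, 0 ≤ g x ∧ g x < K * τ)
    {F : Finset (Finset V)} (hF : ∀ X ∈ F, #X = J * (K * t) ∧ G.IsClique X)
    (hd : (F : Set (Finset V)).PairwiseDisjoint id) :
    ∃ F' : Finset (Finset V), (∀ T ∈ F', T ⊆ F.biUnion id ∧ #T = t ∧ G.IsClique T ∧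
        ∀ x ∈ T, ∀ y ∈ T, g x ≤ g y + τ) ∧
      (F' : Set (Finset V)).PairwiseDisjoint id ∧
      J * #(F.biUnion id \ F'.biUnion id) ≤ #(F.biUnion id) := by
  classical
  obtain ⟨F', hF', hd', hmax⟩ := exists_maximal_disjoint_family
    (fun T : Finset V => G.IsClique T ∧ ∀ x ∈ T, ∀ y ∈ T, g x ≤ g y + τ) ht (F.biUnion id)
  refine ⟨F', fun T hT => ?_, ?_, ?_⟩
  · exact hF' T hT
  · exact hd'
  · have hsmall : ∀ X ∈ F, #(X ∩ (F.biUnion id \ F'.biUnion id)) ≤ K * t := by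
      intro X hX
      by_contra! hcon
      set S := X ∩ (F.biUnion id \ F'.biUnion id) with hS
      obtain ⟨x₀, hx₀⟩ : S.Nonempty := card_pos.mp (by omega)
      have hmaps : ∀ x ∈ S, ⌊g x / τ⌋₊ ∈ range K := by
        intro x _
        rw [mem_range, Nat.floor_lt (div_nonneg (hg x).1 hτ.le), div_lt_iff₀ hτ]
        exact (hg x).2
      obtain ⟨k, -, hk⟩ := exists_le_card_fiber_of_mul_le_card_of_maps_to hmaps ⟨_, hmaps x₀ hx₀⟩
        (n := t) (by rw [card_range]; exact hcon.le)
      obtain ⟨T, hT, hTc⟩ := exists_subset_card_eq hk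
      have hTS : T ⊆ S := hT.trans (filter_subset _ _)
      refine hmax T (by convert hTS.trans inter_subset_right) hTc
        ⟨(hF X hX).2.subset (by exact_mod_cast hTS.trans inter_subset_left), fun x hx y hy => ?_⟩
      have hx' := (mem_filter.mp (hT hx)).2
      have hy' := (mem_filter.mp (hT hy)).2
      have h1 := Nat.lt_floor_add_one (g x / τ)
      have h2 := Nat.floor_le (div_nonneg (hg y).1 hτ.le)
      rw [hx', div_lt_iff₀ hτ] at h1
      rw [hy', le_div_iff₀ hτ] at h2
      linarith
    have h1 : #(F.biUnion id \ F'.biUnion id) ≤ #F * (K * t) := by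
      calc #(F.biUnion id \ F'.biUnion id)
          ≤ #(F.biUnion fun X => X ∩ (F.biUnion id \ F'.biUnion id)) := by
            refine card_le_card fun v hv => ?_
            obtain ⟨X, hX, hvX⟩ := mem_biUnion.mp (mem_sdiff.mp hv).1
            exact mem_biUnion.mpr ⟨X, hX, mem_inter.mpr ⟨hvX, hv⟩⟩
        _ ≤ #F * (K * t) := card_biUnion_le_card_mul _ _ _ hsmall
    have h2 : #(F.biUnion id) = #F * (J * (K * t)) := by
      rw [card_biUnion hd]
      exact sum_const_nat fun X hX => (hF X hX).1
    rw [h2]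
    calc J * #(F.biUnion id \ F'.biUnion id) ≤ J * (#F * (K * t)) := Nat.mul_le_mul_left _ h1
      _ = #F * (J * (K * t)) := by ring

/-- A nonnegative sum over everything dominates the sums over disjoint parts. -/
theorem sum_add_sum_blocks_le {V : Type} [Fintype V] [DecidableEq V] {g : V → ℝ}
    (hg : ∀ v, 0 ≤ g v) {U : Finset V} {F : Finset (Finset V)}
    (hd : (F : Set (Finset V)).PairwiseDisjoint id) (hU : Disjoint U (F.biUnion id)) :
    ∑ v ∈ U, g v + ∑ Z ∈ F, ∑ v ∈ Z, g v ≤ ∑ v, g v := by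
  have : ∑ Z ∈ F, ∑ v ∈ Z, g v = ∑ v ∈ F.biUnion id, g v := (sum_biUnion hd).symm
  rw [this, ← sum_union hU]
  exact sum_le_sum_of_subset_of_nonneg (subset_univ _) fun v _ _ => hg v

/-- The red degrees into `U` of the vertices covered by a family of blue cliques are large. -/
theorem BookBounded.degree_sum_lower_bound {V : Type} [Fintype V] [DecidableEq V]
    {R : SimpleGraph V} {c d : ℝ}
    (h : BookBounded R c d) {ε τ : ℝ} (hε : 0 ≤ ε) {t r : ℕ} (ht : 0 < t) (hr : 0 < r)
    {U : Finset V} {F : Finset (Finset V)} (hF : ∀ X ∈ F, #X = t ∧ Rᶜ.IsClique X ∧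
      ∀ x ∈ X, ∀ y ∈ X, ∑ w ∈ U, redIndicator R x w ≤ ∑ w ∈ U, redIndicator R y w + τ)
    (hd : (F : Set (Finset V)).PairwiseDisjoint id) (hU : Disjoint U (F.biUnion id))
    (hτ : 0 ≤ τ) (hFne : F.Nonempty)
    (hpair : ∀ X ∈ F, ∀ Y ∈ F, ε * (t : ℝ) ^ 2 ≤ ∑ x ∈ X, ∑ y ∈ Y, redIndicator R x y →
      ∃ X' ⊆ X, ∃ Y' ⊆ Y, #X' = #Y' ∧ 0 < #X' ∧ r ≤ #X' ∧ ∀ Z ∈ F,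
        ∑ w ∈ Z, averageOver (redIndicator R) X' w * averageOver (redIndicator R) Y' w ≤ ε * t)
    {E b : ℝ} (hb : b = t * #F)
    (hE : E = 2 / 3 * (15 / 8 * #U + (1 - 2 * ε) * b - 2 * (d + Fintype.card V / r)) - 2 * τ)
    (hE₀ : 0 ≤ E) :
    b * E / 2 - E * (Fintype.card V / t + ε * b) ≤
      ∑ x ∈ F.biUnion id, ∑ w ∈ U, redIndicator R x w := by
  classical
  set N : ℝ := (Fintype.card V : ℝ) with hN
  have hN0 : 0 ≤ N := Nat.cast_nonneg _
  have ht0 : (0 : ℝ) < t := by exact_mod_cast ht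
  have hr0 : (0 : ℝ) < r := by exact_mod_cast hr
  set ρ := averageOver (redIndicator R) with hρ
  have hρ0 : ∀ X w, 0 ≤ ρ X w := fun X w => averageOver_nonneg (redIndicator_nonneg R) X w
  have hUb : ∀ a : V → ℝ, 15 / 16 * (#U : ℝ) - 3 / 2 * ∑ w ∈ U, a w ≤ ∑ w ∈ U, (1 - a w) ^ 2 := by
    intro a
    have : ∑ w ∈ U, (15 / 16 - 3 / 2 * a w) ≤ ∑ w ∈ U, (1 - a w) ^ 2 :=
      sum_le_sum fun w _ => by nlinarith [sq_nonneg (a w - 1 / 4)]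
    rw [sum_sub_distrib, ← mul_sum, sum_const, nsmul_eq_mul] at this
    linarith
  have hne : ∀ X ∈ F, X.Nonempty := fun X hX => card_pos.mp ((hF X hX).1 ▸ ht)
  have hsub : ∀ X ∈ F, ∀ X' ⊆ X, 0 < #X' → ∑ w ∈ U, ρ X' w ≤ ∑ w ∈ U, ρ X w + τ := by
    intro X hX X' hX' hpos
    have hX'0 : (0 : ℝ) < #X' := by exact_mod_cast hpos
    rw [hρ, sum_averageOver, sum_averageOver, (hF X hX).1]
    have hbd : ∀ x ∈ X', ∑ w ∈ U, redIndicator R x w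
        ≤ (∑ x ∈ X, ∑ w ∈ U, redIndicator R x w) / t + τ := by
      intro x hx
      have h1 : ∑ _y ∈ X, ((∑ w ∈ U, redIndicator R x w) - τ)
          ≤ ∑ y ∈ X, ∑ w ∈ U, redIndicator R y w :=
        sum_le_sum fun y hy => by linarith [(hF X hX).2.2 x (hX' hx) y hy]
      rw [sum_const, (hF X hX).1, nsmul_eq_mul] at h1
      rw [← sub_le_iff_le_add, le_div_iff₀ ht0]
      linarith
    rw [div_le_iff₀ hX'0, mul_comm, ← nsmul_eq_mul]
    exact sum_le_card_nsmul _ _ _ hbd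
  have hstar := star_weight_bound hFne (D := fun X => ∑ w ∈ U, ρ X w)
    (H := fun X Y => ε * (t : ℝ) ^ 2 ≤ ∑ x ∈ X, ∑ y ∈ Y, redIndicator R x y)
    (t := t) (E := E) (L := d + N / t - 15 / 16 * #U + 2 * ε * b) (κ := N / t + ε * b)
    ht0.le hE₀ (fun X _ => sum_nonneg fun w _ => hρ0 X w) (by rw [hb]; positivity)
    (by
      have : 0 ≤ N / r := by positivity
      rw [← hb, hE]
      linarith)
    (by
      intro X hX Y hY hXY
      obtain ⟨X', hX', Y', hY', hc, hpos, hrX, hcod⟩ := hpair X hX Y hY hXY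
      have hX'ne : X'.Nonempty := card_pos.mp hpos
      have hY'ne : Y'.Nonempty := card_pos.mp (hc ▸ hpos)
      have h1 := h.sum_one_sub_density_sq_le hX'ne
        ((hF X hX).2.1.subset (by exact_mod_cast hX'))
      have h2 := h.sum_one_sub_density_sq_le hY'ne
        ((hF Y hY).2.1.subset (by exact_mod_cast hY'))
      have hNr : N / #X' ≤ N / r := by gcongr
      rw [← hc] at h2
      have h3 := sum_add_sum_blocks_le
        (g := fun v => (1 - ρ X' v) ^ 2 + (1 - ρ Y' v) ^ 2) (fun v => by positivity) hd hU
      have h4 : ∑ _Z ∈ F, ((t : ℝ) - 2 * (ε * t))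
          ≤ ∑ Z ∈ F, ∑ v ∈ Z, ((1 - ρ X' v) ^ 2 + (1 - ρ Y' v) ^ 2) := by
        refine sum_le_sum fun Z hZ => ?_
        have : ∑ v ∈ Z, (1 - 2 * (ρ X' v * ρ Y' v))
            ≤ ∑ v ∈ Z, ((1 - ρ X' v) ^ 2 + (1 - ρ Y' v) ^ 2) :=
          sum_le_sum fun v _ => by nlinarith [sq_nonneg (ρ X' v + ρ Y' v - 1)]
        rw [sum_sub_distrib, ← mul_sum, sum_const, nsmul_eq_mul, (hF Z hZ).1] at this
        linarith [hcod Z hZ]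
      rw [sum_const, nsmul_eq_mul] at h4
      simp only [sum_add_distrib] at h3 h4
      have h5 := hUb (ρ X')
      have h6 := hUb (ρ Y')
      have h7 := hsub X hX X' hX' hpos
      have h8 := hsub Y hY Y' hY' (hc ▸ hpos)
      have h9 : (#F : ℝ) * (t - 2 * (ε * t)) = (1 - 2 * ε) * b := by rw [hb]; ring
      rw [hE]
      linarith)
    (by
      intro X hX
      have h1 := h.sum_one_sub_density_sq_le (hne X hX) (hF X hX).2.1
      rw [(hF X hX).1] at h1
      have h3 := sum_add_sum_blocks_le (g := fun v => (1 - ρ X v) ^ 2)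
        (fun v => sq_nonneg _) hd hU
      set P := {Y ∈ F | ¬ ε * (t : ℝ) ^ 2 ≤ ∑ x ∈ X, ∑ y ∈ Y, redIndicator R x y} with hP
      have h4 : ∑ _Z ∈ P, ((t : ℝ) - 2 * (ε * t)) ≤ ∑ Z ∈ F, ∑ v ∈ Z, (1 - ρ X v) ^ 2 := by
        refine le_trans (sum_le_sum fun Z hZ => ?_) (sum_le_sum_of_subset_of_nonneg
          (filter_subset _ _) fun Z _ _ => sum_nonneg fun v _ => sq_nonneg _)
        obtain ⟨hZF, hZ⟩ := mem_filter.mp hZ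
        have : ∑ v ∈ Z, (1 - 2 * ρ X v) ≤ ∑ v ∈ Z, (1 - ρ X v) ^ 2 :=
          sum_le_sum fun v _ => by nlinarith [sq_nonneg (ρ X v)]
        rw [sum_sub_distrib, ← mul_sum, sum_const, nsmul_eq_mul, (hF Z hZF).1, hρ,
          sum_averageOver, (hF X hX).1] at this
        have hlt : (∑ x ∈ X, ∑ y ∈ Z, redIndicator R x y) / t ≤ ε * t := by
          rw [div_le_iff₀ ht0]
          linarith [not_le.mp hZ]
        linarith
      rw [sum_const, nsmul_eq_mul] at h4
      have h5 := hUb (ρ X)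
      have h6 : (#P : ℝ) * (ε * t) ≤ #F * (ε * t) := by
        gcongr
        exact filter_subset _ _
      have h7 : (#F : ℝ) * (ε * t) = ε * b := by rw [hb]; ring
      linarith)
  have hsum : (t : ℝ) * ∑ X ∈ F, ∑ w ∈ U, ρ X w
      = ∑ x ∈ F.biUnion id, ∑ w ∈ U, redIndicator R x w := by
    rw [sum_biUnion hd, mul_sum]
    refine sum_congr rfl fun X hX => ?_
    rw [hρ, sum_averageOver, (hF X hX).1, id]
    field_simp
  rw [← hb] at hstar
  linarith

theorem degree_estimates_of_bounds {u b D n N α ε : ℝ} (hu : 0 < u) (hα : α ≤ 1 / 4)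
    (hε : 0 < ε) (hε₁ : ε ≤ 1 / 1000) (hn : 0 < n) (hN : N ≤ 4 * n)
    (h₁ : u ^ 3 - 2 * u * (2 * ε * u ^ 2) ≤ u ^ 2 * (α * n) + 2 * ε * u ^ 2 * N)
    (h₂ : u * D ≤ u ^ 2 * b / 8 + 2 * (u ^ 2 * (α * n) + 2 * ε * u ^ 2 * N)
      - 2 * (u ^ 3 - 2 * u * (2 * ε * u ^ 2))) :
    u ≤ n ∧ D ≤ u * b / 8 + 2 * u * (α * n - u) + 192 * ε * n ^ 2 := by
  have hu2 : 0 < u ^ 2 := by positivity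
  have h₃ : u - 4 * ε * u ≤ α * n + 2 * ε * N := by
    refine le_of_mul_le_mul_left ?_ hu2
    linarith
  have h₄ : D ≤ u * b / 8 + 2 * (u * (α * n) + 2 * ε * u * N) - 2 * (u ^ 2 - 4 * ε * u ^ 2) := by
    refine le_of_mul_le_mul_left ?_ hu
    linarith
  have h₅ : α * n ≤ 1 / 4 * n := by gcongr
  have h₆ : ε * N ≤ ε * (4 * n) := by gcongr
  have h₇ : ε * n ≤ 1 / 1000 * n := by gcongr
  have h₈ : ε * u ≤ 1 / 1000 * u := by gcongr
  have hun : u ≤ n := by linarith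
  refine ⟨hun, ?_⟩
  have h₉ : ε * N * u ≤ ε * (4 * n) * n := by gcongr
  have h₁₀ : ε * u ^ 2 ≤ ε * n ^ 2 := by gcongr
  have : 0 < ε * n ^ 2 := by positivity
  linarith

/-- The two estimates for the red degrees into the uncovered set are incompatible. -/
theorem degree_estimates_incompatible {u y D E n N α ε z₁ z₂ : ℝ} (hα : 1 / 6 ≤ α) (hα₂ : α ≤ 1 / 4)
    (hε : 0 < ε) (hε₁ : ε ≤ 1 / 1000) (hn : 1 ≤ ε * n) (hn₀ : 0 < n) (hu : 0 ≤ u) (hun : u ≤ n)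
    (hN₁ : (3 / 2 + 3 * α + 1000 * ε) * n ≤ N) (hN : N ≤ 4 * n) (hy : 0 ≤ y) (hyn : y ≤ ε * n)
    (hz₁ : 0 ≤ z₁) (hz₁n : z₁ ≤ ε * n) (hz₂n : z₂ ≤ ε * n)
    (hD : D ≤ u * (N - u) / 8 + 2 * u * (α * n - u) + 192 * ε * n ^ 2)
    (hE : E = 2 / 3 * (15 / 8 * u + (1 - 2 * ε) * (N - u - y) - 2 * (n + 1 + z₁)) - 2 * (ε * n)) :
    0 ≤ E ∧ D < (N - u - y) * E / 2 - E * (z₂ + ε * (N - u - y)) := by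
  have hεn : 0 < ε * n := by positivity
  have hαn : 1 / 6 * n ≤ α * n := by gcongr
  have hWn : n ≤ N - u := by linarith
  have hεb : ε * (N - u - y) ≤ ε * (4 * n) := by gcongr; linarith
  have hεb₀ : 0 ≤ ε * (N - u - y) := by
    have : ε * n ≤ 1 / 1000 * n := by gcongr
    exact mul_nonneg hε.le (by linarith)
  have hElow : 2 / 3 * (N - u + 15 / 8 * u - 2 * n) - 11 * (ε * n) ≤ E := by linarith
  have hEup : E ≤ 5 * n := by linarith
  have hE₀ : 0 ≤ E := by linarith
  refine ⟨hE₀, ?_⟩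
  have h₁ : E * (z₂ + ε * (N - u - y)) ≤ 5 * n * (5 * (ε * n)) :=
    (mul_le_mul_of_nonneg_left (by linarith) hE₀).trans
      (mul_le_mul_of_nonneg_right hEup (by positivity))
  have h₂ : y * E ≤ ε * n * (5 * n) := mul_le_mul hyn hEup hE₀ hεn.le
  have h₃ : (N - u) * (2 / 3 * (N - u + 15 / 8 * u - 2 * n) - 11 * (ε * n)) ≤ (N - u) * E :=
    mul_le_mul_of_nonneg_left hElow (by linarith)
  have h₄ : (N - u) * (ε * n) ≤ 4 * n * (ε * n) :=
    mul_le_mul_of_nonneg_right (by linarith) hεn.le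
  have h₅ : 6 * u * (α * n - u) ≤ 3 * α * u * (N - u) := by
    nlinarith [mul_nonneg (mul_nonneg (by linarith : 0 ≤ α) hu) (by linarith : 0 ≤ N - 2 * n),
      mul_nonneg hu hu]
  have h₆ : (N - u) * (1000 * (ε * n)) ≤ (N - u) * (N - 2 * n - 3 * u * (α - 1 / 6)) := by
    refine mul_le_mul_of_nonneg_left ?_ (by linarith)
    have : u * (α - 1 / 6) ≤ n * (α - 1 / 6) := by gcongr
    linarith
  have h₇ : n * (1000 * (ε * n)) ≤ (N - u) * (1000 * (ε * n)) :=
    mul_le_mul_of_nonneg_right hWn (by positivity)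
  have : 0 < n * (ε * n) := by positivity
  nlinarith

/-- Colourings of large complete graphs have a large red or a large blue book. -/
theorem exists_not_bookBounded {α η : ℝ} (hα₁ : 1 / 6 ≤ α) (hα₂ : α ≤ 1 / 4) (hη : 0 < η)
    (hη₁ : η ≤ 1) : ∃ n₀ : ℕ, ∀ n : ℕ, n₀ ≤ n → ∀ {V : Type} [Fintype V] (R : SimpleGraph V),
      (3 / 2 + 3 * α + η) * n ≤ (Fintype.card V : ℝ) → (Fintype.card V : ℝ) ≤ 4 * n →
      ¬ BookBounded R (α * n) (n + 1) := by
  classical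
  obtain ⟨ε, rfl⟩ : ∃ ε : ℝ, η = 1000 * ε := ⟨η / 1000, by ring⟩
  have hε : 0 < ε := by linarith
  have hε₁ : ε ≤ 1 / 1000 := by linarith
  obtain ⟨k, hk⟩ := exists_nat_gt (4 / ε)
  have hk0 : (0 : ℝ) < k := lt_trans (by positivity) hk
  have hkpos : 0 < k := by exact_mod_cast hk0
  rw [div_lt_iff₀' hε] at hk
  obtain ⟨Mp, hMp⟩ := exists_red_pair hε (by linarith) hkpos k
  set t := max Mp k with ht
  have htk : k ≤ t := le_max_right _ _
  have htpos : 0 < t := hkpos.trans_le htk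
  have ht₀pos : 0 < k * (k * t) := by positivity
  obtain ⟨M, hM⟩ := exists_sum_blue_le hε (by linarith) hkpos (k * (k * t))
  refine ⟨k * (M + 1), fun n hn V _ R hN₁ hN h => ?_⟩
  set N : ℝ := (Fintype.card V : ℝ) with hNdef
  have hn4 : 4 * ((M : ℝ) + 1) ≤ ε * n := by
    have h₁ : (k : ℝ) * (M + 1) ≤ n := by exact_mod_cast hn
    have h₂ : ε * (k * (M + 1)) ≤ ε * n := by gcongr
    have h₃ : 4 * ((M : ℝ) + 1) ≤ ε * k * (M + 1) := by gcongr
    linarith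
  have hM0 : (0 : ℝ) ≤ M := Nat.cast_nonneg _
  have hn0 : (0 : ℝ) < n := by
    by_contra! hcon
    nlinarith
  have hεn : ε * n ≤ 1 / 1000 * n := by gcongr
  have hNdiv : ∀ m : ℕ, k ≤ m → N / m ≤ ε * n := by
    intro m hm
    have hm' : (k : ℝ) ≤ m := by exact_mod_cast hm
    rw [div_le_iff₀ (by linarith)]
    have : ε * k * n ≤ ε * m * n := by gcongr
    nlinarith
  have hNk := hNdiv k le_rfl
  have hred : 6 * (α * n) + 3 * ((n : ℝ) + 1 + N / k) < 2 * N := by linarith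
  have hblue : 3 * ((n : ℝ) + 1) + 6 * (α * n + N / k) < 2 * N := by linarith
  have hNt := hNdiv t htk
  obtain ⟨F₁, hF₁, hd₁, hmax⟩ := exists_maximal_disjoint_family
    (fun T : Finset V => Rᶜ.IsClique T) ht₀pos univ
  obtain ⟨W, hW⟩ : ∃ W : Finset V, W = F₁.biUnion id := ⟨_, rfl⟩
  set U : Finset V := univ \ W with hU
  have hUW : Disjoint U W := sdiff_disjoint
  have hcard : (#U : ℝ) + #W = N := by
    have := card_sdiff_add_card_eq_card (subset_univ W)
    rw [← hU, card_univ] at this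
    rw [hNdef]
    exact_mod_cast this
  set D : ℝ := ∑ x ∈ W, ∑ w ∈ U, redIndicator R x w with hD
  have hu0 : (0 : ℝ) ≤ #U := Nat.cast_nonneg _
  have hupper : (#U : ℝ) ≤ n ∧
      D ≤ #U * (N - #U) / 8 + 2 * #U * (α * n - #U) + 192 * ε * (n : ℝ) ^ 2 := by
    have hW' : N - #U = #W := by linarith
    rw [hW']
    rcases le_or_gt (max M 1) #U with hMU | hMU
    · have hq := hM U h hblue (fun T hT hTc => hmax T (by rw [hU, hW] at hT; convert hT) hTc)
        ((le_max_left _ _).trans hMU)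
      obtain ⟨h₁, h₂⟩ := h.degree_bounds hUW hq
      have hUpos : 0 < #U := (le_max_right M 1).trans hMU
      exact degree_estimates_of_bounds (by exact_mod_cast hUpos) hα₂ hε hε₁ hn0 hN h₁ h₂
    · have hUM : (#U : ℝ) ≤ M := by
        have : #U ≤ M := by omega
        exact_mod_cast this
      have hD' : D ≤ #W * #U := by
        have : ∀ x ∈ W, ∑ w ∈ U, redIndicator R x w ≤ #U := fun x _ => by
          simpa using sum_le_card_nsmul U _ 1 fun w _ => redIndicator_le_one R x w
        simpa using sum_le_card_nsmul W _ _ this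
      have h₁ : (#W : ℝ) * #U ≤ 4 * n * (ε * n) := by
        refine mul_le_mul (by linarith) (by linarith) hu0 (by positivity)
      have h₂ : (#U : ℝ) * #U ≤ n * (ε * n) :=
        mul_le_mul (by linarith) (by linarith) hu0 (by positivity)
      have h₃ : 0 ≤ (#U : ℝ) * #W / 8 := by positivity
      have h₄ : 0 ≤ 2 * (#U : ℝ) * (α * n) := by
        have : 0 ≤ α := by linarith
        positivity
      have : 0 < n * (ε * n) := by positivity
      exact ⟨by linarith, by nlinarith⟩
  obtain ⟨F₂, hF₂, hd₂, hF₂c⟩ := exists_leveled_family Rᶜ (g := fun x => ∑ w ∈ U, redIndicator R x w)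
    (τ := ε * n) (K := k) (t := t) (J := k) (by positivity) htpos
    (fun x => ⟨sum_nonneg fun w _ => redIndicator_nonneg R x w, by
      have : ∑ w ∈ U, redIndicator R x w ≤ #U := by
        simpa using sum_le_card_nsmul U _ 1 fun w _ => redIndicator_le_one R x w
      nlinarith [hupper.1]⟩)
    (fun X hX => (hF₁ X hX).2) hd₁
  rw [← hW] at hF₂ hF₂c
  have hsub : F₂.biUnion id ⊆ W := biUnion_subset.mpr fun T hT => (hF₂ T hT).1
  obtain ⟨y, hy⟩ : ∃ y : ℝ, y = #(W \ F₂.biUnion id) := ⟨_, rfl⟩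
  have hb : N - #U - y = t * #F₂ := by
    have h₁ : #(F₂.biUnion id) = #F₂ * t := by
      rw [card_biUnion hd₂]
      exact sum_const_nat fun X hX => (hF₂ X hX).2.1
    have h₂ : (y : ℝ) + #(F₂.biUnion id) = #W := by
      rw [hy]
      exact_mod_cast card_sdiff_add_card_eq_card hsub
    rw [h₁] at h₂
    push_cast at h₂
    linarith
  have hy0 : 0 ≤ y := hy ▸ Nat.cast_nonneg _
  have hyn : y ≤ ε * n := by
    have h₁ : (k : ℝ) * y ≤ #W := by rw [hy]; exact_mod_cast hF₂c
    have h₂ : 4 * y ≤ ε * k * y := by gcongr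
    have h₃ : ε * (k * y) ≤ ε * #W := by gcongr
    have h₄ : ε * #W ≤ ε * (4 * n) := by gcongr; linarith
    linarith
  have hαn : 1 / 6 * (n : ℝ) ≤ α * n := by gcongr
  have hF₂ne : F₂.Nonempty := by
    rw [nonempty_iff_ne_empty]
    rintro rfl
    rw [card_empty, Nat.cast_zero, mul_zero] at hb
    nlinarith [hupper.1, mul_pos hε hn0]
  obtain ⟨hE₀, hlt⟩ := degree_estimates_incompatible (z₁ := N / k) (z₂ := N / t) hα₁ hα₂ hε hε₁
    (by linarith) hn0 hu0 hupper.1 hN₁ hN hy0 hyn (by positivity) hNk hNt hupper.2 rfl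
  have hlow := h.degree_sum_lower_bound hε.le htpos hkpos
    (fun X hX => (hF₂ X hX).2) hd₂ (hUW.mono_right hsub) (by positivity : 0 ≤ ε * n) hF₂ne
    (hMp t F₂ h hred (le_max_left _ _) fun X hX => ⟨(hF₂ X hX).2.1, (hF₂ X hX).2.2.1⟩)
    hb rfl hE₀
  have hmono : ∑ x ∈ F₂.biUnion id, ∑ w ∈ U, redIndicator R x w ≤ D :=
    sum_le_sum_of_subset_of_nonneg hsub fun x _ _ => sum_nonneg fun w _ => redIndicator_nonneg R x w
  linarith

theorem HasBook.of_comap {V W : Type} [Finite W] {G : SimpleGraph W} (f : V ↪ W) {m : ℕ}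
    (h : HasBook (G.comap f) m) : HasBook G m := by
  obtain ⟨u, v, huv, hm⟩ := h
  refine ⟨f u, f v, huv, hm.trans ?_⟩
  rw [← Set.ncard_image_of_injective _ f.injective]
  refine Set.ncard_le_ncard ?_ (Set.toFinite _)
  rintro _ ⟨w, hw, rfl⟩
  exact hw

theorem compl_comap_eq {V W : Type} (G : SimpleGraph W) (f : V ↪ W) :
    (G.comap f)ᶜ = Gᶜ.comap f := by
  ext u v
  simp [SimpleGraph.compl_adj, f.injective.eq_iff]

/-- A graph without books of the given sizes in it and its complement has bounded codegrees. -/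
theorem bookBounded_of_not_hasBook {V : Type} [Fintype V] {R : SimpleGraph V} {c : ℝ} (hc : 0 ≤ c)
    {n : ℕ} (hR : ¬ HasBook R ⌈c⌉₊) (hB : ¬ HasBook Rᶜ n) : BookBounded R c (n + 1) := by
  classical
  have hcard : ∀ (G : SimpleGraph V) [DecidableRel G.Adj] (x y : V),
      ({w | G.Adj x w ∧ G.Adj y w} : Set V).ncard = #{w | G.Adj x w ∧ G.Adj y w} := fun G _ x y => by
    rw [← Set.ncard_coe_finset]
    simp
  refine ⟨hc, by positivity, fun x y hxy => ?_, fun x y hxy => ?_⟩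
  · by_contra! hcon
    refine hR ⟨x, y, hxy, Nat.ceil_le.mpr (hcon.le.trans_eq ?_)⟩
    rw [hcard, ← sum_boole]
    refine sum_congr rfl fun w _ => ?_
    unfold redIndicator
    split_ifs <;> simp_all
  · have hlt : ({w | Rᶜ.Adj x w ∧ Rᶜ.Adj y w} : Set V).ncard < n :=
      not_le.mp fun hle => hB ⟨x, y, hxy, hle⟩
    rw [hcard] at hlt
    have hle : ∑ w, (1 - redIndicator R x w) * (1 - redIndicator R y w)
        ≤ ∑ w, ((if Rᶜ.Adj x w ∧ Rᶜ.Adj y w then (1 : ℝ) else 0)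
          + ((if w = x then 1 else 0) + if w = y then 1 else 0)) := by
      refine sum_le_sum fun w _ => ?_
      rcases eq_or_ne w x with rfl | hwx
      · unfold redIndicator
        split_ifs <;> simp_all
      rcases eq_or_ne w y with rfl | hwy
      · unfold redIndicator
        split_ifs <;> simp_all
      simp only [SimpleGraph.compl_adj, hwx, hwy, redIndicator]
      by_cases h₁ : R.Adj x w <;> by_cases h₂ : R.Adj y w <;> simp [h₁, h₂, hwx.symm, hwy.symm]
    rw [sum_add_distrib, sum_add_distrib, sum_boole, sum_ite_eq', sum_ite_eq', if_pos (mem_univ _),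
      if_pos (mem_univ _)] at hle
    have : ((#{w | Rᶜ.Adj x w ∧ Rᶜ.Adj y w} : ℕ) : ℝ) + 1 ≤ n := by exact_mod_cast hlt
    linarith

end BookRamsey

/-- For `1/6 ≤ α ≤ 1/4`, `r(B_{⌈αn⌉}, B_n) ≤ (3/2 + 3α) n + o(n)`. -/
theorem ramsey_book_upper_bound (α η : ℝ) (hα1 : 1/6 ≤ α) (hα2 : α ≤ 1/4) (hη : 0 < η) :
    ∃ n₀ : ℕ, ∀ n : ℕ, n₀ ≤ n →
      ∀ N : ℕ, (3/2 + 3 * α + η) * (n : ℝ) ≤ (N : ℝ) →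
        ∀ R : SimpleGraph (Fin N), HasBook R ⌈α * (n : ℝ)⌉₊ ∨ HasBook Rᶜ n := by
  obtain ⟨n₀, h⟩ := exists_not_bookBounded hα1 hα2 (lt_min hη one_pos) (min_le_right η 1)
  refine ⟨max n₀ 2, fun n hn N hN R => ?_⟩
  have hn₂ : (2 : ℝ) ≤ n := by exact_mod_cast (le_max_right _ _).trans hn
  by_contra! hcon
  set A : ℝ := (3 / 2 + 3 * α + min η 1) * n with hA
  have hA₀ : 0 ≤ A := by
    have : 0 < min η 1 := lt_min hη one_pos
    have : 0 ≤ α := by linarith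
    positivity
  have hAN : A ≤ N := by
    refine le_trans ?_ hN
    rw [hA]
    gcongr
    exact min_le_left _ _
  have hA₄ : A ≤ 13 / 4 * n := by
    rw [hA]
    gcongr
    linarith [min_le_right η 1]
  have hle : ⌈A⌉₊ ≤ N := Nat.ceil_le.mpr hAN
  set f : Fin ⌈A⌉₊ ↪ Fin N := Fin.castLEEmb hle with hf
  refine h n ((le_max_left _ _).trans hn) (R.comap f) ?_ ?_ (bookBounded_of_not_hasBook ?_ ?_ ?_)
  · rw [Fintype.card_fin]
    exact Nat.le_ceil A
  · rw [Fintype.card_fin]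
    linarith [Nat.ceil_lt_add_one hA₀]
  · have : 0 ≤ α := by linarith
    positivity
  · exact fun hb => hcon.1 hb.of_comap
  · rw [compl_comap_eq]
    exact fun hb => hcon.2 hb.of_comap
end
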